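/- arXiv:1809.09471 — 3 statements merged into one kernel-verified Lean document; each statement's English description precedes it below -/
import Mathlib

section
/- Let Ω ⊆ ℝ^d be a convex body and let Σ ⊆ ℝ^d be any d-simplex. Then for every p ∈ int Ω and every q ∈ int Σ, the asymptotic volumes (as elements of [0,∞]) satisfy liminf_{R→∞} Vol^B_{int Ω}(B_{int Ω}(p,R))/R^d ≥ liminf_{R→∞} Vol^B_{int Σ}(B_{int Σ}(q,R))/R^d, with equality if and only if Ω is a d-simplex. -/
open Filter Set MeasureTheory Metric
open scoped ENNReal Topology Pointwise RealInnerProductSpace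

noncomputable section
open scoped Classical

abbrev Euc (d : ℕ) := EuclideanSpace ℝ (Fin d)

/-- The Hilbert distance on a bounded open convex set `U`. -/
def hilbertDist {d : ℕ} (U : Set (Euc d)) (p q : Euc d) : ℝ :=
  if p = q then 0
  else
    (1 / 2) * Real.log
      (((1 - sInf {t : ℝ | p + t • (q - p) ∈ U}) / (- sInf {t : ℝ | p + t • (q - p) ∈ U})) *
        (sSup {t : ℝ | p + t • (q - p) ∈ U} / (sSup {t : ℝ | p + t • (q - p) ∈ U} - 1)))

/-- The closed Hilbert ball. -/
def hilbertBall {d : ℕ} (U : Set (Euc d)) (p : Euc d) (R : ℝ) : Set (Euc d) :=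
  {q ∈ U | hilbertDist U p q ≤ R}

/-- The Finsler (Hilbert) norm `F_U(p, v)`. -/
def finslerNorm {d : ℕ} (U : Set (Euc d)) (p v : Euc d) : ℝ :=
  if v = 0 then 0
  else (1 / 2) * (1 / sSup {t : ℝ | 0 < t ∧ p + t • v ∈ U}
                + 1 / sSup {t : ℝ | 0 < t ∧ p - t • v ∈ U})

/-- The unit ball `β_U(p)` of the Finsler norm. -/
def finslerUnitBall {d : ℕ} (U : Set (Euc d)) (p : Euc d) : Set (Euc d) :=
  {v | finslerNorm U p v < 1}

/-- The Busemann volume of `A ⊆ U`. -/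
def busemannVol {d : ℕ} (U : Set (Euc d)) (A : Set (Euc d)) : ℝ≥0∞ :=
  ∫⁻ p in A, volume (Metric.ball (0 : Euc d) 1) / volume (finslerUnitBall U p)

/-- The polar body `K°`. -/
def polarSet {d : ℕ} (K : Set (Euc d)) : Set (Euc d) :=
  {y | ∀ v ∈ K, ⟪v, y⟫ ≤ (1 : ℝ)}

/-- The Holmes–Thompson volume of `A ⊆ U`. -/
def htVol {d : ℕ} (U : Set (Euc d)) (A : Set (Euc d)) : ℝ≥0∞ :=
  ∫⁻ p in A, volume (polarSet (finslerUnitBall U p)) / volume (Metric.ball (0 : Euc d) 1)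

/-- The asymptotic ball `AsB_U(y, R)`. -/
def asympBall {d : ℕ} (U : Set (Euc d)) (y : Euc d) (R : ℝ) : Set (Euc d) :=
  if 0 < R then (fun u => y + (1 - Real.exp (-2 * R)) • (u - y)) '' U else ∅

/-- `F` is a face of the compact convex set `P`. -/
def IsFace {d : ℕ} (P F : Set (Euc d)) : Prop :=
  F.Nonempty ∧ IsClosed F ∧ Convex ℝ F ∧ IsExtreme ℝ P F

/-- The dimension of a set: the dimension of its affine span. -/
def faceDim {d : ℕ} (F : Set (Euc d)) : ℕ :=
  Module.finrank ℝ (affineSpan ℝ F).direction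

/-- The set of maximal flags of a `dm`-dimensional polytope `P ⊆ ℝ^d`. -/
def flagSet {d : ℕ} (dm : ℕ) (P : Set (Euc d)) : Set (Fin (dm + 1) → Set (Euc d)) :=
  {f | (∀ i, IsFace P (f i) ∧ faceDim (f i) = (i : ℕ)) ∧
       ∀ i j : Fin (dm + 1), i ≤ j → f i ⊆ f j}

/-- `N(ε, Ω)`: the least number of maximal flags of a `d`-dimensional polytope within
Hausdorff distance `ε` of `Ω`. -/
def flagNumber (d : ℕ) (Ω : Set (Euc d)) (ε : ℝ) : ℕ :=
  sInf {n | ∃ V : Finset (Euc d), V.Nonempty ∧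
    faceDim (convexHull ℝ (V : Set (Euc d))) = d ∧
    Metric.hausdorffDist (convexHull ℝ (V : Set (Euc d))) Ω ≤ ε ∧
    (flagSet d (convexHull ℝ (V : Set (Euc d)))).ncard = n}

/-- The flag approximability `a_f(Ω)`. -/
def flagApprox (d : ℕ) (Ω : Set (Euc d)) : ℝ :=
  liminf (fun ε : ℝ => Real.log (flagNumber d Ω ε) / (- Real.log ε)) (𝓝[>] 0)

/-- `s` is a `dm`-simplex. -/
def IsSimplexSet {d : ℕ} (dm : ℕ) (s : Set (Euc d)) : Prop :=
  ∃ v : Fin (dm + 1) → Euc d, AffineIndependent ℝ v ∧ s = convexHull ℝ (Set.range v)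

/-- `S` is a flag simplex of the `dm`-dimensional polytope `P`. -/
def IsFlagSimplex {d : ℕ} (dm : ℕ) (P S : Set (Euc d)) : Prop :=
  ∃ f ∈ flagSet dm P, ∃ v : Fin (dm + 1) → Euc d, AffineIndependent ℝ v ∧
    S = convexHull ℝ (Set.range v) ∧ ∀ i, v i ∈ intrinsicInterior ℝ (f i)

/-- The Macbeath region `M'(x)`. -/
def macbeath {d : ℕ} (Ω : Set (Euc d)) (x : Euc d) : Set (Euc d) :=
  (fun v => x + v) ''
    (((5 : ℝ)⁻¹ • ((fun w => w - x) '' Ω)) ∩ ((5 : ℝ)⁻¹ • ((fun w => x - w) '' Ω)))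

/-- The Funk distance with respect to the convex body `Ω`. -/
def funkDist {d : ℕ} (Ω : Set (Euc d)) (p q : Euc d) : ℝ :=
  if p = q then 0
  else Real.log (sSup {t : ℝ | p + t • (q - p) ∈ Ω} /
        (sSup {t : ℝ | p + t • (q - p) ∈ Ω} - 1))

/-- admissible families of affine functions: nonnegative on `K`. -/
def Adm {n : ℕ} (K : Set (Fin n → ℝ)) (A : Matrix (Fin n) (Fin n) ℝ) (c : Fin n → ℝ) : Prop :=
  ∀ x ∈ K, ∀ i, 0 ≤ (A.mulVec x + c) i

/-- the lower density attached to `K`. -/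
def mden {n : ℕ} (K : Set (Fin n → ℝ)) (x : Fin n → ℝ) : ℝ≥0∞ :=
  ⨆ (A : Matrix (Fin n) (Fin n) ℝ), ⨆ (c : Fin n → ℝ), ⨆ (_ : Adm K A c),
    ENNReal.ofReal |A.det| * (ENNReal.ofReal (∏ i, (A.mulVec x + c) i))⁻¹

/-- the asymptotic ball. -/
def DD {n : ℕ} (K : Set (Fin n → ℝ)) (b : Fin n → ℝ) (ρ : ℝ) : Set (Fin n → ℝ) :=
  (fun z => ρ • b + (1 - ρ) • z) '' K

/-- the lower volume. -/
def II {n : ℕ} (K : Set (Fin n → ℝ)) (b : Fin n → ℝ) (T : ℝ) : ℝ≥0∞ :=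
  ∫⁻ x in DD K b (Real.exp (-T)), mden K x

/-- slices. -/
def slice {n : ℕ} (K : Set (Fin (n + 1) → ℝ)) (s : ℝ) : Set (Fin n → ℝ) :=
  {y | (Fin.cons s y : Fin (n + 1) → ℝ) ∈ K}

lemma measurable_mden {n : ℕ} (K : Set (Fin n → ℝ)) : Measurable (mden K) := by
  apply LowerSemicontinuous.measurable
  unfold mden
  refine lowerSemicontinuous_iSup fun A => lowerSemicontinuous_iSup fun c =>
    lowerSemicontinuous_iSup fun _ => Continuous.lowerSemicontinuous ?_
  apply ENNReal.continuous_const_mul ENNReal.ofReal_ne_top |>.comp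
  apply continuous_inv.comp
  apply ENNReal.continuous_ofReal.comp
  fun_prop

lemma isCompact_DD {n : ℕ} {K : Set (Fin n → ℝ)} (hK : IsCompact K) (b : Fin n → ℝ) (ρ : ℝ) :
    IsCompact (DD K b ρ) := by
  apply hK.image
  fun_prop

lemma le_mden {n : ℕ} {K : Set (Fin n → ℝ)} {A : Matrix (Fin n) (Fin n) ℝ} {c : Fin n → ℝ}
    (h : Adm K A c) (x : Fin n → ℝ) :
    ENNReal.ofReal |A.det| * (ENNReal.ofReal (∏ i, (A.mulVec x + c) i))⁻¹ ≤ mden K x := by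
  unfold mden
  exact le_iSup_of_le A (le_iSup_of_le c (le_iSup_of_le h le_rfl))

lemma extend_aff {n : ℕ} {K : Set (Fin (n + 1) → ℝ)} (hK : Convex ℝ K) {s : ℝ}
    (h' : (Fin n → ℝ) →ₗ[ℝ] ℝ) (c : ℝ) (hpos : ∀ y ∈ slice K s, 0 ≤ h' y + c)
    {u w : Fin (n + 1) → ℝ} (hu : u ∈ K) (hus : u 0 < s) (hw : w ∈ K) (hws : s < w 0) :
    ∃ α : ℝ, ∀ x ∈ K, 0 ≤ α * (x 0 - s) + (h' (Fin.tail x) + c) := by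
  have key : ∀ x ∈ K, ∀ z ∈ K, x 0 < s → s < z 0 →
      -(h' (Fin.tail z) + c) / (z 0 - s) ≤ (h' (Fin.tail x) + c) / (s - x 0) := by
    intro x hx z hz hxs hzs
    have h1 : 0 < z 0 - s := by linarith
    have h2 : 0 < s - x 0 := by linarith
    have h3 : 0 < z 0 - x 0 := by linarith
    set a := (z 0 - s) / (z 0 - x 0) with ha
    set e := (s - x 0) / (z 0 - x 0) with he
    have hae : a + e = 1 := by rw [ha, he]; field_simp; ring
    have hmem : a • x + e • z ∈ K := hK hx hz (by positivity) (by positivity) hae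
    have h0 : a * x 0 + e * z 0 = s := by rw [ha, he]; field_simp; ring
    have hsl : a • Fin.tail x + e • Fin.tail z ∈ slice K s := by
      show (Fin.cons s _ : Fin (n + 1) → ℝ) ∈ K
      convert hmem using 1
      ext i
      refine Fin.cases ?_ (fun i => ?_) i
      · simp [h0]
      · simp [Fin.tail]
    have := hpos _ hsl
    simp only [map_add, map_smul, smul_eq_mul] at this
    rw [div_le_div_iff₀ h1 h2]
    have h4 : 0 ≤ (z 0 - s) * (h' (Fin.tail x) + c) + (s - x 0) * (h' (Fin.tail z) + c) := by
      have h5 : (z 0 - s) = a * (z 0 - x 0) := by rw [ha]; field_simp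
      have h6 : (s - x 0) = e * (z 0 - x 0) := by rw [he]; field_simp
      rw [h5, h6]
      have h7 : a * (z 0 - x 0) * (h' (Fin.tail x) + c) + e * (z 0 - x 0) * (h' (Fin.tail z) + c)
        = (z 0 - x 0) * (a * h' (Fin.tail x) + e * h' (Fin.tail z) + (a + e) * c) := by ring
      rw [h7, hae, one_mul]
      positivity
    nlinarith
  set S : Set ℝ := {r | ∃ z ∈ K, s < z 0 ∧ r = -(h' (Fin.tail z) + c) / (z 0 - s)} with hS
  have hne : S.Nonempty := ⟨_, w, hw, hws, rfl⟩
  have hbdd : BddAbove S := by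
    refine ⟨(h' (Fin.tail u) + c) / (s - u 0), ?_⟩
    rintro r ⟨z, hz, hzs, rfl⟩
    exact key u hu z hz hus hzs
  refine ⟨sSup S, fun x hx => ?_⟩
  rcases lt_trichotomy (x 0) s with h | h | h
  · have : sSup S ≤ (h' (Fin.tail x) + c) / (s - x 0) := by
      apply csSup_le hne
      rintro r ⟨z, hz, hzs, rfl⟩
      exact key x hx z hz h hzs
    rw [le_div_iff₀ (by linarith)] at this
    linarith
  · rw [h, sub_self, mul_zero, zero_add]
    apply hpos
    show (Fin.cons s _ : Fin (n + 1) → ℝ) ∈ K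
    rw [← h, Fin.cons_self_tail]
    exact hx
  · have : -(h' (Fin.tail x) + c) / (x 0 - s) ≤ sSup S := le_csSup hbdd ⟨x, hx, h, rfl⟩
    rw [div_le_iff₀ (by linarith)] at this
    linarith

lemma mden_slice {n : ℕ} {K : Set (Fin (n + 1) → ℝ)} (hK : Convex ℝ K) {s : ℝ} (hs : 0 < s)
    (hK0 : ∀ x ∈ K, 0 ≤ x 0)
    {u w : Fin (n + 1) → ℝ} (hu : u ∈ K) (hus : u 0 < s) (hw : w ∈ K) (hws : s < w 0)
    (y : Fin n → ℝ) :
    (ENNReal.ofReal s)⁻¹ * mden (slice K s) y ≤ mden K (Fin.cons s y) := by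
  conv_lhs => unfold mden
  simp only [ENNReal.mul_iSup]
  refine iSup_le fun A => iSup_le fun c => iSup_le fun hA => ?_
  have : ∀ i, ∃ α : ℝ, ∀ x ∈ K, 0 ≤ α * (x 0 - s) + ((A.mulVec (Fin.tail x)) i + c i) := by
    intro i
    have := extend_aff hK (s := s) ((LinearMap.proj i).comp (Matrix.mulVecLin A)) (c i)
      (fun y hy => by simpa using hA y hy i) hu hus hw hws
    simpa using this
  choose α hα using this
  let A' : Matrix (Fin (n + 1)) (Fin (n + 1)) ℝ :=
    Matrix.of (Fin.cons (Fin.cons 1 0) (fun i => Fin.cons (α i) (A i)))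
  let c' : Fin (n + 1) → ℝ := Fin.cons 0 (fun i => c i - α i * s)
  have h0 : ∀ x, (A'.mulVec x + c') 0 = x 0 := by
    intro x
    simp [A', c', Matrix.mulVec, dotProduct, Fin.sum_univ_succ]
  have hi : ∀ x i, (A'.mulVec x + c') (Fin.succ i)
      = α i * (x 0 - s) + ((A.mulVec (Fin.tail x)) i + c i) := by
    intro x i
    simp [A', c', Matrix.mulVec, dotProduct, Fin.sum_univ_succ, Fin.tail]
    ring
  have hdet : A'.det = A.det := by
    rw [Matrix.det_succ_row_zero, Fin.sum_univ_succ]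
    have : ∀ j : Fin n, A' 0 j.succ = 0 := fun j => by simp [A']
    simp only [this]
    have h00 : A' 0 0 = 1 := by simp [A']
    have hsub : A'.submatrix Fin.succ (Fin.succAbove 0) = A := by
      ext i j
      simp [A']
    rw [h00, hsub]
    simp
  have hadm : Adm K A' c' := by
    intro x hx i
    refine Fin.cases ?_ (fun i => ?_) i
    · rw [h0]; exact hK0 x hx
    · rw [hi]; exact hα i x hx
  refine le_trans (le_of_eq ?_) (le_mden hadm _)
  rw [hdet, Fin.prod_univ_succ, h0]
  simp only [hi, Fin.cons_zero, sub_self, mul_zero, zero_add, Fin.tail_cons]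
  rw [ENNReal.ofReal_mul hs.le, ENNReal.mul_inv (Or.inl (by simpa using hs)) (Or.inl (by simp))]
  simp only [Pi.add_apply]
  ring

lemma DD_slice {n : ℕ} {K : Set (Fin (n + 1) → ℝ)} (hK : Convex ℝ K) (h0 : (0 : Fin (n + 1) → ℝ) ∈ K)
    {b : Fin (n + 1) → ℝ} (hb : b 0 = 1) {s ρ : ℝ} (hρ : 0 < ρ) (hρs : ρ < s) (hs : s < 1)
    {y : Fin n → ℝ} (hy : y ∈ DD (slice K s) (s • Fin.tail b) (ρ / s)) :
    (Fin.cons s y : Fin (n + 1) → ℝ) ∈ DD K b ρ := by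
  obtain ⟨z, hz, rfl⟩ := hy
  have hs0 : 0 < s := hρ.trans hρs
  have hz' : (Fin.cons s z : Fin (n + 1) → ℝ) ∈ K := hz
  set t := (1 - ρ / s) / (1 - ρ) with ht
  have h1 : 0 < 1 - ρ := by linarith
  have h2 : ρ / s < 1 := by rw [div_lt_one hs0]; exact hρs
  have h3 : ρ ≤ ρ / s := by rw [le_div_iff₀ hs0]; nlinarith
  have ht0 : 0 ≤ t := div_nonneg (by linarith) h1.le
  have ht1 : t ≤ 1 := by rw [ht, div_le_one h1]; linarith
  refine ⟨t • Fin.cons s z, ?_, ?_⟩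
  · have := hK hz' h0 ht0 (sub_nonneg.2 ht1) (by ring)
    simpa using this
  · have h4 : (1 - ρ) * t = 1 - ρ / s := by rw [ht]; field_simp
    ext i
    refine Fin.cases ?_ (fun i => ?_) i
    · simp only [Pi.add_apply, Pi.smul_apply, smul_eq_mul, Fin.cons_zero, hb]
      rw [← mul_assoc, h4]; field_simp; ring
    · simp only [Pi.add_apply, Pi.smul_apply, smul_eq_mul, Fin.cons_succ, Fin.tail]
      rw [← mul_assoc (1 - ρ), h4, ← mul_assoc (ρ / s), div_mul_cancel₀ _ hs0.ne']

lemma int_log_pow (n : ℕ) {c a ε : ℝ} (hc : 0 ≤ c) (hε : 0 < ε) (ha : -a ≤ Real.log ε) :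
    ∫⁻ s in Ioo (Real.exp (-a)) ε, ENNReal.ofReal (s⁻¹ * (c * (a + Real.log s) ^ n))
      = ENNReal.ofReal (c / (n + 1) * (a + Real.log ε) ^ (n + 1)) := by
  have hle : Real.exp (-a) ≤ ε := by
    rw [← Real.exp_log hε]; exact Real.exp_le_exp.2 ha
  have hpos : ∀ s ∈ Icc (Real.exp (-a)) ε, 0 < s := fun s hs => (Real.exp_pos _).trans_le hs.1
  have hcont : ContinuousOn (fun s => s⁻¹ * (c * (a + Real.log s) ^ n)) (Icc (Real.exp (-a)) ε) := by
    have h1 : ContinuousOn (fun s : ℝ => s⁻¹) (Icc (Real.exp (-a)) ε) :=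
      continuousOn_inv₀.mono fun s hs => (hpos s hs).ne'
    have h2 : ContinuousOn (fun s : ℝ => Real.log s) (Icc (Real.exp (-a)) ε) :=
      Real.continuousOn_log.mono fun s hs => (hpos s hs).ne'
    fun_prop
  have hint : IntegrableOn (fun s => s⁻¹ * (c * (a + Real.log s) ^ n)) (Icc (Real.exp (-a)) ε) :=
    hcont.integrableOn_Icc
  rw [← ofReal_integral_eq_lintegral_ofReal]
  · congr 1
    rw [← integral_Ioc_eq_integral_Ioo, ← intervalIntegral.integral_of_le hle]
    rw [intervalIntegral.integral_eq_sub_of_hasDerivAt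
      (f := fun s => c / (n + 1) * (a + Real.log s) ^ (n + 1))]
    · simp
    · intro s hs
      rw [uIcc_of_le hle] at hs
      have h := (((Real.hasDerivAt_log (hpos s hs).ne').const_add a).pow (n + 1)).const_mul
        (c / ((n : ℝ) + 1))
      have h' : HasDerivAt (fun s => c / ((n : ℝ) + 1) * (a + Real.log s) ^ (n + 1))
        (c / ((n : ℝ) + 1) * (((n + 1 : ℕ) : ℝ) * (a + Real.log s) ^ (n + 1 - 1) * s⁻¹)) s := h
      have e : s⁻¹ * (c * (a + Real.log s) ^ n)
          = c / ((n : ℝ) + 1) * (((n + 1 : ℕ) : ℝ) * (a + Real.log s) ^ (n + 1 - 1) * s⁻¹) := by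
        push_cast
        have : (n : ℝ) + 1 ≠ 0 := by positivity
        field_simp
      rw [e]
      exact h'
    · apply ContinuousOn.intervalIntegrable
      rw [uIcc_of_le hle]; exact hcont
  · exact hint.mono_set Ioo_subset_Icc_self
  · rw [EventuallyLE, ae_restrict_iff' measurableSet_Ioo]
    refine Eventually.of_forall fun s hs => ?_
    have h1 := hpos s (Ioo_subset_Icc_self hs)
    have h2 : -a < Real.log s := by rw [Real.lt_log_iff_exp_lt h1]; exact hs.1
    have : 0 ≤ a + Real.log s := by linarith
    show (0 : ℝ) ≤ _
    positivity

lemma cap_norm {n : ℕ} {K : Set (Fin (n + 1) → ℝ)} (hK : Convex ℝ K) (hKc : IsCompact K)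
    (h0 : (0 : Fin (n + 1) → ℝ) ∈ K) (hK0 : ∀ x ∈ K, 0 ≤ x 0)
    {b : Fin (n + 1) → ℝ} (hbK : b ∈ K) (hb : b 0 = 1) {ε c T0 : ℝ} (hε : 0 < ε) (hε1 : ε ≤ 1)
    (hc : 0 ≤ c) (hT0 : 0 ≤ T0)
    (hsl : ∀ s, 0 < s → s < ε → ∀ T, T0 ≤ T →
      ENNReal.ofReal (c * (T - T0) ^ n) ≤ II (slice K s) (s • Fin.tail b) T)
    {T : ℝ} (hT : T0 - Real.log ε ≤ T) :
    ENNReal.ofReal (c / (n + 1) * (T - T0 + Real.log ε) ^ (n + 1)) ≤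
      ∫⁻ x in DD K b (Real.exp (-T)) ∩ {x | x 0 < ε}, mden K x := by
  set ρ := Real.exp (-T) with hρ
  have hρ0 : 0 < ρ := Real.exp_pos _
  set S := DD K b ρ ∩ {x | x 0 < ε} with hS
  have hSm : MeasurableSet S := by
    apply (isCompact_DD hKc b ρ).measurableSet.inter
    exact measurableSet_lt (measurable_pi_apply 0) measurable_const
  have hfm : Measurable (S.indicator (mden K)) := (measurable_mden K).indicator hSm
  have hmp := (volume_preserving_piFinSuccAbove (fun _ : Fin (n + 1) => ℝ) 0).symm
  have hemb := (MeasurableEquiv.piFinSuccAbove (fun _ : Fin (n + 1) => ℝ) 0).symm.measurableEmbedding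
  have e1 : ∫⁻ x in S, mden K x = ∫⁻ s : ℝ, ∫⁻ y : Fin n → ℝ,
      S.indicator (mden K) (Fin.cons s y : Fin (n + 1) → ℝ) := by
    rw [← lintegral_indicator hSm, ← hmp.lintegral_comp_emb hemb, Measure.volume_eq_prod,
      lintegral_prod]
    · simp [MeasurableEquiv.piFinSuccAbove, Fin.insertNthEquiv]
    · exact (hfm.comp (MeasurableEquiv.measurable _)).aemeasurable
  rw [e1]
  have e2 := int_log_pow n (a := T - T0) hc hε (by linarith)
  rw [← e2]
  calc _ ≤ ∫⁻ s in Ioo (Real.exp (-(T - T0))) ε, ∫⁻ y : Fin n → ℝ,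
        S.indicator (mden K) (Fin.cons s y : Fin (n + 1) → ℝ) := by
        refine setLIntegral_mono' measurableSet_Ioo fun s hs => ?_
        have hs0 : 0 < s := (Real.exp_pos _).trans hs.1
        have hs1 : s < 1 := hs.2.trans_le hε1
        have hρs : ρ < s := lt_of_le_of_lt (Real.exp_le_exp.2 (by linarith)) hs.1
        have hlog : -(T - T0) < Real.log s := by rw [Real.lt_log_iff_exp_lt hs0]; exact hs.1
        have h1 := hsl s hs0 hs.2 (T + Real.log s) (by linarith)
        have hexp : Real.exp (-(T + Real.log s)) = ρ / s := by
          rw [neg_add, Real.exp_add, Real.exp_neg (Real.log s), Real.exp_log hs0]; rfl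
        have hslm : MeasurableSet (DD (slice K s) (s • Fin.tail b) (ρ / s)) := by
          apply (isCompact_DD ?_ _ _).measurableSet
          have : slice K s = Fin.tail '' (K ∩ {x | x 0 = s}) := by
            ext y
            constructor
            · intro hy
              exact ⟨Fin.cons s y, ⟨hy, by simp⟩, by simp⟩
            · rintro ⟨x, ⟨hx, hxs⟩, rfl⟩
              show (Fin.cons s _ : Fin (n + 1) → ℝ) ∈ K
              rw [← (show x 0 = s from hxs), Fin.cons_self_tail]; exact hx
          rw [this]
          apply (hKc.inter_right (isClosed_eq (continuous_apply 0) continuous_const)).image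
          unfold Fin.tail
          fun_prop
        calc _ = (ENNReal.ofReal s)⁻¹ * ENNReal.ofReal (c * (T + Real.log s - T0) ^ n) := by
              rw [ENNReal.ofReal_mul (by positivity), ENNReal.ofReal_inv_of_pos hs0]
              congr 4; ring
          _ ≤ (ENNReal.ofReal s)⁻¹ * II (slice K s) (s • Fin.tail b) (T + Real.log s) := by gcongr
          _ = ∫⁻ y in DD (slice K s) (s • Fin.tail b) (ρ / s),
                (ENNReal.ofReal s)⁻¹ * mden (slice K s) y := by
              unfold II
              rw [hexp, lintegral_const_mul _ (measurable_mden _)]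
          _ = ∫⁻ y, (DD (slice K s) (s • Fin.tail b) (ρ / s)).indicator
                (fun y => (ENNReal.ofReal s)⁻¹ * mden (slice K s) y) y := by
              rw [lintegral_indicator hslm]
          _ ≤ _ := by
              apply lintegral_mono
              intro y
              by_cases hy : y ∈ DD (slice K s) (s • Fin.tail b) (ρ / s)
              · have hm : (Fin.cons s y : Fin (n + 1) → ℝ) ∈ S :=
                  ⟨DD_slice hK h0 hb hρ0 hρs hs1 hy, by simpa using hs.2⟩
                simp only [indicator_of_mem hy, indicator_of_mem hm]
                exact mden_slice hK hs0 hK0 h0 hs0 hbK (by rw [hb]; exact hs1) y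
              · simp [indicator_of_notMem hy]
    _ ≤ _ := setLIntegral_le_lintegral _ _

/-- affine map. -/
def aff {n : ℕ} (M : Matrix (Fin n) (Fin n) ℝ) (t : Fin n → ℝ) (x : Fin n → ℝ) : Fin n → ℝ :=
  M.mulVec x + t

lemma continuous_aff {n : ℕ} (M : Matrix (Fin n) (Fin n) ℝ) (t : Fin n → ℝ) :
    Continuous (aff M t) := by
  unfold aff
  fun_prop

lemma aff_injective {n : ℕ} {M : Matrix (Fin n) (Fin n) ℝ} (hM : M.det ≠ 0) (t : Fin n → ℝ) :
    Function.Injective (aff M t) := by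
  intro x y h
  have : M.mulVec x = M.mulVec y := by simpa [aff] using h
  exact Matrix.mulVec_injective_iff_isUnit.2
    ((Matrix.isUnit_iff_isUnit_det M).2 (isUnit_iff_ne_zero.2 hM)) this

lemma aff_combo {n : ℕ} (M : Matrix (Fin n) (Fin n) ℝ) (t x y : Fin n → ℝ) {a c : ℝ}
    (h : a + c = 1) : aff M t (a • x + c • y) = a • aff M t x + c • aff M t y := by
  have : t = a • t + c • t := by rw [← add_smul, h, one_smul]
  unfold aff
  conv_lhs => rw [this]
  simp only [Matrix.mulVec_add, Matrix.mulVec_smul, smul_add]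
  abel

lemma mden_aff {n : ℕ} (K : Set (Fin n → ℝ)) (M : Matrix (Fin n) (Fin n) ℝ)
    (t x : Fin n → ℝ) : ENNReal.ofReal |M.det| * mden (aff M t '' K) (aff M t x) ≤ mden K x := by
  conv_lhs => unfold mden
  simp only [ENNReal.mul_iSup]
  refine iSup_le fun A => iSup_le fun c => iSup_le fun hA => ?_
  have e : ∀ y, (A * M).mulVec y + (A.mulVec t + c) = A.mulVec (aff M t y) + c := by
    intro y
    simp [aff, Matrix.mulVec_add, add_assoc]
  have hadm : Adm K (A * M) (A.mulVec t + c) := by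
    intro y hy i
    rw [e]
    exact hA _ ⟨y, hy, rfl⟩ i
  refine le_trans (le_of_eq ?_) (le_mden hadm x)
  rw [e, Matrix.det_mul, abs_mul, ENNReal.ofReal_mul (abs_nonneg _)]
  ring

lemma lint_aff {n : ℕ} (K : Set (Fin n → ℝ)) {M : Matrix (Fin n) (Fin n) ℝ} (hM : M.det ≠ 0)
    (t : Fin n → ℝ) {S : Set (Fin n → ℝ)} (hS : MeasurableSet S) :
    ∫⁻ x in aff M t '' S, mden (aff M t '' K) x ≤ ∫⁻ x in S, mden K x := by
  have hd : ∀ x ∈ S, HasFDerivWithinAt (aff M t)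
      (LinearMap.toContinuousLinearMap (Matrix.toLin' M)) S x := by
    intro x _
    exact ((LinearMap.toContinuousLinearMap (Matrix.toLin' M)).hasFDerivAt.add_const t).hasFDerivWithinAt
  rw [lintegral_image_eq_lintegral_abs_det_fderiv_mul volume hS hd (aff_injective hM t).injOn]
  apply lintegral_mono
  intro x
  have : (LinearMap.toContinuousLinearMap (Matrix.toLin' M)).det = M.det := by
    simp [ContinuousLinearMap.det]
  simp only [this]
  exact mden_aff K M t x

lemma DD_aff {n : ℕ} (K : Set (Fin n → ℝ)) (M : Matrix (Fin n) (Fin n) ℝ) (t b : Fin n → ℝ) (ρ : ℝ) :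
    DD (aff M t '' K) (aff M t b) ρ = aff M t '' DD K b ρ := by
  unfold DD
  rw [image_image, image_image]
  apply image_congr
  intro z _
  rw [aff_combo M t b z (by ring)]

lemma II_aff {n : ℕ} {K : Set (Fin n → ℝ)} (hK : IsCompact K) {M : Matrix (Fin n) (Fin n) ℝ}
    (hM : M.det ≠ 0) (t b : Fin n → ℝ) (T : ℝ) :
    II (aff M t '' K) (aff M t b) T ≤ II K b T := by
  unfold II
  rw [DD_aff]
  exact lint_aff K hM t (isCompact_DD hK b _).measurableSet

lemma exists_norm_aff {n : ℕ} (f : (Fin (n + 1) → ℝ) →ₗ[ℝ] ℝ) {v b : Fin (n + 1) → ℝ}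
    (h : f v < f b) : ∃ (M : Matrix (Fin (n + 1)) (Fin (n + 1)) ℝ) (t : Fin (n + 1) → ℝ),
      M.det ≠ 0 ∧ aff M t v = 0 ∧ ∀ x, aff M t x 0 = (f x - f v) / (f b - f v) := by
  set g : (Fin (n + 1) → ℝ) →ₗ[ℝ] ℝ := (f b - f v)⁻¹ • f with hg
  have hg0 : g ≠ 0 := by
    intro h0
    have : g (b - v) = 1 := by
      simp only [hg, LinearMap.smul_apply, map_sub, smul_eq_mul]
      rw [← mul_sub, inv_mul_cancel₀]; linarith
    rw [h0] at this
    simp at this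
  obtain ⟨j, hj⟩ : ∃ j, g (Pi.single j 1) ≠ 0 := by
    by_contra hcon
    push Not at hcon
    apply hg0
    apply LinearMap.pi_ext'
    intro i
    ext
    simp [hcon i]
  let L : (Fin (n + 1) → ℝ) →ₗ[ℝ] (Fin (n + 1) → ℝ) :=
    LinearMap.pi (fun i => if i = 0 then g else LinearMap.proj (Equiv.swap 0 j i))
  have hL0 : ∀ x, L x 0 = g x := fun x => by simp [L]
  have hLi : ∀ x i, i ≠ 0 → L x i = x (Equiv.swap 0 j i) := fun x i hi => by simp [L, hi]
  have hinj : Function.Injective L := by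
    rw [← LinearMap.ker_eq_bot, LinearMap.ker_eq_bot']
    intro x hx
    have h1 : ∀ k, k ≠ j → x k = 0 := by
      intro k hk
      have hne : Equiv.swap 0 j k ≠ 0 := by
        intro h'
        apply hk
        have := congrArg (Equiv.swap 0 j) h'
        simpa using this
      have := hLi x _ hne
      rw [hx] at this
      simpa using this.symm
    have h2 : x = x j • Pi.single j 1 := by
      ext k
      by_cases hk : k = j
      · subst hk; simp
      · simp [h1 k hk, hk]
    have h3 : g x = 0 := by rw [← hL0, hx]; rfl
    rw [h2, map_smul, smul_eq_mul] at h3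
    have h4 : x j = 0 := by
      rcases mul_eq_zero.1 h3 with h | h
      · exact h
      · exact absurd h hj
    rw [h2, h4, zero_smul]
  refine ⟨LinearMap.toMatrix' L, -(L v), ?_, ?_, ?_⟩
  · have : Function.Injective (LinearMap.toMatrix' L).mulVec := by
      intro x y hxy
      rw [LinearMap.toMatrix'_mulVec, LinearMap.toMatrix'_mulVec] at hxy
      exact hinj hxy
    exact ((Matrix.isUnit_iff_isUnit_det _).1 (Matrix.mulVec_injective_iff_isUnit.1 this)).ne_zero
  · simp [aff, LinearMap.toMatrix'_mulVec]
  · intro x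
    have : aff (LinearMap.toMatrix' L) (-(L v)) x = L x - L v := by
      simp [aff, LinearMap.toMatrix'_mulVec, sub_eq_add_neg]
    rw [this, Pi.sub_apply, hL0, hL0, hg]
    simp only [LinearMap.smul_apply, smul_eq_mul]
    field_simp

lemma convex_aff {n : ℕ} {K : Set (Fin n → ℝ)} (hK : Convex ℝ K) (M : Matrix (Fin n) (Fin n) ℝ)
    (t : Fin n → ℝ) : Convex ℝ (aff M t '' K) := by
  rintro _ ⟨x, hx, rfl⟩ _ ⟨y, hy, rfl⟩ a c ha hc hac
  exact ⟨a • x + c • y, hK hx hy ha hc hac, aff_combo M t x y hac⟩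

lemma slice_body {n : ℕ} {K : Set (Fin (n + 1) → ℝ)} (hK : Convex ℝ K) (hKc : IsCompact K) (s : ℝ) :
    Convex ℝ (slice K s) ∧ IsCompact (slice K s) := by
  constructor
  · intro x hx y hy a c ha hc hac
    have := hK hx hy ha hc hac
    show (Fin.cons s _ : Fin (n + 1) → ℝ) ∈ K
    convert this using 1
    ext i
    refine Fin.cases ?_ (fun i => ?_) i
    · simp [← add_mul, hac]
    · simp
  · have : slice K s = Fin.tail '' (K ∩ {x | x 0 = s}) := by
      ext y
      constructor
      · intro hy
        exact ⟨Fin.cons s y, ⟨hy, by simp⟩, by simp⟩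
      · rintro ⟨x, ⟨hx, hxs⟩, rfl⟩
        show (Fin.cons s _ : Fin (n + 1) → ℝ) ∈ K
        rw [← (show x 0 = s from hxs), Fin.cons_self_tail]; exact hx
    rw [this]
    apply (hKc.inter_right (isClosed_eq (continuous_apply 0) continuous_const)).image
    unfold Fin.tail
    fun_prop

lemma slice_interior {n : ℕ} {K : Set (Fin (n + 1) → ℝ)} (hK : Convex ℝ K)
    (h0 : (0 : Fin (n + 1) → ℝ) ∈ K) {b : Fin (n + 1) → ℝ} (hb : b ∈ interior K) (hb0 : b 0 = 1)
    {s : ℝ} (hs : 0 < s) (hs1 : s ≤ 1) : s • Fin.tail b ∈ interior (slice K s) := by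
  have h1 : s • b ∈ interior K := by
    have := hK.combo_interior_self_mem_interior hb h0 hs (sub_nonneg.2 hs1) (by ring)
    simpa using this
  have h2 : s • b = (Fin.cons s (s • Fin.tail b) : Fin (n + 1) → ℝ) := by
    ext i
    refine Fin.cases ?_ (fun i => ?_) i
    · simp [hb0]
    · simp [Fin.tail]
  have hcont : Continuous (fun y : Fin n → ℝ => (Fin.cons s y : Fin (n + 1) → ℝ)) := by fun_prop
  have h3 : (fun y : Fin n → ℝ => (Fin.cons s y : Fin (n + 1) → ℝ)) ⁻¹' interior K ⊆
      interior (slice K s) :=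
    interior_maximal (fun y hy => by
      have hy' : (Fin.cons s y : Fin (n + 1) → ℝ) ∈ interior K := hy
      exact (interior_subset hy' : _ ∈ K)) (isOpen_interior.preimage hcont)
  apply h3
  rw [mem_preimage, ← h2]
  exact h1

lemma aff_interior {n : ℕ} {K : Set (Fin n → ℝ)} {M : Matrix (Fin n) (Fin n) ℝ} (hM : M.det ≠ 0)
    (t : Fin n → ℝ) {b : Fin n → ℝ} (hb : b ∈ interior K) :
    aff M t b ∈ interior (aff M t '' K) := by
  have hu : IsUnit M.det := isUnit_iff_ne_zero.2 hM
  have h1 : ∀ y, aff M t (M⁻¹.mulVec (y - t)) = y := by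
    intro y
    simp [aff, Matrix.mulVec_mulVec, Matrix.mul_nonsing_inv _ hu]
  have h2 : ∀ x, M⁻¹.mulVec (aff M t x - t) = x := by
    intro x
    simp [aff, Matrix.mulVec_mulVec, Matrix.nonsing_inv_mul _ hu]
  have hcont : Continuous (fun y => M⁻¹.mulVec (y - t)) := by fun_prop
  refine interior_maximal (s := aff M t '' K) (t := (fun y => M⁻¹.mulVec (y - t)) ⁻¹' interior K) ?_
    (isOpen_interior.preimage hcont) ?_
  · intro y hy
    exact ⟨_, interior_subset hy, h1 y⟩
  · show M⁻¹.mulVec (aff M t b - t) ∈ interior K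
    rw [h2]; exact hb

/-- Uniform lower bound. -/
def Unif (n : ℕ) : Prop := ∀ (K : Set (Fin n → ℝ)) (b : Fin n → ℝ), Convex ℝ K → IsCompact K →
  b ∈ interior K → ∀ T : ℝ, 0 ≤ T → ENNReal.ofReal (1 / (n.factorial : ℝ) * T ^ n) ≤ II K b T

/-- Asymptotic lower bound with constant `a`. -/
def Asy {n : ℕ} (K : Set (Fin n → ℝ)) (b : Fin n → ℝ) (a : ℝ) : Prop :=
  ∀ c, 0 ≤ c → c < a → ∃ T0, 0 ≤ T0 ∧ ∀ T, T0 ≤ T → ENNReal.ofReal (c * (T - T0) ^ n) ≤ II K b T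

/-- cap bound in general position, using the uniform bound. -/
lemma cap_unif {n : ℕ} (hU : Unif n) {K : Set (Fin (n + 1) → ℝ)} (hK : Convex ℝ K)
    (hKc : IsCompact K) {b v : Fin (n + 1) → ℝ} (hb : b ∈ interior K) (hv : v ∈ K)
    (f : (Fin (n + 1) → ℝ) →ₗ[ℝ] ℝ) (hf : ∀ x ∈ K, f v ≤ f x) (hfb : f v < f b)
    {ε : ℝ} (hε : 0 < ε) (hε1 : ε ≤ 1) {T : ℝ} (hT : - Real.log ε ≤ T) :
    ENNReal.ofReal (1 / ((n + 1).factorial : ℝ) * (T + Real.log ε) ^ (n + 1)) ≤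
      ∫⁻ x in DD K b (Real.exp (-T)) ∩ {x | f x - f v < ε * (f b - f v)}, mden K x := by
  obtain ⟨M, t, hM, hMv, hM0⟩ := exists_norm_aff f hfb
  have hpos : 0 < f b - f v := by linarith
  have hS : MeasurableSet (DD K b (Real.exp (-T)) ∩ {x | f x - f v < ε * (f b - f v)}) := by
    apply (isCompact_DD hKc b _).measurableSet.inter
    have : Continuous f := f.continuous_of_finiteDimensional
    exact measurableSet_lt (by fun_prop) measurable_const
  refine le_trans ?_ (lint_aff K hM t hS)
  rw [image_inter (aff_injective hM t), ← DD_aff]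
  have h0 : (0 : Fin (n + 1) → ℝ) ∈ aff M t '' K := ⟨v, hv, hMv⟩
  have hb1 : aff M t b 0 = 1 := by rw [hM0]; exact div_self hpos.ne'
  have hbi := aff_interior hM t hb
  have hC := convex_aff hK M t
  have hCc : IsCompact (aff M t '' K) := hKc.image (continuous_aff M t)
  have := cap_norm hC hCc h0 (by
      rintro _ ⟨x, hx, rfl⟩
      rw [hM0]
      exact div_nonneg (by linarith [hf x hx]) hpos.le) (interior_subset hbi) hb1 hε hε1
      (c := 1 / (n.factorial : ℝ)) (T0 := 0) (by positivity) le_rfl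
      (by
        intro s hs hsε T hT
        rw [sub_zero]
        exact hU _ _ (slice_body hC hCc s).1 (slice_body hC hCc s).2
          (slice_interior hC h0 hbi hb1 hs (hsε.le.trans hε1)) T hT) (T := T) (by linarith)
  have e : (1 / (n.factorial : ℝ) / (n + 1) * (T - 0 + Real.log ε) ^ (n + 1))
      = (1 / ((n + 1).factorial : ℝ) * (T + Real.log ε) ^ (n + 1)) := by
    rw [Nat.factorial_succ]; push_cast
    rw [sub_zero, div_div, mul_comm ((n : ℝ) + 1)]
  rw [e] at this
  refine this.trans (lintegral_mono_set ?_)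
  rintro y ⟨hy, hyε⟩
  refine ⟨hy, ?_⟩
  rw [DD_aff] at hy
  obtain ⟨x, hx, rfl⟩ := hy
  refine ⟨x, ?_, rfl⟩
  have : aff M t x 0 < ε := hyε
  rw [hM0, div_lt_iff₀ hpos] at this
  exact this

/-- cap bound in general position, conical case. -/
lemma cap_cone {n : ℕ} (hA : ∀ (K : Set (Fin n → ℝ)) (b : Fin n → ℝ), Convex ℝ K → IsCompact K →
      b ∈ interior K → Asy K b (n + 1)) {K : Set (Fin (n + 1) → ℝ)} (hK : Convex ℝ K)
    (hKc : IsCompact K) {b v : Fin (n + 1) → ℝ} (hb : b ∈ interior K) (hv : v ∈ K)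
    (f : (Fin (n + 1) → ℝ) →ₗ[ℝ] ℝ) (hf : ∀ x ∈ K, f v ≤ f x) (hfb : f v < f b)
    {ε : ℝ} (hε : 0 < ε) (hε1 : ε ≤ 1)
    (hcone : ∀ x ∈ K, ∀ r, 1 ≤ r → r * (f x - f v) ≤ ε * (f b - f v) → f v < f x →
      v + r • (x - v) ∈ K)
    {c : ℝ} (hc : 0 ≤ c) (hc1 : c < 1) :
    ∃ T0, 0 ≤ T0 ∧ ∀ T, T0 ≤ T → 
    ENNReal.ofReal (c * (T - T0) ^ (n + 1)) ≤
      ∫⁻ x in DD K b (Real.exp (-T)) ∩ {x | f x - f v < ε * (f b - f v)}, mden K x := by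
  obtain ⟨M, t, hM, hMv, hM0⟩ := exists_norm_aff f hfb
  have hpos : 0 < f b - f v := by linarith
  have hlogε : Real.log ε ≤ 0 := Real.log_nonpos hε.le hε1
  have h0 : (0 : Fin (n + 1) → ℝ) ∈ aff M t '' K := ⟨v, hv, hMv⟩
  have hb1 : aff M t b 0 = 1 := by rw [hM0]; exact div_self hpos.ne'
  have hbi := aff_interior hM t hb
  have hC := convex_aff hK M t
  have hCc : IsCompact (aff M t '' K) := hKc.image (continuous_aff M t)
  set K' := aff M t '' K with hK'
  set b' := aff M t b with hb'
  have hcone' : ∀ y ∈ K', ∀ r, 1 ≤ r → r * y 0 ≤ ε → 0 < y 0 → r • y ∈ K' := by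
    rintro _ ⟨x, hx, rfl⟩ r hr h1 h2
    rw [hM0] at h1 h2
    refine ⟨v + r • (x - v), hcone x hx r hr ?_ ?_, ?_⟩
    · rw [← mul_div_assoc, div_le_iff₀ hpos] at h1; exact h1
    · rw [lt_div_iff₀ hpos] at h2; linarith
    · have : v + r • (x - v) = (1 - r) • v + r • x := by
        rw [smul_sub, sub_smul, one_smul]; abel
      rw [this, aff_combo M t v x (by ring), hMv, smul_zero, zero_add]
  obtain ⟨T0, hT0, hT0'⟩ := hA (slice K' ε) (ε • Fin.tail b') (slice_body hC hCc ε).1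
    (slice_body hC hCc ε).2 (slice_interior hC h0 hbi hb1 hε hε1) (c * (n + 1)) (by positivity)
    (by have : (0 : ℝ) < n + 1 := by positivity
        nlinarith)
  refine ⟨T0 - Real.log ε, by linarith, fun T hT => ?_⟩
  have hS : MeasurableSet (DD K b (Real.exp (-T)) ∩ {x | f x - f v < ε * (f b - f v)}) := by
    apply (isCompact_DD hKc b _).measurableSet.inter
    have : Continuous f := f.continuous_of_finiteDimensional
    exact measurableSet_lt (by fun_prop) measurable_const
  refine le_trans ?_ (lint_aff K hM t hS)
  rw [image_inter (aff_injective hM t), ← DD_aff]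
  have := cap_norm hC hCc h0 (by
      rintro _ ⟨x, hx, rfl⟩
      rw [hM0]
      exact div_nonneg (by linarith [hf x hx]) hpos.le) (interior_subset hbi) hb1 hε hε1
      (c := c * (n + 1)) (T0 := T0) (by positivity) hT0
      (by
        intro s hs hsε T hT
        refine (hT0' T hT).trans ?_
        have hr : 1 ≤ ε / s := by rw [one_le_div hs]; exact hsε.le
        have hr0 : 0 < ε / s := by positivity
        have := II_aff (slice_body hC hCc s).2 (M := (ε / s) • (1 : Matrix (Fin n) (Fin n) ℝ))
          (by rw [Matrix.det_smul]; simp [hr0.ne', hs.ne', hε.ne']) 0 (s • Fin.tail b') T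
        have ha : ∀ y, aff ((ε / s) • (1 : Matrix (Fin n) (Fin n) ℝ)) 0 y = (ε / s) • y := by
          intro y; simp [aff, Matrix.smul_mulVec]
        rw [ha, smul_smul, div_mul_cancel₀ _ hs.ne'] at this
        refine le_trans (le_of_eq ?_) this
        congr 1
        ext y
        constructor
        · intro hy
          refine ⟨(s / ε) • y, ?_, ?_⟩
          · show (Fin.cons s _ : Fin (n + 1) → ℝ) ∈ K'
            have hy' : (Fin.cons ε y : Fin (n + 1) → ℝ) ∈ K' := hy
            have h1 := hC hy' h0 (a := s / ε) (b := 1 - s / ε) (by positivity)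
              (by rw [sub_nonneg, div_le_one hε]; exact hsε.le) (by ring)
            convert h1 using 1
            ext i
            refine Fin.cases ?_ (fun i => ?_) i
            · simp; field_simp
            · simp
          · rw [ha, smul_smul]
            have : ε / s * (s / ε) = 1 := by field_simp
            rw [this, one_smul]
        · rintro ⟨x, hx, rfl⟩
          have hx' : (Fin.cons s x : Fin (n + 1) → ℝ) ∈ K' := hx
          rw [ha]
          show (Fin.cons ε _ : Fin (n + 1) → ℝ) ∈ K'
          have h1 := hcone' _ hx' (ε / s) hr (by simp; rw [div_mul_cancel₀ _ hs.ne'])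
            (by simpa using hs)
          convert h1 using 1
          ext i
          refine Fin.cases ?_ (fun i => ?_) i
          · simp; rw [div_mul_cancel₀ _ hs.ne']
          · simp) (T := T) (by linarith)
  have e : c * (n + 1) / (n + 1) * (T - T0 + Real.log ε) ^ (n + 1)
      = c * (T - (T0 - Real.log ε)) ^ (n + 1) := by
    have : (n : ℝ) + 1 ≠ 0 := by positivity
    rw [mul_div_cancel_right₀ _ this]
    congr 2; ring
  rw [e] at this
  refine this.trans (lintegral_mono_set ?_)
  rintro y ⟨hy, hyε⟩
  refine ⟨hy, ?_⟩
  rw [DD_aff] at hy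
  obtain ⟨x, hx, rfl⟩ := hy
  refine ⟨x, ?_, rfl⟩
  have : aff M t x 0 < ε := hyε
  rw [hM0, div_lt_iff₀ hpos] at this
  exact this

/-- iterated joins. -/
def joinIter {n : ℕ} (C : Set (Fin n → ℝ)) : ℕ → Set (Fin n → ℝ)
  | 0 => C
  | k + 1 => convexJoin ℝ C (joinIter C k)

lemma isCompact_convexJoin' {n : ℕ} {C D : Set (Fin n → ℝ)} (hC : IsCompact C) (hD : IsCompact D) :
    IsCompact (convexJoin ℝ C D) := by
  have : convexJoin ℝ C D = (fun p : (Fin n → ℝ) × (Fin n → ℝ) × ℝ =>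
      (1 - p.2.2) • p.1 + p.2.2 • p.2.1) '' (C ×ˢ D ×ˢ Icc (0 : ℝ) 1) := by
    ext z
    simp only [mem_convexJoin, segment_eq_image, mem_image, mem_prod, Prod.exists]
    constructor
    · rintro ⟨a, ha, b, hb, t, ht, rfl⟩
      exact ⟨a, b, t, ⟨ha, hb, ht⟩, rfl⟩
    · rintro ⟨a, b, t, ⟨ha, hb, ht⟩, rfl⟩
      exact ⟨a, ha, b, hb, t, ht, rfl⟩
  rw [this]
  apply (hC.prod (hD.prod isCompact_Icc)).image
  fun_prop

lemma joinIter_props {n : ℕ} {C : Set (Fin n → ℝ)} (hC : IsCompact C) (k : ℕ) :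
    IsCompact (joinIter C k) ∧ C ⊆ joinIter C k ∧ joinIter C k ⊆ convexHull ℝ C ∧
    ∀ t : Finset (Fin n → ℝ), (t : Set (Fin n → ℝ)) ⊆ C → t.Nonempty → t.card ≤ k + 1 →
      convexHull ℝ (t : Set (Fin n → ℝ)) ⊆ joinIter C k := by
  induction k with
  | zero =>
    refine ⟨hC, Subset.rfl, subset_convexHull ℝ C, ?_⟩
    intro t ht hne hcard
    have : t.card = 1 := le_antisymm hcard hne.card_pos
    obtain ⟨x, rfl⟩ := Finset.card_eq_one.1 this
    simpa [joinIter] using ht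
  | succ k ih =>
    obtain ⟨h1, h2, h3, h4⟩ := ih
    have hsub : C ⊆ joinIter C (k + 1) := by
      intro x hx
      exact mem_convexJoin.2 ⟨x, hx, x, h2 hx, left_mem_segment ℝ x x⟩
    refine ⟨isCompact_convexJoin' hC h1, hsub, ?_, ?_⟩
    · intro y hy
      obtain ⟨a, ha, b, hb, hs⟩ := mem_convexJoin.1 hy
      exact (convex_convexHull ℝ C).segment_subset (subset_convexHull ℝ C ha) (h3 hb) hs
    · intro t ht hne hcard
      obtain ⟨x, hx⟩ := hne
      by_cases he : (t.erase x).Nonempty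
      · have hins : (t : Set (Fin n → ℝ)) = insert x ((t.erase x : Finset _) : Set (Fin n → ℝ)) := by
          rw [← Finset.coe_insert, Finset.insert_erase hx]
        rw [hins, convexHull_insert (Finset.coe_nonempty.2 he)]
        apply convexJoin_mono
        · simpa using ht hx
        · apply h4 _ _ he
          · rw [Finset.card_erase_of_mem hx]; omega
          · exact (Finset.coe_subset.2 (Finset.erase_subset x t)).trans ht
      · have : t = {x} := by
          rw [Finset.not_nonempty_iff_eq_empty] at he
          rw [← Finset.insert_erase hx, he]; rfl
        subst this
        simp only [Finset.coe_singleton, convexHull_singleton, singleton_subset_iff]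
        exact hsub (ht (by simp))

lemma isClosed_convexHull_compact {n : ℕ} {C : Set (Fin n → ℝ)} (hC : IsCompact C) :
    IsClosed (convexHull ℝ C) := by
  obtain ⟨h1, h2, h3, h4⟩ := joinIter_props hC n
  have : convexHull ℝ C = joinIter C n := by
    apply Subset.antisymm _ h3
    rw [convexHull_eq_union]
    intro x hx
    simp only [mem_iUnion] at hx
    obtain ⟨t, ht, hai, hx⟩ := hx
    have hne : t.Nonempty := by
      rw [Finset.nonempty_iff_ne_empty]
      rintro rfl
      simp at hx
    refine h4 t ht hne ?_ hx
    have := hai.card_le_finrank_succ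
    have h5 : Module.finrank ℝ (vectorSpan ℝ (Set.range ((↑) : t → Fin n → ℝ))) ≤ n := by
      have := Submodule.finrank_le (vectorSpan ℝ (Set.range ((↑) : t → Fin n → ℝ)))
      simpa using this
    rw [Fintype.card_coe] at this
    omega
  rw [this]; exact h1.isClosed

lemma ext_sep {n : ℕ} {K : Set (Fin n → ℝ)} (hK : Convex ℝ K) (hKc : IsCompact K)
    {x : Fin n → ℝ} (hx : x ∈ K.extremePoints ℝ) {δ : ℝ} (hδ : 0 < δ) :
    ∃ (f : (Fin n → ℝ) →L[ℝ] ℝ) (u : ℝ), f x < u ∧ ∀ y ∈ K, δ ≤ dist y x → u < f y := by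
  have hCc : IsCompact (K \ ball x δ) := hKc.diff isOpen_ball
  have hnot : x ∉ convexHull ℝ (K \ ball x δ) := by
    intro hmem
    have hsub : convexHull ℝ (K \ ball x δ) ⊆ K := convexHull_min sdiff_subset hK
    have : x ∈ (convexHull ℝ (K \ ball x δ)).extremePoints ℝ :=
      inter_extremePoints_subset_extremePoints_of_subset hsub ⟨hmem, hx⟩
    have := extremePoints_convexHull_subset this
    exact this.2 (mem_ball_self hδ)
  obtain ⟨f, u, h1, h2⟩ := geometric_hahn_banach_point_closed (convex_convexHull ℝ _)
    (isClosed_convexHull_compact hCc) hnot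
  refine ⟨f, u, h1, fun y hy hd => h2 y (subset_convexHull ℝ _ ⟨hy, ?_⟩)⟩
  simpa using hd

lemma ext_not_interior {n : ℕ} {K : Set (Fin (n + 1) → ℝ)} {x : Fin (n + 1) → ℝ}
    (hx : x ∈ K.extremePoints ℝ) : x ∉ interior K := by
  intro hi
  have hc1 : Tendsto (fun t : ℝ => x + t • (Pi.single 0 1 : Fin (n + 1) → ℝ)) (𝓝[>] 0) (𝓝 x) := by
    have : Continuous (fun t : ℝ => x + t • (Pi.single 0 1 : Fin (n + 1) → ℝ)) := by fun_prop
    have := (this.tendsto 0).mono_left (nhdsWithin_le_nhds (s := Ioi 0))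
    simpa using this
  have hc2 : Tendsto (fun t : ℝ => x - t • (Pi.single 0 1 : Fin (n + 1) → ℝ)) (𝓝[>] 0) (𝓝 x) := by
    have : Continuous (fun t : ℝ => x - t • (Pi.single 0 1 : Fin (n + 1) → ℝ)) := by fun_prop
    have := (this.tendsto 0).mono_left (nhdsWithin_le_nhds (s := Ioi 0))
    simpa using this
  have hn := mem_interior_iff_mem_nhds.1 hi
  obtain ⟨t, ⟨h1, h2⟩, h3⟩ := ((hc1.eventually hn).and (hc2.eventually hn)).and
    self_mem_nhdsWithin |>.exists
  have ht : (0 : ℝ) < t := h3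
  have := hx.2 h1 h2 (by
    refine ⟨1 / 2, 1 / 2, by norm_num, by norm_num, by norm_num, ?_⟩
    ext i; simp; ring)
  have := congrFun this 0
  simp at this
  exact ht.ne' this

/-- contribution near a point. -/
def CapC {n : ℕ} (K : Set (Fin n → ℝ)) (b x : Fin n → ℝ) (δ c : ℝ) : Prop :=
  ∃ S : Set (Fin n → ℝ), MeasurableSet S ∧ S ∩ K ⊆ ball x δ ∧ ∃ T0, 0 ≤ T0 ∧ ∀ T, T0 ≤ T →
    ENNReal.ofReal (c * (T - T0) ^ n) ≤ ∫⁻ y in DD K b (Real.exp (-T)) ∩ S, mden K y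

lemma capC_unif {n : ℕ} (hU : Unif n) {K : Set (Fin (n + 1) → ℝ)} (hK : Convex ℝ K)
    (hKc : IsCompact K) {b x : Fin (n + 1) → ℝ} (hb : b ∈ interior K)
    (hx : x ∈ K.extremePoints ℝ) {δ : ℝ} (hδ : 0 < δ) :
    CapC K b x δ (1 / ((n + 1).factorial : ℝ)) := by
  have hbx : 0 < dist b x := by
    rw [dist_pos]
    rintro rfl
    exact ext_not_interior hx hb
  obtain ⟨f, u, h1, h2⟩ := ext_sep hK hKc hx (lt_min hδ hbx)
  obtain ⟨v, hv, hvmin⟩ := hKc.exists_isMinOn ⟨b, interior_subset hb⟩ f.continuous.continuousOn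
  have hvx : f v ≤ f x := hvmin hx.1
  have hub : u < f b := h2 b (interior_subset hb) (min_le_right _ _)
  have hpos : 0 < f b - f v := by linarith
  set ε := min 1 ((u - f v) / (f b - f v)) with hε
  have hε0 : 0 < ε := lt_min one_pos (div_pos (by linarith) hpos)
  refine ⟨{y | f y - f v < ε * (f b - f v)}, ?_, ?_, - Real.log ε, ?_, ?_⟩
  · have := f.continuous
    exact measurableSet_lt (by fun_prop) measurable_const
  · rintro y ⟨hy, hyK⟩
    by_contra hcon
    have h3 := h2 y hyK ((min_le_left _ _).trans (by simpa using hcon))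
    have h4 : f y - f v < ε * (f b - f v) := hy
    have h5 : ε * (f b - f v) ≤ u - f v := by
      rw [← le_div_iff₀ hpos]; exact min_le_right _ _
    linarith
  · have := Real.log_nonpos hε0.le (min_le_left _ _); linarith
  · intro T hT
    have := cap_unif hU hK hKc hb hv (f : (Fin (n + 1) → ℝ) →ₗ[ℝ] ℝ) (fun y hy => hvmin hy)
      (show f v < f b by linarith) hε0 (min_le_left _ _) hT
    rw [sub_neg_eq_add]
    exact this

lemma capC_cone {n : ℕ} (hA : ∀ (K : Set (Fin n → ℝ)) (b : Fin n → ℝ), Convex ℝ K → IsCompact K →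
      b ∈ interior K → Asy K b (n + 1)) {K : Set (Fin (n + 1) → ℝ)} (hK : Convex ℝ K)
    (hKc : IsCompact K) {b x : Fin (n + 1) → ℝ} (hb : b ∈ interior K)
    (hfin : (K.extremePoints ℝ).Finite)
    (hx : x ∈ K.extremePoints ℝ) {δ : ℝ} (hδ : 0 < δ)
    (hδ' : ∀ w ∈ K.extremePoints ℝ, w ≠ x → δ ≤ dist w x) {c : ℝ} (hc : 0 ≤ c) (hc1 : c < 1) :
    CapC K b x δ c := by
  have hbx : 0 < dist b x := by
    rw [dist_pos]
    rintro rfl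
    exact ext_not_interior hx hb
  have hKeq : convexHull ℝ (K.extremePoints ℝ) = K := by
    have h := closure_convexHull_extremePoints hKc hK
    rwa [(hfin.isClosed_convexHull (𝕜 := ℝ)).closure_eq] at h
  obtain ⟨f, u, h1, h2⟩ := ext_sep hK hKc hx (lt_min hδ hbx)
  have hw : ∀ w ∈ K.extremePoints ℝ \ {x}, u < f w := fun w hw =>
    h2 w hw.1.1 ((min_le_left _ _).trans (hδ' w hw.1 hw.2))
  have hlin : ∀ a : ℝ, Convex ℝ {y : Fin (n + 1) → ℝ | a ≤ f y} := fun a =>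
    convex_halfSpace_ge f.toLinearMap.isLinear a
  have hmin : ∀ y ∈ K, f x ≤ f y := by
    have : K ⊆ {y | f x ≤ f y} := by
      conv_lhs => rw [← hKeq]
      apply convexHull_min _ (hlin _)
      intro w hw'
      by_cases h : w = x
      · subst h; exact le_refl (f w)
      · exact (h1.trans (hw w ⟨hw', h⟩)).le
    exact this
  have hub : u < f b := h2 b (interior_subset hb) (min_le_right _ _)
  have hpos : 0 < f b - f x := by linarith
  set ε := min 1 ((u - f x) / (f b - f x)) with hε
  have hε0 : 0 < ε := lt_min one_pos (div_pos (by linarith) hpos)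
  have h5 : ε * (f b - f x) ≤ u - f x := by
    rw [← le_div_iff₀ hpos]; exact min_le_right _ _
  have hcone : ∀ y ∈ K, ∀ r, 1 ≤ r → r * (f y - f x) ≤ ε * (f b - f x) → f x < f y →
      x + r • (y - x) ∈ K := by
    intro y hy r hr hr1 hxy
    have hins : K.extremePoints ℝ = insert x (K.extremePoints ℝ \ {x}) := by
      rw [insert_sdiff_singleton, insert_eq_of_mem hx]
    have hne : (K.extremePoints ℝ \ {x}).Nonempty := by
      by_contra hcon
      rw [not_nonempty_iff_eq_empty] at hcon
      rw [hcon] at hins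
      rw [← hKeq, hins] at hy
      simp at hy
      rw [hy] at hxy
      exact lt_irrefl _ hxy
    have hy' := hy
    rw [← hKeq, hins, convexHull_insert hne, mem_convexJoin] at hy'
    obtain ⟨x', hx', w, hwm, hseg⟩ := hy'
    rw [mem_singleton_iff] at hx'
    subst hx'
    rw [segment_eq_image] at hseg
    obtain ⟨θ, ⟨hθ0, hθ1⟩, rfl⟩ := hseg
    have hwu : u ≤ f w := by
      have : convexHull ℝ (K.extremePoints ℝ \ {x'}) ⊆ {y | u ≤ f y} :=
        convexHull_min (fun z hz => (hw z hz).le) (hlin u)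
      exact this hwm
    have hwK : w ∈ K := by
      rw [← hKeq]; exact convexHull_mono sdiff_subset hwm
    have hfy : f ((1 - θ) • x' + θ • w) - f x' = θ * (f w - f x') := by
      simp only [map_add, map_smul, smul_eq_mul]; ring
    rw [hfy] at hr1
    have hrθ : r * θ ≤ 1 := by
      have h6 : r * θ * (f w - f x') ≤ 1 * (f w - f x') := by
        calc _ = r * (θ * (f w - f x')) := by ring
          _ ≤ _ := hr1
          _ ≤ u - f x' := h5
          _ ≤ _ := by linarith
      exact le_of_mul_le_mul_right h6 (by linarith)
    have := hK hx.1 hwK (a := 1 - r * θ) (b := r * θ) (by linarith) (by positivity) (by ring)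
    convert this using 1
    ext i; simp; ring
  obtain ⟨T0, hT0, hT⟩ := cap_cone hA hK hKc hb hx.1 (f : (Fin (n + 1) → ℝ) →ₗ[ℝ] ℝ) hmin
    (show f x < f b by linarith) hε0 (min_le_left _ _) hcone hc hc1
  refine ⟨{y | f y - f x < ε * (f b - f x)}, ?_, ?_, T0, hT0, hT⟩
  · have := f.continuous
    exact measurableSet_lt (by fun_prop) measurable_const
  · rintro y ⟨hy, hyK⟩
    by_contra hcon
    have h3 := h2 y hyK ((min_le_left _ _).trans (by simpa using hcon))
    have h4 : f y - f x < ε * (f b - f x) := hy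
    linarith

lemma DD_subset {n : ℕ} {K : Set (Fin n → ℝ)} (hK : Convex ℝ K) {b : Fin n → ℝ} (hb : b ∈ K) {T : ℝ}
    (hT : 0 ≤ T) : DD K b (Real.exp (-T)) ⊆ K := by
  rintro _ ⟨z, hz, rfl⟩
  exact hK hb hz (Real.exp_pos _).le
    (sub_nonneg.2 (Real.exp_le_one_iff.2 (by linarith))) (by ring)

lemma sum_caps {n : ℕ} {K : Set (Fin n → ℝ)} (hK : Convex ℝ K) (hKc : IsCompact K)
    {b : Fin n → ℝ} (hb : b ∈ K) (E : Finset (Fin n → ℝ)) {δ c : ℝ} (hc : 0 ≤ c)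
    (hsep : ∀ x ∈ E, ∀ y ∈ E, x ≠ y → 2 * δ ≤ dist x y)
    (hE : ∀ x ∈ E, CapC K b x δ c) :
    ∃ T0, 0 ≤ T0 ∧ ∀ T, T0 ≤ T → ENNReal.ofReal (E.card * c * (T - T0) ^ n) ≤ II K b T := by
  choose! S hS hSb T0 hT0 hT using hE
  have hle : ∀ x ∈ E, T0 x ≤ ∑ x ∈ E, T0 x := fun x hx =>
    Finset.single_le_sum (f := T0) (fun y hy => hT0 y hy) hx
  refine ⟨∑ x ∈ E, T0 x, Finset.sum_nonneg hT0, fun T hTT => ?_⟩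
  have hTnn : 0 ≤ T := (Finset.sum_nonneg hT0).trans hTT
  have hm : ∀ x ∈ E, MeasurableSet (DD K b (Real.exp (-T)) ∩ S x) := fun x hx =>
    (isCompact_DD hKc b _).measurableSet.inter (hS x hx)
  have hdisj : (E : Set (Fin n → ℝ)).PairwiseDisjoint (fun x => DD K b (Real.exp (-T)) ∩ S x) := by
    intro x hx y hy hxy
    rw [Function.onFun, Set.disjoint_left]
    rintro z ⟨hz, hzx⟩ ⟨_, hzy⟩
    have hzK := DD_subset hK hb hTnn hz
    have h1 : dist z x < δ := hSb x hx ⟨hzx, hzK⟩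
    have h2 : dist z y < δ := hSb y hy ⟨hzy, hzK⟩
    have h3 := hsep x hx y hy hxy
    have h4 := dist_triangle_left x y z
    linarith
  calc ENNReal.ofReal (E.card * c * (T - ∑ x ∈ E, T0 x) ^ n)
      = ∑ x ∈ E, ENNReal.ofReal (c * (T - ∑ x ∈ E, T0 x) ^ n) := by
        rw [Finset.sum_const, nsmul_eq_mul, mul_assoc, ENNReal.ofReal_mul (by positivity)]
        simp
    _ ≤ ∑ x ∈ E, ∫⁻ y in DD K b (Real.exp (-T)) ∩ S x, mden K y := by
        refine Finset.sum_le_sum fun x hx => le_trans ?_ (hT x hx T ((hle x hx).trans hTT))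
        apply ENNReal.ofReal_le_ofReal
        have := hle x hx
        gcongr
    _ = ∫⁻ y in ⋃ x ∈ E, DD K b (Real.exp (-T)) ∩ S x, mden K y := by
        rw [lintegral_biUnion_finset hdisj hm]
    _ ≤ _ := lintegral_mono_set (by
        intro y hy
        simp only [mem_iUnion] at hy
        obtain ⟨x, _, hy, _⟩ := hy
        exact hy)

lemma exists_sep {α : Type*} [MetricSpace α] (E : Finset α) :
    ∃ δ : ℝ, 0 < δ ∧ ∀ x ∈ E, ∀ y ∈ E, x ≠ y → 2 * δ ≤ dist x y := by
  by_cases h : E.offDiag.Nonempty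
  · obtain ⟨p, hp, hmin⟩ := E.offDiag.exists_min_image (fun p => dist p.1 p.2) h
    rw [Finset.mem_offDiag] at hp
    refine ⟨dist p.1 p.2 / 2, by have := dist_pos.2 hp.2.2; linarith, fun x hx y hy hxy => ?_⟩
    have := hmin (x, y) (Finset.mem_offDiag.2 ⟨hx, hy, hxy⟩)
    simp only at this
    linarith
  · refine ⟨1, one_pos, fun x hx y hy hxy => ?_⟩
    exact absurd ⟨(x, y), Finset.mem_offDiag.2 ⟨hx, hy, hxy⟩⟩ h

lemma asy_of_ext {n : ℕ} (hU : Unif n) (hA : ∀ (K : Set (Fin n → ℝ)) (b : Fin n → ℝ),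
      Convex ℝ K → IsCompact K → b ∈ interior K → Asy K b (n + 1))
    {K : Set (Fin (n + 1) → ℝ)} (hK : Convex ℝ K)
    (hKc : IsCompact K) {b : Fin (n + 1) → ℝ} (hb : b ∈ interior K)
    (E : Finset (Fin (n + 1) → ℝ)) (hE : ∀ x ∈ E, x ∈ K.extremePoints ℝ) :
    Asy K b E.card := by
  intro c hc hcE
  by_cases hfin : (K.extremePoints ℝ).Finite
  · obtain ⟨δ, hδ, hsep⟩ := exists_sep hfin.toFinset
    have hE0 : (0 : ℝ) < E.card := hc.trans_lt hcE
    obtain ⟨T0, hT0, hT⟩ := sum_caps hK hKc (interior_subset hb) E (δ := δ) (c := c / E.card)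
      (by positivity)
      (fun x hx y hy hxy => hsep x (by simpa using hE x hx) y (by simpa using hE y hy) hxy)
      (fun x hx => capC_cone hA hK hKc hb hfin (hE x hx) hδ (fun w hw hwx => by
        have := hsep w (by simpa using hw) x (by simpa using hE x hx) hwx
        linarith) (by positivity) (by rw [div_lt_one hE0]; exact hcE))
    refine ⟨T0, hT0, fun T hTT => ?_⟩
    have := hT T hTT
    rwa [mul_div_cancel₀ _ hE0.ne'] at this
  · obtain ⟨F, hF, hFc⟩ := Set.Infinite.exists_subset_card_eq hfin (E.card * (n + 1).factorial)
    obtain ⟨δ, hδ, hsep⟩ := exists_sep F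
    obtain ⟨T0, hT0, hT⟩ := sum_caps hK hKc (interior_subset hb) F (δ := δ)
      (c := 1 / ((n + 1).factorial : ℝ)) (by positivity) hsep
      (fun x hx => capC_unif hU hK hKc hb (hF hx) hδ)
    refine ⟨T0, hT0, fun T hTT => le_trans ?_ (hT T hTT)⟩
    apply ENNReal.ofReal_le_ofReal
    have h1 : (F.card : ℝ) * (1 / ((n + 1).factorial : ℝ)) = E.card := by
      rw [hFc]; push_cast
      have : ((n + 1).factorial : ℝ) ≠ 0 := by positivity
      field_simp
    rw [h1]
    have : 0 ≤ T - T0 := by linarith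
    gcongr

lemma convexHull_ext {E : Type*} [NormedAddCommGroup E] [NormedSpace ℝ E] {K : Set E}
    (hK : Convex ℝ K) (hKc : IsCompact K) (hfin : (K.extremePoints ℝ).Finite) :
    convexHull ℝ (K.extremePoints ℝ) = K := by
  have h := closure_convexHull_extremePoints hKc hK
  rwa [(hfin.isClosed_convexHull (𝕜 := ℝ)).closure_eq] at h

/-- either many extreme points or affinely independent ones. -/
lemma ext_card {n : ℕ} {K : Set (Fin n → ℝ)} (hK : Convex ℝ K) (hKc : IsCompact K)
    (hi : (interior K).Nonempty) (hfin : (K.extremePoints ℝ).Finite) :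
    n + 1 ≤ hfin.toFinset.card ∧ (hfin.toFinset.card = n + 1 →
      AffineIndependent ℝ ((↑) : hfin.toFinset → (Fin n → ℝ))) := by
  have hspan : affineSpan ℝ (K.extremePoints ℝ) = ⊤ := by
    rw [← interior_convexHull_nonempty_iff_affineSpan_eq_top, convexHull_ext hK hKc hfin]
    exact hi
  have hrange : Set.range ((↑) : hfin.toFinset → (Fin n → ℝ)) = K.extremePoints ℝ := by
    simp
  have hfr : Module.finrank ℝ (vectorSpan ℝ (Set.range ((↑) : hfin.toFinset → (Fin n → ℝ)))) = n := by
    rw [hrange, ← direction_affineSpan, hspan, AffineSubspace.direction_top]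
    simp
  have hne : hfin.toFinset.card ≠ 0 := by
    intro h0
    rw [Finset.card_eq_zero] at h0
    have h1 : K.extremePoints ℝ = ∅ := by
      simpa using h0
    rw [h1] at hspan
    simp at hspan
  obtain ⟨m, hm⟩ := Nat.exists_eq_succ_of_ne_zero hne
  constructor
  · have := finrank_vectorSpan_range_le ℝ ((↑) : hfin.toFinset → (Fin n → ℝ)) (n := m)
      (by simpa using hm)
    rw [hfr] at this
    omega
  · intro hcard
    rw [affineIndependent_iff_finrank_vectorSpan_eq ℝ _ (n := n) (by simpa using hcard)]
    exact hfr

lemma ext_many {n : ℕ} {K : Set (Fin n → ℝ)} (hK : Convex ℝ K) (hKc : IsCompact K)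
    (hi : (interior K).Nonempty) :
    ∃ E : Finset (Fin n → ℝ), E.card = n + 1 ∧ ∀ x ∈ E, x ∈ K.extremePoints ℝ := by
  by_cases hfin : (K.extremePoints ℝ).Finite
  · obtain ⟨E, hE, hEc⟩ := Finset.exists_subset_card_eq (ext_card hK hKc hi hfin).1
    exact ⟨E, hEc, fun x hx => by simpa using hE hx⟩
  · obtain ⟨F, hF, hFc⟩ := Set.Infinite.exists_subset_card_eq hfin (n + 1)
    exact ⟨F, hFc, fun x hx => hF hx⟩

lemma main_induction (n : ℕ) : Unif n ∧ ∀ (K : Set (Fin n → ℝ)) (b : Fin n → ℝ),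
      Convex ℝ K → IsCompact K → b ∈ interior K → Asy K b (n + 1) := by
  induction n with
  | zero =>
    have key : ∀ (K : Set (Fin 0 → ℝ)) (b : Fin 0 → ℝ), b ∈ interior K → ∀ T, 1 ≤ II K b T := by
      intro K b hb T
      have hD : DD K b (Real.exp (-T)) = univ := by
        apply Subsingleton.eq_univ_of_nonempty
        exact ⟨_, b, interior_subset hb, rfl⟩
      have hm : ∀ x, 1 ≤ mden K x := by
        intro x
        have := le_mden (K := K) (A := 0) (c := 0) (fun x _ i => i.elim0) x
        simpa using this
      unfold II
      rw [hD, Measure.restrict_univ]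
      calc (1 : ℝ≥0∞) = ∫⁻ x : Fin 0 → ℝ, 1 := by
            rw [lintegral_one]
            have := Real.volume_pi_ball (ι := Fin 0) 0 one_pos
            rw [Subsingleton.eq_univ_of_nonempty ⟨0, mem_ball_self one_pos⟩] at this
            simpa using this.symm
        _ ≤ _ := lintegral_mono hm
    constructor
    · intro K b _ _ hb T _
      simpa using key K b hb T
    · intro K b _ _ hb c hc hc1
      refine ⟨0, le_rfl, fun T _ => le_trans ?_ (key K b hb T)⟩
      simp at hc1 ⊢
      exact hc1.le
  | succ n ih =>
    obtain ⟨hU, hA⟩ := ih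
    constructor
    · intro K b hK hKc hb T hT
      obtain ⟨x, hx⟩ := hKc.extremePoints_nonempty ⟨b, interior_subset hb⟩
      obtain ⟨g, u, h1, h2⟩ := ext_sep hK hKc hx (δ := dist b x) (by
        rw [dist_pos]
        rintro rfl
        exact ext_not_interior hx hb)
      obtain ⟨v, hv, hvmin⟩ := hKc.exists_isMinOn ⟨b, interior_subset hb⟩ g.continuous.continuousOn
      have h3 : g v ≤ g x := hvmin hx.1
      have h4 := h2 b (interior_subset hb) le_rfl
      have := cap_unif hU hK hKc hb hv (g : (Fin (n + 1) → ℝ) →ₗ[ℝ] ℝ) (fun y hy => hvmin hy)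
        (show g v < g b by linarith) one_pos le_rfl (T := T) (by simpa using hT)
      rw [Real.log_one, add_zero] at this
      exact this.trans (lintegral_mono_set inter_subset_left)
    · intro K b hK hKc hb
      obtain ⟨E, hEc, hE⟩ := ext_many hK hKc ⟨b, hb⟩
      have := asy_of_ext hU hA hK hKc hb E hE
      rw [hEc] at this
      exact_mod_cast this

/-- the hexagon-like body. -/
def Hset (n : ℕ) : Set (Fin n → ℝ) :=
  {w | (∀ i, |w i| < 2) ∧ ∀ i j, w i - w j < 2}

lemma ball_subset_Hset (n : ℕ) : ball (0 : Fin n → ℝ) 1 ⊆ Hset n := by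
  intro w hw
  have h1 : ∀ i, |w i| < 1 := by
    intro i
    have h2 : ‖w‖ < 1 := by simpa using hw
    exact (norm_le_pi_norm w i).trans_lt h2
  refine ⟨fun i => (h1 i).trans (by norm_num), fun i j => ?_⟩
  have h2 := abs_lt.1 (h1 i)
  have h3 := abs_lt.1 (h1 j)
  linarith [h2.1, h2.2, h3.1, h3.2]

lemma volume_Hset_ne_zero (n : ℕ) : volume (Hset n) ≠ 0 := by
  intro h
  have h1 := measure_mono_null (ball_subset_Hset n) h
  exact (measure_ball_pos volume (0 : Fin n → ℝ) one_pos).ne' h1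

lemma volume_Hset_le (n : ℕ) : volume (Hset n) ≤ ((n + 1 : ℕ) : ℝ≥0∞) * 2 ^ n := by
  set B0 : Set (Fin n → ℝ) := Icc (fun _ => 0) (fun _ => 2) with hB0
  set B : Fin n → Set (Fin n → ℝ) := fun k =>
    Icc (Function.update (fun _ => 0) k (-2)) (Function.update (fun _ => 2) k 0) with hB
  set L : Fin n → ((Fin n → ℝ) →ₗ[ℝ] (Fin n → ℝ)) := fun k =>
    LinearMap.transvection (LinearMap.proj k) (Function.update (fun _ => -1) k 0) with hL
  have hdet : ∀ k, LinearMap.det (L k) = 1 := by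
    intro k
    rw [hL]
    simp only
    rw [LinearMap.transvection.det]
    simp
  have hsub : Hset n ⊆ B0 ∪ ⋃ k, (L k) ⁻¹' (B k) := by
    intro w hw
    by_cases h : ∀ i, 0 ≤ w i
    · left
      exact ⟨fun i => h i, fun i => (abs_lt.1 (hw.1 i)).2.le⟩
    · right
      push Not at h
      obtain ⟨i, hi⟩ := h
      obtain ⟨k, -, hk⟩ := Finset.exists_min_image Finset.univ w ⟨i, Finset.mem_univ i⟩
      have hk0 : w k < 0 := (hk i (Finset.mem_univ i)).trans_lt hi
      refine mem_iUnion.2 ⟨k, ?_⟩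
      have hLw : ∀ j, L k w j = if j = k then w k else w j - w k := by
        intro j
        simp only [hL, LinearMap.transvection.apply, LinearMap.proj_apply, Pi.add_apply,
          Pi.smul_apply, smul_eq_mul]
        by_cases hj : j = k
        · subst hj; simp
        · simp [Function.update_of_ne hj, hj]; ring
      refine ⟨fun j => ?_, fun j => ?_⟩
      · rw [hLw]
        by_cases hj : j = k
        · subst hj
          simp only [Function.update_self, if_true]
          exact (abs_lt.1 (hw.1 j)).1.le
        · simp only [Function.update_of_ne hj, if_neg hj]
          linarith [hk j (Finset.mem_univ j)]
      · rw [hLw]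
        by_cases hj : j = k
        · subst hj
          simp only [Function.update_self, if_true]
          exact hk0.le
        · simp only [Function.update_of_ne hj, if_neg hj]
          exact (hw.2 j k).le
  have hvB0 : volume B0 = 2 ^ n := by
    rw [hB0, Real.volume_Icc_pi]
    simp
  have hvB : ∀ k, volume ((L k) ⁻¹' (B k)) = 2 ^ n := by
    intro k
    rw [Measure.addHaar_preimage_linearMap volume (by rw [hdet]; exact one_ne_zero), hdet]
    simp only [inv_one, abs_one, ENNReal.ofReal_one, one_mul, hB]
    rw [Real.volume_Icc_pi]
    have : ∀ i : Fin n, ENNReal.ofReal ((Function.update (fun _ => (2 : ℝ)) k 0 : Fin n → ℝ) i -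
        (Function.update (fun _ => (0 : ℝ)) k (-2) : Fin n → ℝ) i) = 2 := by
      intro i
      by_cases hi : i = k
      · subst hi; simp
      · simp [Function.update_of_ne hi]
    simp [this]
  calc volume (Hset n) ≤ volume (B0 ∪ ⋃ k, (L k) ⁻¹' (B k)) := measure_mono hsub
    _ ≤ volume B0 + volume (⋃ k, (L k) ⁻¹' (B k)) := measure_union_le _ _
    _ ≤ volume B0 + ∑ k, volume ((L k) ⁻¹' (B k)) := by
        gcongr; exact measure_iUnion_fintype_le _ _
    _ = ((n + 1 : ℕ) : ℝ≥0∞) * 2 ^ n := by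
        simp [hvB0, hvB]; ring

lemma volume_Hset_ne_top (n : ℕ) : volume (Hset n) ≠ ⊤ := by
  refine ne_top_of_le_ne_top ?_ (volume_Hset_le n)
  exact ENNReal.mul_ne_top (by simp) (by simp)

lemma sSup_inv_ge {E : Type*} [NormedAddCommGroup E] [NormedSpace ℝ E] {U : Set E} (hU : IsOpen U)
    {x : E} (hx : x ∈ U) (L : E →ₗ[ℝ] ℝ) (c : ℝ) (hL : ∀ y ∈ U, 0 ≤ L y + c)
    (hLx : 0 < L x + c) (v : E) :
    - (L v / (L x + c)) ≤ 1 / sSup {t : ℝ | 0 < t ∧ x + t • v ∈ U} ∧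
    0 ≤ 1 / sSup {t : ℝ | 0 < t ∧ x + t • v ∈ U} := by
  have h0 : 0 ≤ 1 / sSup {t : ℝ | 0 < t ∧ x + t • v ∈ U} :=
    div_nonneg one_pos.le (Real.sSup_nonneg fun t ht => ht.1.le)
  refine ⟨?_, h0⟩
  by_cases hv : 0 ≤ L v
  · have : 0 ≤ L v / (L x + c) := by positivity
    linarith
  · push Not at hv
    have hub : ∀ t ∈ {t : ℝ | 0 < t ∧ x + t • v ∈ U}, t ≤ (L x + c) / (- L v) := by
      rintro t ⟨ht, htU⟩
      have := hL _ htU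
      rw [map_add, map_smul, smul_eq_mul] at this
      rw [le_div_iff₀ (by linarith)]
      linarith
    obtain ⟨t0, ht0, ht0U⟩ : ∃ t : ℝ, 0 < t ∧ x + t • v ∈ U := by
      have hc : Continuous (fun t : ℝ => x + t • v) := by fun_prop
      have h1 : Tendsto (fun t : ℝ => x + t • v) (𝓝[>] 0) (𝓝 x) := by
        have := (hc.tendsto 0).mono_left (nhdsWithin_le_nhds (s := Ioi 0))
        simpa using this
      obtain ⟨t, h2, h3⟩ := ((h1.eventually (hU.mem_nhds hx)).and self_mem_nhdsWithin).exists
      exact ⟨t, h3, h2⟩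
    have hpos : 0 < sSup {t : ℝ | 0 < t ∧ x + t • v ∈ U} :=
      ht0.trans_le (le_csSup ⟨_, hub⟩ ⟨ht0, ht0U⟩)
    have hle : sSup {t : ℝ | 0 < t ∧ x + t • v ∈ U} ≤ (L x + c) / (- L v) :=
      csSup_le ⟨t0, ht0, ht0U⟩ hub
    rw [le_div_iff₀ hpos]
    calc - (L v / (L x + c)) * sSup {t : ℝ | 0 < t ∧ x + t • v ∈ U}
        ≤ - (L v / (L x + c)) * ((L x + c) / (- L v)) := by
          apply mul_le_mul_of_nonneg_left hle
          rw [← neg_div]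
          exact div_nonneg (by linarith) hLx.le
      _ = 1 := by
          have := hLx.ne'
          have := hv.ne
          field_simp

lemma finsler_ge {d : ℕ} {U : Set (Euc d)} (hU : IsOpen U)
    {x : Euc d} (hx : x ∈ U) (L M : Euc d →ₗ[ℝ] ℝ) (c e : ℝ) (hL : ∀ y ∈ U, 0 ≤ L y + c)
    (hLx : 0 < L x + c) (hM : ∀ y ∈ U, 0 ≤ M y + e)
    (hMx : 0 < M x + e) (v : Euc d) (hv : v ≠ 0) :
    M v / (M x + e) - L v / (L x + c) ≤ 2 * finslerNorm U x v ∧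
    |L v / (L x + c)| ≤ 2 * finslerNorm U x v := by
  have h1 := sSup_inv_ge hU hx L c hL hLx v
  have h2 := sSup_inv_ge hU hx M e hM hMx (-v)
  have h3 := sSup_inv_ge hU hx L c hL hLx (-v)
  simp only [smul_neg, ← sub_eq_add_neg, map_neg, neg_div, neg_neg] at h2 h3
  unfold finslerNorm
  rw [if_neg hv]
  refine ⟨by linarith [h1.1, h2.1], ?_⟩
  rw [abs_le]
  constructor <;> linarith [h1.1, h1.2, h2.1, h2.2, h3.1, h3.2]

/-- coordinates. -/
def cE (d : ℕ) : Euc d ≃L[ℝ] (Fin d → ℝ) := EuclideanSpace.equiv (Fin d) ℝ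

lemma cE_mp (d : ℕ) : MeasurePreserving (cE d) volume volume := PiLp.volume_preserving_ofLp (Fin d)

lemma cE_emb (d : ℕ) : MeasurableEmbedding (cE d) :=
  (cE d).toHomeomorph.measurableEmbedding

lemma adm_pos {n : ℕ} {K : Set (Fin n → ℝ)} {A : Matrix (Fin n) (Fin n) ℝ} {c : Fin n → ℝ}
    (h : Adm K A c) (hA : A.det ≠ 0) {x : Fin n → ℝ} (hx : x ∈ interior K) (i : Fin n) :
    0 < (A.mulVec x + c) i := by
  refine lt_of_le_of_ne (h x (interior_subset hx) i) fun h0 => hA ?_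
  apply Matrix.det_eq_zero_of_row_eq_zero i
  have hc : Continuous (fun t : ℝ => x - t • A i) := by fun_prop
  have h1 : Tendsto (fun t : ℝ => x - t • A i) (𝓝[>] 0) (𝓝 x) := by
    have := (hc.tendsto 0).mono_left (nhdsWithin_le_nhds (s := Ioi 0))
    simpa using this
  obtain ⟨t, h2, h3⟩ := ((h1.eventually (mem_interior_iff_mem_nhds.1 hx)).and
    self_mem_nhdsWithin).exists
  have ht : (0 : ℝ) < t := h3
  have h4 := h _ h2 i
  rw [Matrix.mulVec_sub, Matrix.mulVec_smul] at h4
  have h5 : (A.mulVec (A i)) i = ∑ j, A i j * A i j := rfl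
  have h6 : t * (A.mulVec (A i)) i ≤ 0 := by
    simp only [Pi.add_apply, Pi.sub_apply, Pi.smul_apply, smul_eq_mul] at h4 h0
    linarith
  have h7 : ∑ j, A i j * A i j ≤ 0 := by
    rw [← h5]; exact nonpos_of_mul_nonpos_right h6 ht
  have h8 : ∑ j, A i j * A i j = 0 :=
    le_antisymm h7 (Finset.sum_nonneg fun j _ => mul_self_nonneg _)
  intro j
  have := (Finset.sum_eq_zero_iff_of_nonneg (fun j _ => mul_self_nonneg (A i j))).1 h8 j
    (Finset.mem_univ j)
  simpa using this

lemma dens_lb {d : ℕ} {Ω : Set (Euc d)} {x : Euc d} (hx : x ∈ interior Ω) :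
    mden (cE d '' Ω) (cE d x) * volume (finslerUnitBall (interior Ω) x) ≤ volume (Hset d) := by
  unfold mden
  rw [ENNReal.iSup_mul]
  refine iSup_le fun A => ?_
  rw [ENNReal.iSup_mul]
  refine iSup_le fun c => ?_
  rw [ENNReal.iSup_mul]
  refine iSup_le fun hA => ?_
  by_cases hdet : A.det = 0
  · simp [hdet]
  have hxi : cE d x ∈ interior (cE d '' Ω) := by
    have : cE d '' interior Ω = interior (cE d '' Ω) := (cE d).toHomeomorph.image_interior Ω
    rw [← this]; exact mem_image_of_mem _ hx
  have hpos := adm_pos hA hdet hxi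
  set h : Fin d → ℝ := A.mulVec (cE d x) + c with hh
  set W : (Fin d → ℝ) →ₗ[ℝ] (Fin d → ℝ) := Matrix.toLin' (Matrix.diagonal (fun i => (h i)⁻¹) * A)
    with hW
  have hWdet : LinearMap.det W = (∏ i, h i)⁻¹ * A.det := by
    rw [hW, LinearMap.det_toLin', Matrix.det_mul, Matrix.det_diagonal, Finset.prod_inv_distrib]
  have hprod : 0 < ∏ i, h i := Finset.prod_pos fun i _ => hpos i
  have hWapp : ∀ v i, W v i = A.mulVec v i / h i := by
    intro v i
    rw [hW, Matrix.toLin'_apply, ← Matrix.mulVec_mulVec, Matrix.mulVec_diagonal, div_eq_inv_mul]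
  let ℓ : Fin d → (Euc d →ₗ[ℝ] ℝ) := fun i =>
    (LinearMap.proj i).comp ((Matrix.toLin' A).comp (cE d).toLinearMap)
  have hℓ : ∀ i v, ℓ i v = A.mulVec (cE d v) i := fun i v => by
    simp [ℓ]
  have hsub : finslerUnitBall (interior Ω) x ⊆ cE d ⁻¹' (W ⁻¹' Hset d) := by
    intro v hv
    have hv1 : finslerNorm (interior Ω) x v < 1 := hv
    by_cases hv0 : v = 0
    · subst hv0
      simp only [mem_preimage, map_zero]
      exact ball_subset_Hset d (mem_ball_self one_pos)
    have hnn : ∀ i, ∀ y ∈ interior Ω, 0 ≤ ℓ i y + c i := fun i y hy => by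
      rw [hℓ]; exact hA _ (mem_image_of_mem _ (interior_subset hy)) i
    have hp' : ∀ i, 0 < ℓ i x + c i := fun i => by
      rw [hℓ]; exact hpos i
    have hrw : ∀ i, W (cE d v) i = ℓ i v / (ℓ i x + c i) := fun i => by
      rw [hWapp, hℓ, hℓ]; rfl
    refine ⟨fun i => ?_, fun i j => ?_⟩
    · rw [hrw]
      have := (finsler_ge isOpen_interior hx (ℓ i) (ℓ i) (c i) (c i) (hnn i) (hp' i) (hnn i)
        (hp' i) v hv0).2
      linarith
    · rw [hrw, hrw]
      have := (finsler_ge isOpen_interior hx (ℓ j) (ℓ i) (c j) (c i) (hnn j) (hp' j) (hnn i)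
        (hp' i) v hv0).1
      linarith
  have hvol : volume (finslerUnitBall (interior Ω) x) ≤
      ENNReal.ofReal |(LinearMap.det W)⁻¹| * volume (Hset d) := by
    rw [← Measure.addHaar_preimage_linearMap volume (by
      rw [hWdet]; exact mul_ne_zero (inv_ne_zero hprod.ne') hdet)]
    rw [← (cE_mp d).measure_preimage_emb (cE_emb d)]
    exact measure_mono hsub
  calc _ ≤ ENNReal.ofReal |A.det| * (ENNReal.ofReal (∏ i, h i))⁻¹ *
        (ENNReal.ofReal |(LinearMap.det W)⁻¹| * volume (Hset d)) := by gcongr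
    _ = volume (Hset d) := by
        rw [← mul_assoc, ← ENNReal.ofReal_inv_of_pos hprod, ← ENNReal.ofReal_mul (abs_nonneg _),
          ← ENNReal.ofReal_mul (by positivity), hWdet, mul_inv, inv_inv, abs_mul, abs_of_pos hprod,
          abs_inv]
        have : |A.det| * (∏ i, h i)⁻¹ * ((∏ i, h i) * |A.det|⁻¹) = 1 := by
          have := abs_ne_zero.2 hdet
          have := hprod.ne'
          field_simp
        rw [this]; simp

lemma dens_lb' {d : ℕ} {Ω : Set (Euc d)} {x : Euc d} (hx : x ∈ interior Ω) :
    volume (ball (0 : Euc d) 1) / volume (Hset d) * mden (cE d '' Ω) (cE d x) ≤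
      volume (ball (0 : Euc d) 1) / volume (finslerUnitBall (interior Ω) x) := by
  have h0 := volume_Hset_ne_zero d
  have h1 := volume_Hset_ne_top d
  have : mden (cE d '' Ω) (cE d x) ≤ volume (Hset d) / volume (finslerUnitBall (interior Ω) x) :=
    (ENNReal.le_div_iff_mul_le (Or.inr h0) (Or.inr h1)).2 (dens_lb hx)
  calc _ ≤ volume (ball (0 : Euc d) 1) / volume (Hset d) *
        (volume (Hset d) / volume (finslerUnitBall (interior Ω) x)) := by gcongr
    _ = _ := by
        rw [div_eq_mul_inv, div_eq_mul_inv, div_eq_mul_inv, mul_assoc, ← mul_assoc _ (volume (Hset d)),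
          ENNReal.inv_mul_cancel h0 h1, one_mul]

lemma hilbert_le {d : ℕ} {Ω : Set (Euc d)} (hΩ : Convex ℝ Ω) (hc : IsCompact Ω) {p : Euc d}
    (hp : p ∈ interior Ω) : ∃ C : ℝ, 0 ≤ C ∧ ∀ R, C ≤ 2 * R → ∀ z ∈ Ω,
      Real.exp (-(2 * R - C)) • p + (1 - Real.exp (-(2 * R - C))) • z ∈
        hilbertBall (interior Ω) p R := by
  obtain ⟨r, hr, hball⟩ := Metric.isOpen_iff.1 isOpen_interior p hp
  obtain ⟨M, hM⟩ := hc.isBounded.subset_ball p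
  have hM0 : 0 < M := by
    have := hM (interior_subset hp)
    simpa using this
  set δ := r / M with hδ
  have hδ0 : 0 < δ := div_pos hr hM0
  refine ⟨Real.log (1 + 1 / δ), Real.log_nonneg (by have : 0 < 1 / δ := by positivity
                                                    linarith), ?_⟩
  intro R hR z hz
  set C := Real.log (1 + 1 / δ) with hC
  have hC0 : 0 ≤ C := Real.log_nonneg (by have : 0 < 1 / δ := by positivity
                                          linarith)
  set ρ := Real.exp (-(2 * R - C)) with hρ
  have hρ0 : 0 < ρ := Real.exp_pos _
  have hρ1 : ρ ≤ 1 := Real.exp_le_one_iff.2 (by linarith)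
  set x := ρ • p + (1 - ρ) • z with hx
  have hxU : x ∈ interior Ω := hΩ.combo_interior_self_mem_interior hp hz hρ0 (by linarith) (by ring)
  refine ⟨hxU, ?_⟩
  unfold hilbertDist
  by_cases hpx : p = x
  · rw [if_pos hpx]; linarith
  rw [if_neg hpx]
  have hρ1' : ρ < 1 := by
    refine lt_of_le_of_ne hρ1 fun h => hpx ?_
    rw [hx, h]; simp
  have hxp : x - p = (1 - ρ) • (z - p) := by
    rw [hx]; module
  have hzp : 0 < ‖x - p‖ := norm_pos_iff.2 (sub_ne_zero.2 (Ne.symm hpx))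
  set S := {t : ℝ | p + t • (x - p) ∈ interior Ω} with hS
  have hbd : ∀ t ∈ S, |t| * ‖x - p‖ < M := by
    intro t ht
    have := hM (interior_subset ht)
    rw [mem_ball, dist_eq_norm, add_sub_cancel_left, norm_smul, Real.norm_eq_abs] at this
    exact this
  have hbd' : ∀ t ∈ S, |t| ≤ M / ‖x - p‖ := fun t ht => by
    rw [le_div_iff₀ hzp]; exact (hbd t ht).le
  have hba : BddAbove S := ⟨M / ‖x - p‖, fun t ht => (le_abs_self t).trans (hbd' t ht)⟩
  have hbb : BddBelow S := ⟨-(M / ‖x - p‖), fun t ht => neg_le.1 ((neg_le_abs t).trans (hbd' t ht))⟩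
  have hS1 : 1 / (1 - ρ) ≤ sSup S := by
    apply le_of_forall_lt
    intro s hs
    obtain ⟨t, ht, ht'⟩ := exists_between (max_lt hs (show (0 : ℝ) < 1 / (1 - ρ) by
      apply div_pos one_pos; linarith))
    have ht0 : 0 < t := (le_max_right _ _).trans_lt ht
    refine ((le_max_left _ _).trans_lt ht).trans_le (le_csSup hba ?_)
    show p + t • (x - p) ∈ interior Ω
    have h1 : t * (1 - ρ) < 1 := by rwa [lt_div_iff₀ (by linarith)] at ht'
    have := hΩ.combo_interior_self_mem_interior hp hz (a := 1 - t * (1 - ρ)) (b := t * (1 - ρ))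
      (by linarith) (mul_nonneg ht0.le (by linarith)) (by ring)
    rw [hxp]
    convert this using 1
    module
  have hI1 : sInf S ≤ -δ := by
    apply le_of_forall_gt
    intro s hs
    obtain ⟨t, ht, ht'⟩ := exists_between (lt_min hs (show -δ < 0 by linarith))
    have ht0 : t < 0 := ht'.trans_le (min_le_right _ _)
    refine lt_of_le_of_lt (csInf_le hbb ?_) (ht'.trans_le (min_le_left _ _))
    apply hball
    rw [mem_ball, dist_eq_norm, add_sub_cancel_left, norm_smul, Real.norm_eq_abs, abs_of_neg ht0]
    have h1 : ‖x - p‖ < M := by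
      have := hM (interior_subset hxU)
      rwa [mem_ball, dist_eq_norm] at this
    calc -t * ‖x - p‖ ≤ -t * M := by
          apply mul_le_mul_of_nonneg_left h1.le; linarith
      _ < δ * M := by
          apply mul_lt_mul_of_pos_right _ hM0; linarith
      _ = r := by rw [hδ]; field_simp
  set β := sSup S
  set α := sInf S
  have hβ1 : 1 < β := by
    refine lt_of_lt_of_le ?_ hS1
    rw [lt_div_iff₀ (by linarith)]; linarith
  have hα : 0 < -α := by linarith
  have h1 : (1 - α) / (-α) ≤ 1 + 1 / δ := by
    have : (1 - α) / (-α) = 1 + 1 / (-α) := by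
      have := hα.ne'
      rw [eq_comm, add_comm, div_add_one this]; ring
    rw [this]
    have : 1 / (-α) ≤ 1 / δ := one_div_le_one_div_of_le hδ0 (by linarith)
    linarith
  have h2 : β / (β - 1) ≤ ρ⁻¹ := by
    rw [div_le_iff₀ (by linarith), ← div_eq_inv_mul, le_div_iff₀ hρ0]
    rw [div_le_iff₀ (by linarith)] at hS1
    linarith
  have h3 : 0 < (1 - α) / (-α) := div_pos (by linarith) hα
  have h4 : 0 < β / (β - 1) := div_pos (by linarith) (by linarith)
  have h5 : Real.log ((1 - α) / (-α) * (β / (β - 1))) ≤ C + (2 * R - C) := by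
    rw [Real.log_mul h3.ne' h4.ne']
    apply add_le_add
    · exact Real.log_le_log h3 h1
    · have := Real.log_le_log h4 h2
      rwa [hρ, ← Real.exp_neg, Real.log_exp, neg_neg] at this
  linarith

lemma asymp_lb {d : ℕ} {Ω : Set (Euc d)} (hΩ : Convex ℝ Ω) (hc : IsCompact Ω) {p : Euc d}
    (hp : p ∈ interior Ω) {a : ℝ} (hA : Asy (cE d '' Ω) (cE d p) a) {c : ℝ} (hc0 : 0 ≤ c) (hca : c < a) :
    volume (ball (0 : Euc d) 1) * ENNReal.ofReal (c / (d + 1)) ≤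
    liminf (fun R : ℝ =>
        busemannVol (interior Ω) (hilbertBall (interior Ω) p R) / ENNReal.ofReal (R ^ d)) atTop := by
  obtain ⟨T0, hT0, hT⟩ := hA c hc0 hca
  obtain ⟨C, hC, hball⟩ := hilbert_le hΩ hc hp
  set k := volume (ball (0 : Euc d) 1) / volume (Hset d) with hk
  have hktop : k ≠ ⊤ := ENNReal.div_ne_top measure_ball_lt_top.ne (volume_Hset_ne_zero d)
  have hlow : ∀ R, C + T0 ≤ 2 * R → k * ENNReal.ofReal (c * (2 * R - (C + T0)) ^ d) ≤
      busemannVol (interior Ω) (hilbertBall (interior Ω) p R) := by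
    intro R hR
    set D := cE d ⁻¹' (DD (cE d '' Ω) (cE d p) (Real.exp (-(2 * R - C)))) with hD
    have hDsub : D ⊆ hilbertBall (interior Ω) p R := by
      rintro x ⟨_, ⟨z, hz, rfl⟩, hxz⟩
      have := hball R (by linarith) z hz
      convert this using 1
      apply (cE d).injective
      rw [← hxz]
      simp
    have hDm : MeasurableSet D :=
      (cE_emb d).measurable (isCompact_DD (hc.image (cE d).continuous) _ _).measurableSet
    calc k * ENNReal.ofReal (c * (2 * R - (C + T0)) ^ d)
        ≤ k * II (cE d '' Ω) (cE d p) (2 * R - C) := by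
          gcongr
          have := hT (2 * R - C) (by linarith)
          rwa [sub_sub] at this
      _ = k * ∫⁻ x in D, mden (cE d '' Ω) (cE d x) := by
          unfold II
          rw [hD, (cE_mp d).setLIntegral_comp_preimage_emb (cE_emb d)]
      _ = ∫⁻ x in D, k * mden (cE d '' Ω) (cE d x) := by
          rw [lintegral_const_mul' _ _ hktop]
      _ ≤ ∫⁻ x in D, volume (ball (0 : Euc d) 1) / volume (finslerUnitBall (interior Ω) x) :=
          setLIntegral_mono' hDm fun x hx => dens_lb' (hDsub hx).1
      _ ≤ _ := lintegral_mono_set hDsub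
  have hlim : Tendsto (fun R : ℝ => k * ENNReal.ofReal (c * (2 - (C + T0) / R) ^ d)) atTop
      (𝓝 (k * ENNReal.ofReal (c * 2 ^ d))) := by
    apply ENNReal.Tendsto.const_mul _ (Or.inr hktop)
    apply ENNReal.tendsto_ofReal
    have h1 : Tendsto (fun R : ℝ => (C + T0) / R) atTop (𝓝 0) :=
      tendsto_const_nhds.div_atTop tendsto_id
    have h2 := ((tendsto_const_nhds (x := (2 : ℝ))).sub h1).pow d |>.const_mul c
    simpa using h2
  have hle : k * ENNReal.ofReal (c * 2 ^ d) ≤ liminf (fun R : ℝ =>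
        busemannVol (interior Ω) (hilbertBall (interior Ω) p R) / ENNReal.ofReal (R ^ d)) atTop := by
    rw [← hlim.liminf_eq]
    refine liminf_le_liminf ?_
    filter_upwards [eventually_gt_atTop (max 0 ((C + T0) / 2))] with R hR
    have hR0 : 0 < R := (le_max_left _ _).trans_lt hR
    have hR1 : (C + T0) / 2 < R := (le_max_right _ _).trans_lt hR
    have hpow : 0 < R ^ d := by positivity
    rw [ENNReal.le_div_iff_mul_le (Or.inl (by simpa using hpow)) (Or.inl ENNReal.ofReal_ne_top)]
    refine le_trans (le_of_eq ?_) (hlow R (by linarith))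
    rw [mul_assoc, ← ENNReal.ofReal_mul' hpow.le, mul_assoc, ← mul_pow]
    congr 4
    field_simp
  refine le_trans ?_ hle
  rw [hk, div_eq_mul_inv (volume _), mul_assoc (volume (ball (0 : Euc d) 1))]
  gcongr
  have h1 := volume_Hset_ne_zero d
  have h2 := volume_Hset_ne_top d
  rw [← ENNReal.div_eq_inv_mul, ENNReal.le_div_iff_mul_le (Or.inl h1) (Or.inl h2)]
  calc _ ≤ ENNReal.ofReal (c / (d + 1)) * (((d + 1 : ℕ) : ℝ≥0∞) * 2 ^ d) := by
        gcongr; exact volume_Hset_le d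
    _ = ENNReal.ofReal (c / (d + 1)) * ENNReal.ofReal ((d + 1) * 2 ^ d) := by
        rw [ENNReal.ofReal_mul (by positivity), ENNReal.ofReal_pow (by norm_num)]
        congr 2
        · rw [← Nat.cast_succ, ENNReal.ofReal_natCast]
        · simp
    _ = ENNReal.ofReal (c * 2 ^ d) := by
        rw [← ENNReal.ofReal_mul (by positivity)]
        congr 1
        field_simp
    _ ≤ _ := le_rfl

lemma asymp_lb' {d : ℕ} {Ω : Set (Euc d)} (hΩ : Convex ℝ Ω) (hc : IsCompact Ω) {p : Euc d}
    (hp : p ∈ interior Ω) {a : ℝ} (ha : 0 < a) (hA : Asy (cE d '' Ω) (cE d p) a) :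
    volume (ball (0 : Euc d) 1) * ENNReal.ofReal (a / (d + 1)) ≤
    liminf (fun R : ℝ =>
        busemannVol (interior Ω) (hilbertBall (interior Ω) p R) / ENNReal.ofReal (R ^ d)) atTop := by
  have hlim : Tendsto (fun c : ℝ => volume (ball (0 : Euc d) 1) * ENNReal.ofReal (c / (d + 1)))
      (𝓝[<] a) (𝓝 (volume (ball (0 : Euc d) 1) * ENNReal.ofReal (a / (d + 1)))) := by
    apply ENNReal.Tendsto.const_mul _ (Or.inr measure_ball_lt_top.ne)
    apply ENNReal.tendsto_ofReal
    exact (tendsto_id.mono_right nhdsWithin_le_nhds).div_const _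
  refine le_of_tendsto hlim ?_
  filter_upwards [self_mem_nhdsWithin, Ioo_mem_nhdsLT ha] with c hc1 hc2
  exact asymp_lb hΩ hc hp hA hc2.1.le hc1

/-- `ℓ i + c i` are the barycentric coordinates of a simplex with interior `U`. -/
def Bary {d : ℕ} (U : Set (Euc d)) (ℓ : Fin (d + 1) → (Euc d →ₗ[ℝ] ℝ)) (c : Fin (d + 1) → ℝ) : Prop :=
  (∀ x, x ∈ U ↔ ∀ i, 0 < ℓ i x + c i) ∧ (∀ x, ∑ i, (ℓ i x + c i) = 1) ∧
  (∀ v, ∑ i, ℓ i v = 0) ∧ (∀ v, (∀ i, ℓ i v = 0) → v = 0)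

section bary
variable {d : ℕ} {U : Set (Euc d)} {ℓ : Fin (d + 1) → (Euc d →ₗ[ℝ] ℝ)} {c : Fin (d + 1) → ℝ}

lemma Bary.exists_neg (hB : Bary U ℓ c) {v : Euc d} (hv : v ≠ 0) : ∃ i, ℓ i v < 0 := by
  by_contra hcon
  push Not at hcon
  have h := (Finset.sum_eq_zero_iff_of_nonneg (fun i _ => hcon i)).1 (hB.2.2.1 v)
  exact hv (hB.2.2.2 v fun i => h i (Finset.mem_univ i))

lemma Bary.bdd (hB : Bary U ℓ c) {v : Euc d} (hv : v ≠ 0) (x : Euc d) :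
    ∃ B, ∀ t : ℝ, x + t • v ∈ U → t ≤ B := by
  obtain ⟨i, hi⟩ := hB.exists_neg hv
  refine ⟨(ℓ i x + c i) / (- ℓ i v), fun t ht => ?_⟩
  have := (hB.1 _).1 ht i
  rw [map_add, map_smul, smul_eq_mul] at this
  rw [le_div_iff₀ (by linarith)]
  linarith

lemma Bary.sSup_le (hB : Bary U ℓ c) {v : Euc d} (hv : v ≠ 0) {x : Euc d} (hx : x ∈ U) :
    ∃ i, 1 / sSup {t : ℝ | 0 < t ∧ x + t • v ∈ U} ≤ - (ℓ i v / (ℓ i x + c i)) := by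
  obtain ⟨k, -, hk⟩ := Finset.exists_max_image Finset.univ (fun i => - (ℓ i v / (ℓ i x + c i)))
    ⟨0, Finset.mem_univ _⟩
  refine ⟨k, ?_⟩
  have hx' := (hB.1 x).1 hx
  obtain ⟨i, hi⟩ := hB.exists_neg hv
  have hm : 0 < - (ℓ k v / (ℓ k x + c k)) := by
    refine lt_of_lt_of_le ?_ (hk i (Finset.mem_univ i))
    rw [← neg_div]
    exact div_pos (by linarith) (hx' i)
  set m := - (ℓ k v / (ℓ k x + c k)) with hmdef
  obtain ⟨B, hBd⟩ := hB.bdd hv x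
  have hle : 1 / m ≤ sSup {t : ℝ | 0 < t ∧ x + t • v ∈ U} := by
    apply le_of_forall_lt
    intro s hs
    obtain ⟨t, ht, ht'⟩ := exists_between (max_lt hs (show (0 : ℝ) < 1 / m by positivity))
    have ht0 : 0 < t := (le_max_right _ _).trans_lt ht
    refine ((le_max_left _ _).trans_lt ht).trans_le (le_csSup ⟨B, fun t ht => hBd t ht.2⟩ ⟨ht0, ?_⟩)
    rw [hB.1]
    intro j
    rw [map_add, map_smul, smul_eq_mul]
    have h1 : t * m < 1 := by rwa [lt_div_iff₀ hm] at ht'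
    have h2 : - (ℓ j v / (ℓ j x + c j)) ≤ m := hk j (Finset.mem_univ j)
    have h3 : t * - (ℓ j v / (ℓ j x + c j)) < 1 := (mul_le_mul_of_nonneg_left h2 ht0.le).trans_lt h1
    have h4 := mul_lt_mul_of_pos_right h3 (hx' j)
    have h5 : t * - (ℓ j v / (ℓ j x + c j)) * (ℓ j x + c j) = - (t * ℓ j v) := by
      have := (hx' j).ne'
      field_simp
    linarith
  rw [div_le_iff₀ (lt_of_lt_of_le (by positivity) hle)]
  rw [div_le_iff₀ hm] at hle
  linarith

lemma Bary.finsler_lt (hB : Bary U ℓ c) {v : Euc d} {x : Euc d} (hx : x ∈ U)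
    (h : ∀ i j, ℓ i v / (ℓ i x + c i) - ℓ j v / (ℓ j x + c j) < 2) : finslerNorm U x v < 1 := by
  unfold finslerNorm
  by_cases hv : v = 0
  · rw [if_pos hv]; exact one_pos
  rw [if_neg hv]
  obtain ⟨i, hi⟩ := hB.sSup_le hv hx
  obtain ⟨j, hj⟩ := hB.sSup_le (neg_ne_zero.2 hv) hx
  simp only [smul_neg, ← sub_eq_add_neg, map_neg, neg_div, neg_neg] at hj
  have := h j i
  linarith

lemma Bary.dist_ge (hB : Bary U ℓ c) {q x : Euc d} (hq : q ∈ U) (hx : x ∈ U) (hqx : q ≠ x) (i j : Fin (d + 1)) :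
    Real.log ((ℓ i x + c i) / (ℓ i q + c i)) - Real.log ((ℓ j x + c j) / (ℓ j q + c j)) ≤
      2 * hilbertDist U q x := by
  unfold hilbertDist
  rw [if_neg hqx]
  have hv : x - q ≠ 0 := sub_ne_zero.2 (Ne.symm hqx)
  obtain ⟨B, hBd⟩ := hB.bdd hv q
  obtain ⟨B', hBd'⟩ := hB.bdd (neg_ne_zero.2 hv) q
  set S := {t : ℝ | q + t • (x - q) ∈ U} with hS
  have hba : BddAbove S := ⟨B, fun t ht => hBd t ht⟩
  have hbb : BddBelow S := ⟨-B', fun t ht => by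
    have := hBd' (-t) (by rw [smul_neg, neg_smul, neg_neg]; exact ht)
    linarith⟩
  have hUo : IsOpen U := by
    have : U = ⋂ i, {x | 0 < ℓ i x + c i} := by
      ext x; rw [hB.1]; simp
    rw [this]
    refine isOpen_iInter_of_finite fun i => isOpen_lt continuous_const ?_
    exact (LinearMap.continuous_of_finiteDimensional (ℓ i)).add continuous_const
  have hSo : IsOpen S := hUo.preimage (by fun_prop)
  have h0S : (0 : ℝ) ∈ S := by simpa [hS] using hq
  have h1S : (1 : ℝ) ∈ S := by simpa [hS] using hx
  have hs1 : 1 < sSup S := by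
    obtain ⟨ε, hε, hb⟩ := Metric.isOpen_iff.1 hSo 1 h1S
    have : 1 + ε / 2 ∈ S := hb (by
      rw [mem_ball, Real.dist_eq, add_sub_cancel_left, abs_of_pos (by positivity)]; linarith)
    linarith [le_csSup hba this]
  have ha0 : sInf S < 0 := by
    obtain ⟨ε, hε, hb⟩ := Metric.isOpen_iff.1 hSo 0 h0S
    have : - (ε / 2) ∈ S := hb (by
      rw [mem_ball, Real.dist_eq, sub_zero, abs_neg, abs_of_pos (by positivity)]; linarith)
    linarith [csInf_le hbb this]
  have hx' := (hB.1 x).1 hx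
  have hq' := (hB.1 q).1 hq
  set r : Fin (d + 1) → ℝ := fun i => (ℓ i x + c i) / (ℓ i q + c i) with hr
  have hrp : ∀ i, 0 < r i := fun i => div_pos (hx' i) (hq' i)
  have hS2 : ∀ t ∈ S, ∀ i, 0 ≤ 1 - t * (1 - r i) := by
    intro t ht i
    have h1 := (hB.1 _).1 ht i
    rw [map_add, map_smul, smul_eq_mul, map_sub] at h1
    have h2 : 1 - t * (1 - r i) = (ℓ i q + t * (ℓ i x - ℓ i q) + c i) / (ℓ i q + c i) := by
      have := (hq' i).ne'
      rw [hr]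
      field_simp
      ring
    rw [h2]
    exact (div_pos h1 (hq' i)).le
  have hclos : ∀ t ∈ closure S, ∀ i, 0 ≤ 1 - t * (1 - r i) := by
    intro t ht i
    have : closure S ⊆ {t | 0 ≤ 1 - t * (1 - r i)} :=
      closure_minimal (fun t ht => hS2 t ht i) (isClosed_le continuous_const (by fun_prop))
    exact this ht
  have hs := hclos _ (csSup_mem_closure ⟨0, h0S⟩ hba)
  have ha := hclos _ (csInf_mem_closure ⟨0, h0S⟩ hbb)
  set s := sSup S
  set a := sInf S
  have h1 : (r j)⁻¹ ≤ s / (s - 1) := by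
    have := hs j
    rw [le_div_iff₀ (by linarith), ← div_eq_inv_mul, div_le_iff₀ (hrp j)]
    linarith
  have h2 : r i ≤ (1 - a) / (-a) := by
    have := ha i
    rw [le_div_iff₀ (by linarith)]
    linarith
  have h3 : Real.log (r i) + Real.log ((r j)⁻¹) ≤
      Real.log ((1 - a) / (-a) * (s / (s - 1))) := by
    rw [← Real.log_mul (hrp i).ne' (inv_pos.2 (hrp j)).ne']
    apply Real.log_le_log (mul_pos (hrp i) (inv_pos.2 (hrp j)))
    exact mul_le_mul h2 h1 (inv_pos.2 (hrp j)).le ((hrp i).le.trans h2)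
  rw [Real.log_inv] at h3
  linarith

/-- the logarithmic chart. -/
def chart (ℓ : Fin (d + 1) → (Euc d →ₗ[ℝ] ℝ)) (c : Fin (d + 1) → ℝ) (x : Euc d) : Euc d :=
  (cE d).symm fun i => Real.log (ℓ i.succ x + c i.succ) - Real.log (ℓ 0 x + c 0)

/-- its derivative. -/
def dchart (ℓ : Fin (d + 1) → (Euc d →ₗ[ℝ] ℝ)) (c : Fin (d + 1) → ℝ) (x : Euc d) :
    Euc d →L[ℝ] Euc d :=
  ((cE d).symm : (Fin d → ℝ) →L[ℝ] Euc d).comp (ContinuousLinearMap.pi fun i =>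
    (ℓ i.succ x + c i.succ)⁻¹ • LinearMap.toContinuousLinearMap (ℓ i.succ) -
    (ℓ 0 x + c 0)⁻¹ • LinearMap.toContinuousLinearMap (ℓ 0))

lemma dchart_apply (x v : Euc d) (i : Fin d) : cE d (dchart ℓ c x v) i =
    ℓ i.succ v / (ℓ i.succ x + c i.succ) - ℓ 0 v / (ℓ 0 x + c 0) := by
  simp [dchart, div_eq_inv_mul]

lemma chart_apply (x : Euc d) (i : Fin d) : cE d (chart ℓ c x) i =
    Real.log (ℓ i.succ x + c i.succ) - Real.log (ℓ 0 x + c 0) := by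
  simp [chart]

lemma Bary.hasFDerivAt (hB : Bary U ℓ c) {x : Euc d} (hx : x ∈ U) :
    HasFDerivAt (chart ℓ c) (dchart ℓ c x) x := by
  have hx' := (hB.1 x).1 hx
  have h1 : ∀ i, HasFDerivAt (fun x => Real.log (ℓ i x + c i))
      ((ℓ i x + c i)⁻¹ • LinearMap.toContinuousLinearMap (ℓ i)) x := fun i =>
    ((LinearMap.toContinuousLinearMap (ℓ i)).hasFDerivAt.add_const (c i)).log (hx' i).ne'
  have h2 : HasFDerivAt (fun x => fun i : Fin d =>
      Real.log (ℓ i.succ x + c i.succ) - Real.log (ℓ 0 x + c 0)) (ContinuousLinearMap.pi fun i =>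
    (ℓ i.succ x + c i.succ)⁻¹ • LinearMap.toContinuousLinearMap (ℓ i.succ) -
    (ℓ 0 x + c 0)⁻¹ • LinearMap.toContinuousLinearMap (ℓ 0)) x :=
    hasFDerivAt_pi.2 fun i => (h1 i.succ).sub (h1 0)
  exact ((cE d).symm : (Fin d → ℝ) →L[ℝ] Euc d).hasFDerivAt.comp x h2

lemma Bary.dchart_det (hB : Bary U ℓ c) {x : Euc d} (hx : x ∈ U) :
    (dchart ℓ c x).det ≠ 0 := by
  have hx' := (hB.1 x).1 hx
  have hker : LinearMap.ker (dchart ℓ c x : Euc d →ₗ[ℝ] Euc d) = ⊥ := by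
    rw [LinearMap.ker_eq_bot']
    intro v hv
    have hv' : dchart ℓ c x v = 0 := hv
    have h1 : ∀ i : Fin (d + 1), ℓ i v / (ℓ i x + c i) = ℓ 0 v / (ℓ 0 x + c 0) := by
      intro i
      refine Fin.cases rfl (fun i => ?_) i
      have := dchart_apply (ℓ := ℓ) (c := c) x v i
      rw [hv'] at this
      simp at this
      linarith
    have h2 : ∀ i, ℓ i v = ℓ 0 v / (ℓ 0 x + c 0) * (ℓ i x + c i) := fun i => by
      rw [← h1 i, div_mul_cancel₀ _ (hx' i).ne']
    have h3 := hB.2.2.1 v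
    rw [Finset.sum_congr rfl fun i _ => h2 i, ← Finset.mul_sum, hB.2.1, mul_one] at h3
    apply hB.2.2.2
    intro i
    rw [h2, h3, zero_mul]
  intro h0
  have : LinearMap.det (dchart ℓ c x : Euc d →ₗ[ℝ] Euc d) = 0 := h0
  have h4 := LinearMap.bot_lt_ker_of_det_eq_zero this
  rw [hker] at h4
  exact lt_irrefl _ h4

lemma Bary.injOn (hB : Bary U ℓ c) : InjOn (chart ℓ c) U := by
  intro x hx y hy hxy
  have hx' := (hB.1 x).1 hx
  have hy' := (hB.1 y).1 hy
  have h1 : ∀ i : Fin (d + 1), Real.log (ℓ i x + c i) - Real.log (ℓ 0 x + c 0) =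
      Real.log (ℓ i y + c i) - Real.log (ℓ 0 y + c 0) := by
    intro i
    refine Fin.cases (by simp) (fun i => ?_) i
    rw [← chart_apply, ← chart_apply, hxy]
  have h2 : ∀ i : Fin (d + 1), ℓ i x + c i = (ℓ 0 x + c 0) / (ℓ 0 y + c 0) * (ℓ i y + c i) := by
    intro i
    have h3 : Real.log (ℓ i x + c i) = Real.log ((ℓ 0 x + c 0) / (ℓ 0 y + c 0) * (ℓ i y + c i)) := by
      rw [Real.log_mul (div_pos (hx' 0) (hy' 0)).ne' (hy' i).ne',
        Real.log_div (hx' 0).ne' (hy' 0).ne']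
      linarith [h1 i]
    exact Real.log_injOn_pos (hx' i) (mul_pos (div_pos (hx' 0) (hy' 0)) (hy' i)) h3
  have h3 := hB.2.1 x
  rw [Finset.sum_congr rfl fun i _ => h2 i, ← Finset.mul_sum, hB.2.1, mul_one] at h3
  rw [← sub_eq_zero]
  apply hB.2.2.2
  intro i
  have := h2 i
  rw [h3, one_mul] at this
  rw [map_sub]; linarith

lemma Bary.dens_ub (hB : Bary U ℓ c) {x : Euc d} (hx : x ∈ U) :
    volume (ball (0 : Euc d) 1) / volume (finslerUnitBall U x) ≤
    volume (ball (0 : Euc d) 1) / volume (Hset d) * ENNReal.ofReal |(dchart ℓ c x).det| := by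
  have hdet := hB.dchart_det hx
  have hsub : (dchart ℓ c x : Euc d →ₗ[ℝ] Euc d) ⁻¹' (cE d ⁻¹' Hset d) ⊆ finslerUnitBall U x := by
    intro v hv
    obtain ⟨h1, h2⟩ : (∀ i, |cE d (dchart ℓ c x v) i| < 2) ∧
      ∀ i j, cE d (dchart ℓ c x v) i - cE d (dchart ℓ c x v) j < 2 := hv
    simp only [dchart_apply] at h1 h2
    apply hB.finsler_lt hx
    intro i j
    rcases Fin.eq_zero_or_eq_succ i with rfl | ⟨i, rfl⟩ <;>
    rcases Fin.eq_zero_or_eq_succ j with rfl | ⟨j, rfl⟩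
    · simp
    · linarith [(abs_lt.1 (h1 j)).1]
    · linarith [(abs_lt.1 (h1 i)).2]
    · linarith [h2 i j]
  have hv := measure_mono (μ := volume) hsub
  rw [Measure.addHaar_preimage_linearMap volume hdet, (cE_mp d).measure_preimage_emb (cE_emb d)] at hv
  have hpos : 0 < |(dchart ℓ c x).det| := abs_pos.2 hdet
  calc _ ≤ volume (ball (0 : Euc d) 1) /
        (ENNReal.ofReal |(dchart ℓ c x).det⁻¹| * volume (Hset d)) := by
          gcongr
    _ = _ := by
        rw [abs_inv, ENNReal.ofReal_inv_of_pos hpos, div_eq_mul_inv, div_eq_mul_inv,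
          ENNReal.mul_inv (Or.inr (volume_Hset_ne_top d)) (Or.inr (volume_Hset_ne_zero d)), inv_inv]
        ring

lemma volume_closedH_le (d : ℕ) {R : ℝ} (hR : 0 < R) :
    volume {w : Fin d → ℝ | (∀ i, |w i| ≤ 2 * R) ∧ ∀ i j, w i - w j ≤ 2 * R} ≤
      ENNReal.ofReal (R ^ d) * volume (Hset d) := by
  have h1 : ∀ R', R < R' → volume {w : Fin d → ℝ | (∀ i, |w i| ≤ 2 * R) ∧ ∀ i j, w i - w j ≤ 2 * R} ≤
      ENNReal.ofReal (R' ^ d) * volume (Hset d) := by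
    intro R' hR'
    have hR0 : 0 < R' := hR.trans hR'
    have h2 : volume (R' • Hset d) = ENNReal.ofReal (R' ^ d) * volume (Hset d) := by
      rw [Measure.addHaar_smul]
      simp [abs_of_pos hR0]
    rw [← h2]
    apply measure_mono
    rintro w ⟨hw1, hw2⟩
    rw [mem_smul_set_iff_inv_smul_mem₀ hR0.ne']
    refine ⟨fun i => ?_, fun i j => ?_⟩
    · rw [Pi.smul_apply, smul_eq_mul, abs_mul, abs_of_pos (inv_pos.2 hR0), ← div_eq_inv_mul,
        div_lt_iff₀ hR0]
      linarith [hw1 i]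
    · rw [Pi.smul_apply, Pi.smul_apply, smul_eq_mul, smul_eq_mul, ← mul_sub, ← div_eq_inv_mul,
        div_lt_iff₀ hR0]
      linarith [hw2 i j]
  have hlim : Tendsto (fun R' : ℝ => ENNReal.ofReal (R' ^ d) * volume (Hset d)) (𝓝[>] R)
      (𝓝 (ENNReal.ofReal (R ^ d) * volume (Hset d))) := by
    apply ENNReal.Tendsto.mul_const _ (Or.inr (volume_Hset_ne_top d))
    apply ENNReal.tendsto_ofReal
    exact (tendsto_id.mono_right nhdsWithin_le_nhds).pow d
  refine ge_of_tendsto hlim ?_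
  filter_upwards [self_mem_nhdsWithin] with R' hR'
  exact h1 R' hR'

lemma Bary.vol_ball_le (hB : Bary U ℓ c) {q : Euc d} (hq : q ∈ U) {R : ℝ} (hR : 0 < R) :
    busemannVol U (hilbertBall U q R) ≤ volume (ball (0 : Euc d) 1) * ENNReal.ofReal (R ^ d) := by
  set H := {w : Fin d → ℝ | (∀ i, |w i| ≤ 2 * R) ∧ ∀ i j, w i - w j ≤ 2 * R} with hH
  have hHm : MeasurableSet H := by
    apply IsClosed.measurableSet
    have : H = (⋂ i, {w : Fin d → ℝ | |w i| ≤ 2 * R}) ∩ ⋂ i, ⋂ j, {w : Fin d → ℝ | w i - w j ≤ 2 * R} := by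
      ext w; simp [hH]
    rw [this]
    refine (isClosed_iInter fun i => isClosed_le (by fun_prop) continuous_const).inter
      (isClosed_iInter fun i => isClosed_iInter fun j => isClosed_le (by fun_prop) continuous_const)
  have hℓm : ∀ i, Measurable (ℓ i) := fun i =>
    (LinearMap.continuous_of_finiteDimensional (ℓ i)).measurable
  have hUm : MeasurableSet U := by
    have : U = ⋂ i, {x | 0 < ℓ i x + c i} := by
      ext x; rw [hB.1]; simp
    rw [this]
    exact MeasurableSet.iInter fun i => measurableSet_lt measurable_const ((hℓm i).add_const _)
  set G := U ∩ {x | cE d (chart ℓ c x) - cE d (chart ℓ c q) ∈ H} with hG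
  have hGm : MeasurableSet G := by
    refine hUm.inter (measurableSet_preimage (f := fun x => cE d (chart ℓ c x) - cE d (chart ℓ c q)) ?_ hHm)
    apply Measurable.sub_const
    rw [measurable_pi_iff]
    intro i
    simp only [chart_apply]
    exact (Real.measurable_log.comp ((hℓm _).add_const _)).sub
      (Real.measurable_log.comp ((hℓm _).add_const _))
  have hsub : hilbertBall U q R ⊆ G := by
    rintro x ⟨hx, hxR⟩
    refine ⟨hx, ?_⟩
    have hx' := (hB.1 x).1 hx
    have hq' := (hB.1 q).1 hq
    by_cases hqx : q = x
    · subst hqx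
      simp only [mem_ofPred_eq, sub_self, hH, Pi.zero_apply, abs_zero]
      exact ⟨fun _ => by linarith, fun _ _ => by linarith⟩
    have key : ∀ i j : Fin (d + 1), (Real.log (ℓ i x + c i) - Real.log (ℓ i q + c i)) -
        (Real.log (ℓ j x + c j) - Real.log (ℓ j q + c j)) ≤ 2 * R := by
      intro i j
      have := hB.dist_ge hq hx hqx i j
      rw [Real.log_div (hx' i).ne' (hq' i).ne', Real.log_div (hx' j).ne' (hq' j).ne'] at this
      linarith
    refine ⟨fun i => ?_, fun i j => ?_⟩
    · simp only [Pi.sub_apply, chart_apply]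
      rw [abs_le]
      constructor
      · linarith [key 0 i.succ]
      · linarith [key i.succ 0]
    · simp only [Pi.sub_apply, chart_apply]
      linarith [key i.succ j.succ]
  set k := volume (ball (0 : Euc d) 1) / volume (Hset d) with hk
  have hktop : k ≠ ⊤ := ENNReal.div_ne_top measure_ball_lt_top.ne (volume_Hset_ne_zero d)
  have himg : volume (chart ℓ c '' G) ≤ volume H := by
    rw [← (cE_mp d).measure_preimage_emb (cE_emb d) H, ← measure_preimage_add_right volume (-chart ℓ c q) (cE d ⁻¹' H)]
    apply measure_mono
    rintro _ ⟨x, hx, rfl⟩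
    have := hx.2
    simpa [← sub_eq_add_neg] using this
  calc busemannVol U (hilbertBall U q R)
      ≤ ∫⁻ x in G, volume (ball (0 : Euc d) 1) / volume (finslerUnitBall U x) :=
        lintegral_mono_set hsub
    _ ≤ ∫⁻ x in G, k * ENNReal.ofReal |(dchart ℓ c x).det| :=
        setLIntegral_mono' hGm fun x hx => hB.dens_ub hx.1
    _ = k * volume (chart ℓ c '' G) := by
        rw [lintegral_const_mul' _ _ hktop, lintegral_abs_det_fderiv_eq_addHaar_image volume hGm
          (fun x hx => (hB.hasFDerivAt hx.1).hasFDerivWithinAt) (hB.injOn.mono inter_subset_left)]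
    _ ≤ k * (ENNReal.ofReal (R ^ d) * volume (Hset d)) := by
        gcongr
        exact himg.trans (volume_closedH_le d hR)
    _ = _ := by
        rw [hk, mul_comm (ENNReal.ofReal (R ^ d)), ← mul_assoc,
          ENNReal.div_mul_cancel (volume_Hset_ne_zero d) (volume_Hset_ne_top d)]

lemma Bary.liminf_le (hB : Bary U ℓ c) {q : Euc d} (hq : q ∈ U) :
    liminf (fun R : ℝ => busemannVol U (hilbertBall U q R) / ENNReal.ofReal (R ^ d)) atTop ≤
      volume (ball (0 : Euc d) 1) := by
  calc _ ≤ liminf (fun _ : ℝ => volume (ball (0 : Euc d) 1)) atTop := by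
        refine liminf_le_liminf ?_
        filter_upwards [eventually_gt_atTop 0] with R hR
        exact ENNReal.div_le_of_le_mul (hB.vol_ball_le hq hR)
    _ = _ := by simp

end bary

lemma simplex_bary {d : ℕ} {Sig : Set (Euc d)} (h : IsSimplexSet d Sig) :
    ∃ ℓ c, Bary (interior Sig) ℓ c := by
  obtain ⟨v, hv, rfl⟩ := h
  have htop : affineSpan ℝ (range v) = ⊤ := by
    rw [hv.affineSpan_eq_top_iff_card_eq_finrank_add_one]
    simp
  let b : AffineBasis (Fin (d + 1)) ℝ (Euc d) := ⟨v, hv, htop⟩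
  have hdec : ∀ i x, (b.coord i).linear x + b.coord i 0 = b.coord i x := by
    intro i x
    have := congrFun (AffineMap.decomp (b.coord i)) x
    simpa using this.symm
  refine ⟨fun i => (b.coord i).linear, fun i => b.coord i 0, ?_, ?_, ?_, ?_⟩
  · intro x
    have : interior (convexHull ℝ (range v)) = {x | ∀ i, 0 < b.coord i x} := b.interior_convexHull
    rw [this]
    simp only [hdec, mem_ofPred_eq]
  · intro x
    simp only [hdec]
    exact b.sum_coord_apply_eq_one x
  · intro x
    have h1 := b.sum_coord_apply_eq_one x
    have h0 := b.sum_coord_apply_eq_one 0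
    rw [← Finset.sum_congr rfl fun i _ => hdec i x, Finset.sum_add_distrib, h0] at h1
    linarith
  · intro x hx
    apply b.ext_elem
    intro i
    rw [← hdec, hx, zero_add]

lemma body_image {d : ℕ} {Ω : Set (Euc d)} (hΩ : Convex ℝ Ω) (hc : IsCompact Ω) :
    Convex ℝ (cE d '' Ω) ∧ IsCompact (cE d '' Ω) ∧
      ∀ p ∈ interior Ω, cE d p ∈ interior (cE d '' Ω) := by
  refine ⟨hΩ.linear_image (cE d).toLinearMap, hc.image (cE d).continuous, fun p hp => ?_⟩
  have : cE d '' interior Ω = interior (cE d '' Ω) := (cE d).toHomeomorph.image_interior Ω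
  rw [← this]; exact mem_image_of_mem _ hp

lemma general_ge {d : ℕ} {Ω : Set (Euc d)} (hΩ : Convex ℝ Ω) (hc : IsCompact Ω) {p : Euc d}
    (hp : p ∈ interior Ω) : volume (ball (0 : Euc d) 1) ≤
    liminf (fun R : ℝ =>
        busemannVol (interior Ω) (hilbertBall (interior Ω) p R) / ENNReal.ofReal (R ^ d)) atTop := by
  obtain ⟨h1, h2, h3⟩ := body_image hΩ hc
  have := asymp_lb' hΩ hc hp (a := (d : ℝ) + 1) (by positivity)
    ((main_induction d).2 _ _ h1 h2 (h3 p hp))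
  rwa [div_self (by positivity), ENNReal.ofReal_one, mul_one] at this

lemma simplex_or_many {d : ℕ} {Ω : Set (Euc d)} (hΩ : Convex ℝ Ω) (hc : IsCompact Ω)
    (hi : (interior Ω).Nonempty) : IsSimplexSet d Ω ∨
    ∃ E : Finset (Fin d → ℝ), E.card = d + 2 ∧ ∀ x ∈ E, x ∈ (cE d '' Ω).extremePoints ℝ := by
  obtain ⟨h1, h2, h3⟩ := body_image hΩ hc
  obtain ⟨p, hp⟩ := hi
  by_cases hfin : ((cE d '' Ω).extremePoints ℝ).Finite
  · obtain ⟨h4, h5⟩ := ext_card h1 h2 ⟨_, h3 p hp⟩ hfin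
    by_cases hcard : hfin.toFinset.card = d + 1
    · left
      have hai := h5 hcard
      let e := hfin.toFinset.equivFinOfCardEq hcard
      have hai2 : AffineIndependent ℝ (fun i : Fin (d + 1) => ((e.symm i : hfin.toFinset) : Fin d → ℝ)) :=
        hai.comp_embedding e.symm.toEmbedding
      refine ⟨fun i => (cE d).symm ((e.symm i : hfin.toFinset) : Fin d → ℝ), ?_, ?_⟩
      · exact hai2.map' ((cE d).symm.toLinearMap.toAffineMap) (cE d).symm.injective
      · have hr : range (fun i : Fin (d + 1) => (cE d).symm ((e.symm i : hfin.toFinset) : Fin d → ℝ)) =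
            (cE d).symm.toLinearMap '' ((cE d '' Ω).extremePoints ℝ) := by
          ext x
          constructor
          · rintro ⟨i, rfl⟩
            exact ⟨_, hfin.mem_toFinset.1 (e.symm i).2, rfl⟩
          · rintro ⟨y, hy, rfl⟩
            exact ⟨e ⟨y, by simpa using hy⟩, by simp⟩
        rw [hr, ← LinearMap.image_convexHull, convexHull_ext h1 h2 hfin, image_image]
        simp
    · right
      obtain ⟨E, hE, hEc⟩ := Finset.exists_subset_card_eq (show d + 2 ≤ hfin.toFinset.card by omega)
      exact ⟨E, hEc, fun x hx => by simpa using hE hx⟩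
  · right
    obtain ⟨F, hF, hFc⟩ := Set.Infinite.exists_subset_card_eq hfin (d + 2)
    exact ⟨F, hFc, fun x hx => hF hx⟩

lemma many_gt {n : ℕ} {Ω : Set (Euc (n + 1))} (hΩ : Convex ℝ Ω) (hc : IsCompact Ω) {p : Euc (n + 1)}
    (hp : p ∈ interior Ω) (E : Finset (Fin (n + 1) → ℝ)) (hEc : E.card = n + 1 + 2)
    (hE : ∀ x ∈ E, x ∈ (cE (n + 1) '' Ω).extremePoints ℝ) :
    volume (ball (0 : Euc (n + 1)) 1) <
    liminf (fun R : ℝ => busemannVol (interior Ω) (hilbertBall (interior Ω) p R) /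
      ENNReal.ofReal (R ^ (n + 1))) atTop := by
  obtain ⟨h1, h2, h3⟩ := body_image hΩ hc
  obtain ⟨hU, hA⟩ := main_induction n
  have hasy := asy_of_ext hU hA h1 h2 (h3 p hp) E hE
  refine lt_of_lt_of_le ?_ (asymp_lb' hΩ hc hp (by rw [hEc]; positivity) hasy)
  have hω0 : volume (ball (0 : Euc (n + 1)) 1) ≠ 0 := (measure_ball_pos volume _ one_pos).ne'
  have hω1 : volume (ball (0 : Euc (n + 1)) 1) ≠ ⊤ := measure_ball_lt_top.ne
  conv_lhs => rw [← mul_one (volume (ball (0 : Euc (n + 1)) 1))]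
  apply ENNReal.mul_lt_mul_right hω0 hω1
  rw [← ENNReal.ofReal_one, ENNReal.ofReal_lt_ofReal_iff_of_nonneg zero_le_one, hEc,
    lt_div_iff₀ (by positivity)]
  push_cast
  linarith


/-- Among convex bodies in `ℝ^d`, the asymptotic volume (in `[0,∞]`) is at least
that of a `d`-simplex, with equality if and only if the body is a `d`-simplex. -/
theorem asympVol_ge_simplex (d : ℕ) (Ω : Set (Euc d))
    (hcomp : IsCompact Ω) (hconv : Convex ℝ Ω) (hint : (interior Ω).Nonempty)
    (Sig : Set (Euc d)) (hSig : IsSimplexSet d Sig)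
    (p : Euc d) (hp : p ∈ interior Ω) (q : Euc d) (hq : q ∈ interior Sig) :
    liminf (fun R : ℝ =>
        busemannVol (interior Sig) (hilbertBall (interior Sig) q R) / ENNReal.ofReal (R ^ d))
      atTop
    ≤ liminf (fun R : ℝ =>
        busemannVol (interior Ω) (hilbertBall (interior Ω) p R) / ENNReal.ofReal (R ^ d))
      atTop
    ∧ (liminf (fun R : ℝ =>
          busemannVol (interior Ω) (hilbertBall (interior Ω) p R) / ENNReal.ofReal (R ^ d))
        atTop
      = liminf (fun R : ℝ =>
          busemannVol (interior Sig) (hilbertBall (interior Sig) q R) / ENNReal.ofReal (R ^ d))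
        atTop
      ↔ IsSimplexSet d Ω) := by


  obtain _ | n := d
  · have hΩ : Ω = univ := Subsingleton.eq_univ_of_nonempty ⟨p, interior_subset hp⟩
    have hS : Sig = univ := Subsingleton.eq_univ_of_nonempty ⟨q, interior_subset hq⟩
    have hpq : p = q := Subsingleton.elim _ _
    subst hpq
    rw [hS] at hSig ⊢
    rw [hΩ]
    exact ⟨le_rfl, fun _ => hSig, fun _ => rfl⟩
  · have hub : ∀ (S : Set (Euc (n + 1))), IsSimplexSet (n + 1) S → ∀ y ∈ interior S,
        liminf (fun R : ℝ => busemannVol (interior S) (hilbertBall (interior S) y R) /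
          ENNReal.ofReal (R ^ (n + 1))) atTop = volume (ball (0 : Euc (n + 1)) 1) := by
      intro S hS y hy
      obtain ⟨ℓ, c, hB⟩ := simplex_bary hS
      refine le_antisymm (hB.liminf_le hy) ?_
      obtain ⟨v, hv, rfl⟩ := hS
      exact general_ge (convex_convexHull ℝ _) ((finite_range v).isCompact_convexHull ℝ) hy
    rw [hub Sig hSig q hq]
    refine ⟨general_ge hconv hcomp hp, fun heq => ?_, fun hs => hub Ω hs p hp⟩
    rcases simplex_or_many hconv hcomp hint with h | ⟨E, hEc, hE⟩
    · exact h
    · exact absurd heq (many_gt hconv hcomp hp E hEc hE).ne'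

end
end

section
/- Let Ω ⊆ ℝ^d be a convex body. If there exist a finite-dimensional real normed vector space E and a bijection f : int Ω → E such that ‖f(p) − f(q)‖ = d_{int Ω}(p,q) for all p, q ∈ int Ω, then Ω is a d-simplex. -/
open Filter Set MeasureTheory Metric
open scoped ENNReal Topology Pointwise RealInnerProductSpace

noncomputable section
open scoped Classical

/-- The affine functional `x ↦ 1 + ⟨a, x - o⟩`. -/
def LL {d : ℕ} (o a x : Euc d) : ℝ := 1 + ⟪a, x - o⟫

/-- Parameters of the normalised functionals which are nonnegative on `Ω`. -/
def GG {d : ℕ} (Ω : Set (Euc d)) (o : Euc d) : Set (Euc d) := {a | ∀ x ∈ Ω, 0 ≤ LL o a x}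

theorem LL_o {d : ℕ} (o a : Euc d) : LL o a o = 1 := by simp [LL]

theorem LL_zero {d : ℕ} (o x : Euc d) : LL o 0 x = 1 := by simp [LL]

theorem LL_comb {d : ℕ} (o a x y : Euc d) (s : ℝ) :
    LL o a ((1 - s) • x + s • y) = (1 - s) * LL o a x + s * LL o a y := by
  have : (1 - s) • x + s • y - o = (1 - s) • (x - o) + s • (y - o) := by module
  simp only [LL, this, inner_add_right, inner_smul_right]
  ring

theorem LL_line {d : ℕ} (o a x y : Euc d) (t : ℝ) :
    LL o a (x + t • (y - x)) = LL o a x + t * (LL o a y - LL o a x) := by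
  have : x + t • (y - x) = (1 - t) • x + t • y := by module
  rw [this, LL_comb]; ring

theorem LL_cont {d : ℕ} (o : Euc d) : Continuous (fun z : Euc d × Euc d => LL o z.1 z.2) := by
  unfold LL; fun_prop

theorem zero_mem_GG {d : ℕ} (Ω : Set (Euc d)) (o : Euc d) : (0 : Euc d) ∈ GG Ω o := by
  intro x _; rw [LL_zero]; norm_num

theorem LL_pos {d : ℕ} {Ω : Set (Euc d)} {o a x : Euc d} (ha : a ∈ GG Ω o)
    (hx : x ∈ interior Ω) : 0 < LL o a x := by
  have hc : ContinuousAt (fun s : ℝ => o + s • (x - o)) 1 := by fun_prop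
  have h1 : (fun s : ℝ => o + s • (x - o)) ⁻¹' interior Ω ∈ 𝓝 (1 : ℝ) := by
    apply hc
    apply isOpen_interior.mem_nhds
    simpa using hx
  obtain ⟨ε, hε, hb⟩ := Metric.mem_nhds_iff.1 h1
  have h2 : (1 + ε / 2) ∈ ball (1 : ℝ) ε := by
    rw [Metric.mem_ball, Real.dist_eq]
    rw [abs_of_pos (by linarith)]; linarith
  have h3 := ha _ (interior_subset (hb h2))
  simp only at h3
  rw [LL_line, LL_o] at h3
  nlinarith

theorem GG_compact {d : ℕ} {Ω : Set (Euc d)} {o : Euc d} (ho : o ∈ interior Ω) :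
    IsCompact (GG Ω o) := by
  apply Metric.isCompact_of_isClosed_isBounded
  · have : GG Ω o = ⋂ x ∈ Ω, {a | 0 ≤ LL o a x} := by ext a; simp [GG]
    rw [this]
    refine isClosed_biInter fun x _ => isClosed_le continuous_const ?_
    unfold LL; fun_prop
  · obtain ⟨r, hr, hb⟩ := Metric.mem_nhds_iff.1 (mem_interior_iff_mem_nhds.1 ho)
    refine (Metric.isBounded_iff_subset_closedBall 0).2 ⟨2 / r, fun a ha => ?_⟩
    rw [mem_closedBall_zero_iff]
    by_cases h0 : a = 0
    · rw [h0, norm_zero]; positivity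
    have hn : 0 < ‖a‖ := norm_pos_iff.2 h0
    have h1 : o - (r / 2 / ‖a‖) • a ∈ Ω := by
      apply hb
      rw [Metric.mem_ball, dist_eq_norm]
      rw [sub_sub_cancel_left, norm_neg, norm_smul, Real.norm_of_nonneg (by positivity)]
      rw [div_mul_cancel₀ _ hn.ne']; linarith
    have h2 := ha _ h1
    rw [LL, sub_sub_cancel_left, inner_neg_right, inner_smul_right,
      real_inner_self_eq_norm_sq] at h2
    have : r / 2 / ‖a‖ * ‖a‖ ^ 2 = r / 2 * ‖a‖ := by field_simp
    rw [this] at h2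
    rw [le_div_iff₀ hr]; linarith

theorem GG_support {d : ℕ} {Ω : Set (Euc d)} {o c : Euc d}
    (hconv : Convex ℝ Ω) (ho : o ∈ interior Ω) (hc : c ∉ interior Ω) :
    ∃ a ∈ GG Ω o, LL o a c ≤ 0 ∧ (c ∈ Ω → LL o a c = 0) := by
  obtain ⟨φ, hφ⟩ := geometric_hahn_banach_open_point hconv.interior isOpen_interior hc
  have h0 : 0 < φ c - φ o := sub_pos.2 (hφ o ho)
  have hcl : ∀ x ∈ Ω, φ x ≤ φ c := by
    intro x hx
    have hx' : x ∈ closure (interior Ω) := by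
      rw [hconv.closure_interior_eq_closure_of_nonempty_interior ⟨o, ho⟩]
      exact subset_closure hx
    have : closure (interior Ω) ⊆ {x | φ x ≤ φ c} :=
      closure_minimal (fun y hy => (hφ y hy).le) (isClosed_le φ.continuous continuous_const)
    exact this hx'
  set a := (-(φ c - φ o)⁻¹) • (InnerProductSpace.toDual ℝ (Euc d)).symm φ with hadef
  have key : ∀ x, LL o a x = (φ c - φ x) / (φ c - φ o) := by
    intro x
    rw [LL, hadef, real_inner_smul_left, InnerProductSpace.toDual_symm_apply, map_sub]
    field_simp; ring
  have hc0 : LL o a c = 0 := by rw [key]; simp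
  refine ⟨a, fun x hx => ?_, hc0.le, fun _ => hc0⟩
  rw [key]
  exact div_nonneg (sub_nonneg.2 (hcl x hx)) h0.le

theorem exit_pt {d : ℕ} {Ω : Set (Euc d)} (hcomp : IsCompact Ω) {p q : Euc d}
    (hq : q ∈ interior Ω) (hpq : p ≠ q) :
    1 < sSup {t : ℝ | p + t • (q - p) ∈ interior Ω} ∧
    p + sSup {t : ℝ | p + t • (q - p) ∈ interior Ω} • (q - p) ∈ Ω ∧
    p + sSup {t : ℝ | p + t • (q - p) ∈ interior Ω} • (q - p) ∉ interior Ω := by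
  set S := {t : ℝ | p + t • (q - p) ∈ interior Ω} with hS
  have hcont : Continuous (fun t : ℝ => p + t • (q - p)) := by fun_prop
  have hopen : IsOpen S := isOpen_interior.preimage hcont
  have h1 : (1 : ℝ) ∈ S := by simp [hS, hq]
  have hn : 0 < ‖q - p‖ := norm_pos_iff.2 (sub_ne_zero.2 hpq.symm)
  have hbdd : BddAbove S := by
    obtain ⟨R, hR⟩ := hcomp.isBounded.subset_closedBall p
    refine ⟨R / ‖q - p‖, fun t ht => ?_⟩
    have := hR (interior_subset ht)
    rw [mem_closedBall, dist_eq_norm, add_sub_cancel_left, norm_smul] at this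
    rw [le_div_iff₀ hn]
    exact le_trans (mul_le_mul_of_nonneg_right (le_abs_self t) hn.le) this
  have hstep : ∀ t ∈ S, t < sSup S := by
    intro t ht
    obtain ⟨ε, hε, hb⟩ := Metric.isOpen_iff.1 hopen t ht
    have : t + ε / 2 ∈ S := by
      apply hb
      rw [Metric.mem_ball, Real.dist_eq, abs_of_pos (by linarith)]; linarith
    have := le_csSup hbdd this
    linarith
  refine ⟨hstep 1 h1, ?_, fun h => lt_irrefl _ (hstep _ h)⟩
  have h2 : sSup S ∈ closure S := csSup_mem_closure ⟨1, h1⟩ hbdd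
  have h3 : closure S ⊆ (fun t : ℝ => p + t • (q - p)) ⁻¹' Ω :=
    closure_minimal (fun t ht => (interior_subset (s := Ω) ht : p + t • (q - p) ∈ Ω))
      (hcomp.isClosed.preimage hcont)
  exact h3 h2

/-- The exit point, with a supporting functional. -/
theorem exit_pt' {d : ℕ} {Ω : Set (Euc d)} {o : Euc d} (hcomp : IsCompact Ω)
    (hconv : Convex ℝ Ω) (ho : o ∈ interior Ω) {p q : Euc d}
    (hq : q ∈ interior Ω) (hpq : p ≠ q) :
    ∃ c ∈ Ω, ∃ s : ℝ, 0 < s ∧ s < 1 ∧ q = (1 - s) • p + s • c ∧ ∃ a ∈ GG Ω o, LL o a c = 0 := by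
  obtain ⟨h1, h2, h3⟩ := exit_pt hcomp hq hpq
  set T := sSup {t : ℝ | p + t • (q - p) ∈ interior Ω}
  obtain ⟨a, ha, -, h4⟩ := GG_support hconv ho h3
  refine ⟨_, h2, T⁻¹, by positivity, inv_lt_one_of_one_lt₀ h1, ?_, a, ha, h4 h2⟩
  have : T ≠ 0 := by positivity
  rw [smul_add, smul_smul, inv_mul_cancel₀ this]
  module

theorem exists_max {d : ℕ} {Ω : Set (Euc d)} {o : Euc d} (ho : o ∈ interior Ω) (p q : Euc d)
    (hq : q ∈ interior Ω) :
    ∃ a ∈ GG Ω o, ∀ z ∈ GG Ω o, LL o z p / LL o z q ≤ LL o a p / LL o a q := by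
  have := (GG_compact ho).exists_isMaxOn ⟨0, zero_mem_GG Ω o⟩
    (f := fun z => LL o z p / LL o z q) (by
      refine ContinuousOn.div ?_ ?_ (fun z hz => (LL_pos hz hq).ne')
      · unfold LL; fun_prop
      · unfold LL; fun_prop)
  obtain ⟨a, ha, hm⟩ := this
  exact ⟨a, ha, fun z hz => hm hz⟩

/-- exponential of the Funk distance. -/
def MM {d : ℕ} (Ω : Set (Euc d)) (o p q : Euc d) : ℝ :=
  sSup ((fun z => LL o z p / LL o z q) '' GG Ω o)

theorem MM_eq {d : ℕ} {Ω : Set (Euc d)} {o p q a : Euc d} (ha : a ∈ GG Ω o)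
    (h : ∀ z ∈ GG Ω o, LL o z p / LL o z q ≤ LL o a p / LL o a q) :
    MM Ω o p q = LL o a p / LL o a q := by
  apply le_antisymm
  · apply csSup_le (Set.Nonempty.image _ ⟨a, ha⟩)
    rintro _ ⟨z, hz, rfl⟩; exact h z hz
  · apply le_csSup
    · refine ⟨LL o a p / LL o a q, ?_⟩
      rintro _ ⟨z, hz, rfl⟩; exact h z hz
    · exact ⟨a, ha, rfl⟩

theorem le_MM {d : ℕ} {Ω : Set (Euc d)} {o p q z : Euc d} (ho : o ∈ interior Ω)
    (hq : q ∈ interior Ω) (hz : z ∈ GG Ω o) : LL o z p / LL o z q ≤ MM Ω o p q := by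
  obtain ⟨a, ha, h⟩ := exists_max ho p q hq
  rw [MM_eq ha h]; exact h z hz

theorem one_le_MM {d : ℕ} {Ω : Set (Euc d)} {o p q : Euc d} (ho : o ∈ interior Ω)
    (hq : q ∈ interior Ω) : 1 ≤ MM Ω o p q := by
  have := le_MM (p := p) ho hq (zero_mem_GG Ω o)
  simpa [LL_zero] using this

theorem MM_exit {d : ℕ} {Ω : Set (Euc d)} {o : Euc d} (hcomp : IsCompact Ω)
    (hconv : Convex ℝ Ω) (ho : o ∈ interior Ω) {p q : Euc d}
    (hq : q ∈ interior Ω) (hpq : p ≠ q) :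
    MM Ω o p q = sSup {t : ℝ | p + t • (q - p) ∈ interior Ω} /
      (sSup {t : ℝ | p + t • (q - p) ∈ interior Ω} - 1) := by
  obtain ⟨h1, h2, h3⟩ := exit_pt hcomp hq hpq
  set T := sSup {t : ℝ | p + t • (q - p) ∈ interior Ω}
  obtain ⟨a, ha, -, h4⟩ := GG_support hconv ho h3
  have h4 := h4 h2
  have hT : 0 < T - 1 := by linarith
  have e : LL o a p / LL o a q = T / (T - 1) := by
    rw [div_eq_div_iff (LL_pos ha hq).ne' hT.ne']
    rw [LL_line] at h4
    linarith
  rw [← e]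
  apply MM_eq ha
  intro z hz
  rw [e, div_le_div_iff₀ (LL_pos hz hq) hT]
  have := hz _ h2
  rw [LL_line] at this
  linarith

theorem hilbert_eq {d : ℕ} {Ω : Set (Euc d)} {o : Euc d} (hcomp : IsCompact Ω)
    (hconv : Convex ℝ Ω) (ho : o ∈ interior Ω) {p q : Euc d} (hp : p ∈ interior Ω)
    (hq : q ∈ interior Ω) :
    Real.exp (2 * hilbertDist (interior Ω) p q) = MM Ω o p q * MM Ω o q p := by
  by_cases hpq : p = q
  · subst hpq
    have : MM Ω o p p = 1 := by
      have := MM_eq (p := p) (q := p) (zero_mem_GG Ω o) (fun z hz => by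
        rw [div_self (LL_pos hz hp).ne', LL_zero]; norm_num)
      rw [this, LL_zero]; norm_num
    simp [hilbertDist, this]
  have e1 := MM_exit hcomp hconv ho hq hpq
  have e2 := MM_exit hcomp hconv ho hp (Ne.symm hpq)
  have hset : {t : ℝ | q + t • (p - q) ∈ interior Ω} =
      (fun t => 1 - t) '' {t : ℝ | p + t • (q - p) ∈ interior Ω} := by
    ext t
    simp only [Set.mem_ofPred_eq, mem_image]
    constructor
    · intro h
      refine ⟨1 - t, ?_, by ring⟩
      convert h using 1; module
    · rintro ⟨u, hu, rfl⟩
      convert hu using 1; module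
  have hsup : sSup {t : ℝ | q + t • (p - q) ∈ interior Ω} =
      1 - sInf {t : ℝ | p + t • (q - p) ∈ interior Ω} := by
    rw [Real.sInf_def, sub_neg_eq_add, hset]
    have : (fun t : ℝ => 1 - t) '' {t : ℝ | p + t • (q - p) ∈ interior Ω} =
       (fun t : ℝ => 1 + t) '' (-{t : ℝ | p + t • (q - p) ∈ interior Ω}) := by
      ext t
      simp only [mem_image, Set.mem_neg]
      constructor
      · rintro ⟨u, hu, rfl⟩; exact ⟨-u, by simpa using hu, by ring⟩
      · rintro ⟨u, hu, rfl⟩; exact ⟨-u, hu, by ring⟩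
    rw [this]
    have hne : (-{t : ℝ | p + t • (q - p) ∈ interior Ω}).Nonempty := ⟨0, by simpa using hp⟩
    have hbd : BddAbove (-{t : ℝ | p + t • (q - p) ∈ interior Ω}) := by
      by_contra hnb
      have hnb' : ¬ BddAbove {t : ℝ | q + t • (p - q) ∈ interior Ω} := by
        rw [hset, this]
        rintro ⟨M, hM⟩
        exact hnb ⟨M - 1, fun t ht => by have := hM ⟨t, ht, rfl⟩; simp only at this; linarith⟩
      have := (exit_pt hcomp hp (Ne.symm hpq)).1
      rw [Real.sSup_of_not_bddAbove hnb'] at this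
      linarith
    have := (OrderIso.addLeft (1 : ℝ)).map_csSup' hne hbd
    simpa using this.symm
  have p1 := (exit_pt hcomp hq hpq).1
  have p2 := (exit_pt hcomp hp (Ne.symm hpq)).1
  rw [hsup] at e2 p2
  have n1 : 0 < MM Ω o p q := lt_of_lt_of_le one_pos (one_le_MM ho hq)
  have n2 : 0 < MM Ω o q p := lt_of_lt_of_le one_pos (one_le_MM ho hp)
  rw [hilbertDist, if_neg hpq]
  rw [← mul_assoc, show (2 : ℝ) * (1 / 2) = 1 by norm_num, one_mul, ← e1]
  have : (1 - sInf {t : ℝ | p + t • (q - p) ∈ interior Ω}) /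
      (- sInf {t : ℝ | p + t • (q - p) ∈ interior Ω}) = MM Ω o q p := by
    rw [e2]; congr 1; ring
  rw [this, Real.exp_log (by positivity), mul_comm]

theorem ultra_lim {X : Type*} [TopologicalSpace X] {K : Set X} (hK : IsCompact K)
    (𝒰 : Ultrafilter ℕ) (u : ℕ → X) (hu : ∀ n, u n ∈ K) :
    ∃ x ∈ K, Tendsto u 𝒰 (𝓝 x) := by
  obtain ⟨x, hx, h⟩ := hK.ultrafilter_le_nhds (𝒰.map u) (by
    rw [le_principal_iff]
    exact Filter.Eventually.of_forall (f := (𝒰 : Filter ℕ)) hu)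
  exact ⟨x, hx, h⟩

theorem tendsto_LL {d : ℕ} {o : Euc d} {l : Filter ℕ} {u v : ℕ → Euc d} {a b : Euc d}
    (hu : Tendsto u l (𝓝 a)) (hv : Tendsto v l (𝓝 b)) :
    Tendsto (fun n => LL o (u n) (v n)) l (𝓝 (LL o a b)) := by
  unfold LL
  exact (hu.inner (hv.sub_const o)).const_add 1

theorem horo {d : ℕ} {Ω : Set (Euc d)} {o : Euc d} (hcomp : IsCompact Ω)
    (hconv : Convex ℝ Ω) (ho : o ∈ interior Ω) (𝒰 : Ultrafilter ℕ) (p : ℕ → Euc d)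
    (hp : ∀ n, p n ∈ interior Ω)
    (hT : Tendsto (fun n => hilbertDist (interior Ω) o (p n)) 𝒰 atTop) (φ : Euc d → ℝ)
    (hφ : ∀ x ∈ interior Ω, Tendsto (fun n => hilbertDist (interior Ω) x (p n)
      - hilbertDist (interior Ω) o (p n)) 𝒰 (𝓝 (φ x))) :
    ∃ b ∈ Ω, ∃ (w : Euc d → ℝ) (ξ : Euc d → Euc d),
      (∀ x ∈ interior Ω, ξ x ∈ GG Ω o ∧ LL o (ξ x) b = 0 ∧ 0 < w x ∧
        (∀ y ∈ interior Ω, w x * LL o (ξ x) y ≤ w y * LL o (ξ y) y) ∧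
        w x * LL o (ξ x) x * (MM Ω o b x / MM Ω o b o) = Real.exp (2 * φ x)) := by
  obtain ⟨b, hb, hpb⟩ := ultra_lim hcomp 𝒰 p (fun n => interior_subset (hp n))
  have hcG := GG_compact ho
  -- the reverse Funk part
  have hrev : ∀ x ∈ interior Ω, Tendsto (fun n => MM Ω o (p n) x) 𝒰 (𝓝 (MM Ω o b x)) := by
    intro x hx
    choose a ha hm using fun n => exists_max ho (p n) x hx
    obtain ⟨a', ha', hlim⟩ := ultra_lim hcG 𝒰 a ha
    have h1 : Tendsto (fun n => LL o (a n) (p n) / LL o (a n) x) 𝒰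
        (𝓝 (LL o a' b / LL o a' x)) :=
      (tendsto_LL hlim hpb).div (tendsto_LL hlim tendsto_const_nhds) (LL_pos ha' hx).ne'
    have h2 : MM Ω o b x = LL o a' b / LL o a' x := by
      apply MM_eq ha'
      intro z hz
      have h3 : Tendsto (fun n => LL o z (p n) / LL o z x) 𝒰 (𝓝 (LL o z b / LL o z x)) :=
        (tendsto_LL tendsto_const_nhds hpb).div_const _
      exact le_of_tendsto_of_tendsto' h3 h1 (fun n => hm n z hz)
    rw [h2]
    refine h1.congr fun n => ?_
    rw [MM_eq (ha n) (hm n)]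
  have Mpos : ∀ x, ∀ y ∈ interior Ω, 0 < MM Ω o x y := fun x y hy =>
    lt_of_lt_of_le one_pos (one_le_MM ho hy)
  -- forward Funk distance tends to infinity
  have hinv : Tendsto (fun n => (MM Ω o o (p n))⁻¹) 𝒰 (𝓝 0) := by
    have h1 : Tendsto (fun n => MM Ω o (p n) o * Real.exp (-(2 * hilbertDist (interior Ω) o (p n))))
        𝒰 (𝓝 (MM Ω o b o * 0)) := by
      refine (hrev o ho).mul ?_
      apply Real.tendsto_exp_neg_atTop_nhds_zero.comp
      exact hT.const_mul_atTop (by norm_num)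
    rw [mul_zero] at h1
    refine h1.congr fun n => ?_
    rw [Real.exp_neg, hilbert_eq hcomp hconv ho ho (hp n), mul_inv]
    have := (Mpos (p n) o ho).ne'
    field_simp
  have hmain : ∀ x ∈ interior Ω, ∃ (w : ℝ) (ξ : Euc d), ξ ∈ GG Ω o ∧ 0 ≤ w ∧ 
      w * LL o ξ b = 0 ∧
      Tendsto (fun n => MM Ω o x (p n) / MM Ω o o (p n)) 𝒰 (𝓝 (w * LL o ξ x)) ∧
      (∀ y ∈ interior Ω, ∀ g, Tendsto (fun n => MM Ω o y (p n) / MM Ω o o (p n)) 𝒰 (𝓝 g) →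
        w * LL o ξ y ≤ g) := by
    intro x hx
    choose a ha hm using fun n => exists_max ho x (p n) (hp n)
    obtain ⟨a', ha', hlim⟩ := ultra_lim hcG 𝒰 a ha
    have hw : ∀ n, (LL o (a n) (p n))⁻¹ * (MM Ω o o (p n))⁻¹ ∈ Icc (0 : ℝ) 1 := by
      intro n
      have h1 := LL_pos (ha n) (hp n)
      have h2 := Mpos o (p n) (hp n)
      refine ⟨by positivity, ?_⟩
      have := le_MM (p := o) ho (hp n) (ha n)
      rw [LL_o, one_div] at this
      calc _ ≤ MM Ω o o (p n) * (MM Ω o o (p n))⁻¹ := by gcongr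
        _ = 1 := mul_inv_cancel₀ h2.ne'
    obtain ⟨w, hwI, hwlim⟩ := ultra_lim isCompact_Icc 𝒰 _ hw
    refine ⟨w, a', ha', hwI.1, ?_, ?_, ?_⟩
    · have h1 := hwlim.mul (tendsto_LL (o := o) hlim hpb)
      refine tendsto_nhds_unique h1 (hinv.congr fun n => ?_)
      have := (LL_pos (ha n) (hp n)).ne'
      field_simp
    · have h1 := hwlim.mul (tendsto_LL (o := o) hlim (tendsto_const_nhds (x := x)))
      refine h1.congr fun n => ?_
      rw [MM_eq (ha n) (hm n)]
      rw [div_eq_mul_inv, div_eq_mul_inv]; ring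
    · intro y hy g hg
      have h1 := hwlim.mul (tendsto_LL (o := o) hlim (tendsto_const_nhds (x := y)))
      refine le_of_tendsto_of_tendsto' h1 hg fun n => ?_
      have h2 := le_MM (p := y) ho (hp n) (ha n)
      have h3 := Mpos o (p n) (hp n)
      calc _ = LL o (a n) y / LL o (a n) (p n) * (MM Ω o o (p n))⁻¹ := by
            rw [div_eq_mul_inv]; ring
        _ ≤ _ := by rw [div_eq_mul_inv (MM Ω o y (p n))]; gcongr
  choose! w ξ h1 h2 h3 h4 h5 using hmain
  have heq : ∀ x ∈ interior Ω,
      w x * LL o (ξ x) x * (MM Ω o b x / MM Ω o b o) = Real.exp (2 * φ x) := by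
    intro x hx
    have k1 := (h4 x hx).mul ((hrev x hx).div (hrev o ho) (Mpos b o ho).ne')
    refine tendsto_nhds_unique k1 ?_
    have k2 : Tendsto (fun n => Real.exp (2 * (hilbertDist (interior Ω) x (p n)
      - hilbertDist (interior Ω) o (p n)))) 𝒰 (𝓝 (Real.exp (2 * φ x))) :=
      (Real.continuous_exp.tendsto _).comp ((hφ x hx).const_mul 2)
    refine k2.congr fun n => ?_
    rw [mul_sub, Real.exp_sub, hilbert_eq hcomp hconv ho hx (hp n),
      hilbert_eq hcomp hconv ho ho (hp n)]
    simp only [Pi.div_apply]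
    rw [div_mul_div_comm]
  refine ⟨b, hb, w, ξ, fun x hx => ?_⟩
  have hwpos : 0 < w x := by
    rcases (h2 x hx).lt_or_eq with h | h
    · exact h
    · have := heq x hx
      rw [← h, zero_mul, zero_mul] at this
      exact absurd this (Real.exp_pos _).ne
  refine ⟨h1 x hx, ?_, hwpos, fun y hy => h5 x hx y hy _ (h4 y hy), heq x hx⟩
  exact (mul_eq_zero.1 (h3 x hx)).resolve_left hwpos.ne'

/-- `b` is an apex opposite to the zero face of `a`. -/
def Apex {d : ℕ} (Ω : Set (Euc d)) (o a b : Euc d) : Prop :=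
  ∀ x ∈ interior Ω, ∃ c ∈ Ω, ∃ s : ℝ, 0 < s ∧ s < 1 ∧ x = (1 - s) • b + s • c ∧ LL o a c = 0

structure Edge {d : ℕ} (Ω : Set (Euc d)) (o a a' b b' : Euc d) : Prop where
  ha : a ∈ GG Ω o
  ha' : a' ∈ GG Ω o
  hb : b ∈ Ω
  hb' : b' ∈ Ω
  hab : LL o a b = 0
  hab' : LL o a' b' = 0
  apex' : Apex Ω o a' b
  apex : Apex Ω o a b'
  face : ∀ z ∈ GG Ω o, ∀ c ∈ Ω, LL o z c = 0 → 0 < LL o z b → LL o a c = 0 ∨ LL o a' c = 0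
  face' : ∀ z ∈ GG Ω o, ∀ c ∈ Ω, LL o z c = 0 → 0 < LL o z b' → LL o a c = 0 ∨ LL o a' c = 0

theorem Edge.symm {d : ℕ} {Ω : Set (Euc d)} {o a a' b b' : Euc d} (h : Edge Ω o a a' b b') :
    Edge Ω o a' a b' b :=
  ⟨h.ha', h.ha, h.hb', h.hb, h.hab', h.hab, h.apex, h.apex',
    fun z hz c hc h1 h2 => (h.face' z hz c hc h1 h2).symm,
    fun z hz c hc h1 h2 => (h.face z hz c hc h1 h2).symm⟩

theorem LL_ext {d : ℕ} {Ω : Set (Euc d)} {o a a' : Euc d} (ho : o ∈ interior Ω)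
    (h : ∀ x ∈ interior Ω, LL o a x = LL o a' x) : a = a' := by
  obtain ⟨r, hr, hb⟩ := Metric.isOpen_iff.1 isOpen_interior o ho
  have hc : ContinuousAt (fun s : ℝ => o + s • (a - a')) 0 := by fun_prop
  have h1 : (fun s : ℝ => o + s • (a - a')) ⁻¹' interior Ω ∈ 𝓝 (0 : ℝ) := by
    apply hc
    apply isOpen_interior.mem_nhds
    simpa using ho
  obtain ⟨ε, hε, hb⟩ := Metric.mem_nhds_iff.1 h1
  have h2 : (ε / 2) ∈ ball (0 : ℝ) ε := by
    rw [mem_ball_zero_iff, Real.norm_of_nonneg (by positivity)]; linarith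
  have h3 := h _ (hb h2)
  simp only [LL, add_sub_cancel_left, inner_smul_right] at h3
  have h4 : ε / 2 * ⟪a - a', a - a'⟫ = 0 := by
    rw [inner_sub_left (𝕜 := ℝ) a a' (a - a')]; linarith
  have h5 : ⟪a - a', a - a'⟫ = (0 : ℝ) := (mul_eq_zero.1 h4).resolve_left (by positivity)
  exact sub_eq_zero.1 (inner_self_eq_zero.1 h5)

/-- boundary estimate -/
theorem bdry {d : ℕ} {Ω : Set (Euc d)} {o : Euc d} 
    (hconv : Convex ℝ Ω) (ho : o ∈ interior Ω) {b b' a a' z c : Euc d} {w w' C : ℝ}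
    (hw : 0 < w) (hw' : 0 < w') (ha : a ∈ GG Ω o) (ha' : a' ∈ GG Ω o)
    (hC : ∀ x ∈ interior Ω, w * LL o a x * (w' * LL o a' x) * (MM Ω o b x * MM Ω o b' x) ≤ C)
    (hz : z ∈ GG Ω o) (hc : c ∈ Ω) (hzc : LL o z c = 0) (hzb : 0 < LL o z b) :
    LL o a c = 0 ∨ LL o a' c = 0 := by
  by_contra hcon
  push Not at hcon
  have h1 : 0 < LL o a c := lt_of_le_of_ne (ha c hc) hcon.1.symm
  have h2 : 0 < LL o a' c := lt_of_le_of_ne (ha' c hc) hcon.2.symm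
  have key : ∀ s : ℝ, 0 < s → s < 1 →
      w * ((1 - s) * LL o a c) * (w' * ((1 - s) * LL o a' c)) * LL o z b ≤ C * s := by
    intro s hs hs1
    have hx : (1 - s) • c + s • o ∈ interior Ω := by
      apply hconv.combo_self_interior_mem_interior hc ho <;> linarith
    have e := hC _ hx
    have e1 := le_MM (p := b) ho hx hz
    have e2 := one_le_MM (p := b') ho hx
    rw [LL_comb, hzc, LL_o, mul_zero, zero_add, mul_one] at e1
    rw [LL_comb, LL_comb, LL_o, LL_o] at e
    have hs' : 0 < 1 - s := by linarith
    rw [← div_le_iff₀ hs]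
    refine le_trans ?_ e
    rw [mul_div_assoc]
    have e3 : LL o z b / s ≤ MM Ω o b ((1 - s) • c + s • o) * MM Ω o b' ((1 - s) • c + s • o) := by
      have : 0 ≤ LL o z b / s := by positivity
      nlinarith
    have : 0 ≤ LL o z b / s := by positivity
    gcongr <;> linarith
  have hlim : Tendsto (fun s : ℝ => w * ((1 - s) * LL o a c) * (w' * ((1 - s) * LL o a' c))
      * LL o z b) (𝓝[>] 0) (𝓝 (w * ((1 - 0) * LL o a c) * (w' * ((1 - 0) * LL o a' c))
      * LL o z b)) := by
    apply Tendsto.mono_left _ nhdsWithin_le_nhds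
    apply Continuous.tendsto (f := fun s : ℝ => w * ((1 - s) * LL o a c) *
      (w' * ((1 - s) * LL o a' c)) * LL o z b)
    fun_prop
  have hlim2 : Tendsto (fun s : ℝ => C * s) (𝓝[>] 0) (𝓝 (C * 0)) := by
    apply Tendsto.mono_left _ nhdsWithin_le_nhds
    apply Continuous.tendsto (f := fun s : ℝ => C * s)
    fun_prop
  have hle := le_of_tendsto_of_tendsto hlim hlim2 (by
    filter_upwards [Ioo_mem_nhdsGT (show (0 : ℝ) < 1 by norm_num)] with s hs
    exact key s hs.1 hs.2)
  simp only [sub_zero, one_mul, mul_zero] at hle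
  have : 0 < w * LL o a c * (w' * LL o a' c) * LL o z b := by positivity
  linarith

theorem pair_exit {d : ℕ} {Ω : Set (Euc d)} {o : Euc d} (hcomp : IsCompact Ω)
    (hconv : Convex ℝ Ω) (ho : o ∈ interior Ω) {a b : Euc d} (ha : a ∈ GG Ω o)
    (hab : LL o a b = 0) (P : Set (Euc d))
    (face : ∀ a' ∈ P, ∀ z ∈ GG Ω o, ∀ c ∈ Ω, LL o z c = 0 → 0 < LL o z b →
      LL o a c = 0 ∨ LL o a' c = 0) (x : Euc d) (hx : x ∈ interior Ω) :
    ∃ c ∈ Ω, ∃ s : ℝ, 0 < s ∧ s < 1 ∧ x = (1 - s) • b + s • c ∧ ∀ a' ∈ P, LL o a' c = 0 := by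
  have hbx : b ≠ x := by
    rintro rfl
    exact absurd hab (LL_pos ha hx).ne'
  obtain ⟨c, hc, s, hs0, hs1, e, z, hz, hzc⟩ := exit_pt' hcomp hconv ho hx hbx
  refine ⟨c, hc, s, hs0, hs1, e, fun a' ha' => ?_⟩
  have h1 := LL_pos hz hx
  rw [e, LL_comb, hzc, mul_zero, add_zero] at h1
  have h2 : 0 < LL o z b := by
    by_contra h
    push Not at h
    nlinarith
  refine (face a' ha' z hz c hc hzc h2).resolve_left fun h => ?_
  have h3 := LL_pos ha hx
  rw [e, LL_comb, h, hab] at h3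
  simp at h3

theorem exit_unique {d : ℕ} {Ω : Set (Euc d)} {o : Euc d} (ho : o ∈ interior Ω) {b : Euc d}
    (P : Set (Euc d))
    (h : ∀ x ∈ interior Ω, ∃ c ∈ Ω, ∃ s : ℝ, 0 < s ∧ s < 1 ∧ x = (1 - s) • b + s • c ∧
      ∀ a' ∈ P, LL o a' c = 0) {a1 a2 : Euc d} (h1 : a1 ∈ P) (h2 : a2 ∈ P) : a1 = a2 := by
  apply LL_ext ho
  have key : ∀ x ∈ interior Ω, ∃ r : ℝ, 0 < r ∧ ∀ a ∈ P, LL o a x = r * LL o a b := by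
    intro x hx
    obtain ⟨c, -, s, hs0, hs1, e, hP⟩ := h x hx
    refine ⟨1 - s, by linarith, fun a ha => ?_⟩
    rw [e, LL_comb, hP a ha]; ring
  obtain ⟨r, hr, e⟩ := key o ho
  have e1 := e a1 h1
  have e2 := e a2 h2
  rw [LL_o] at e1 e2
  have e3 : LL o a1 b = LL o a2 b := mul_left_cancel₀ hr.ne' (e1.symm.trans e2)
  intro x hx
  obtain ⟨r', -, e'⟩ := key x hx
  rw [e' a1 h1, e' a2 h2, e3]

theorem apex_MM {d : ℕ} {Ω : Set (Euc d)} {o a b x : Euc d} (ha : a ∈ GG Ω o)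
    (h : Apex Ω o a b) (hx : x ∈ interior Ω) : MM Ω o b x = LL o a b / LL o a x := by
  apply MM_eq ha
  intro z hz
  obtain ⟨c, hc, s, hs0, hs1, e, h0⟩ := h x hx
  have p1 := LL_pos hz hx
  have p2 := LL_pos ha hx
  rw [div_le_div_iff₀ p1 p2]
  have e1 : LL o a x = (1 - s) * LL o a b := by rw [e, LL_comb, h0]; ring
  have e2 : LL o z x = (1 - s) * LL o z b + s * LL o z c := by
    conv_lhs => rw [e, LL_comb]
  rw [e1, e2]
  have h3 : 0 < LL o a b := by
    rw [e1] at p2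
    by_contra hn
    push Not at hn
    nlinarith
  have h4 : 0 ≤ s * LL o z c := mul_nonneg hs0.le (hz c hc)
  nlinarith

theorem pair_edge {d : ℕ} {Ω : Set (Euc d)} {o : Euc d} (hcomp : IsCompact Ω)
    (hconv : Convex ℝ Ω) (ho : o ∈ interior Ω) {b b' : Euc d} (hb : b ∈ Ω) (hb' : b' ∈ Ω)
    {φ φ' : Euc d → ℝ} (hφ : ∀ x ∈ interior Ω, φ x + φ' x = 0) {w w' : Euc d → ℝ}
    {ξ ξ' : Euc d → Euc d}
    (h : ∀ x ∈ interior Ω, ξ x ∈ GG Ω o ∧ LL o (ξ x) b = 0 ∧ 0 < w x ∧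
        (∀ y ∈ interior Ω, w x * LL o (ξ x) y ≤ w y * LL o (ξ y) y) ∧
        w x * LL o (ξ x) x * (MM Ω o b x / MM Ω o b o) = Real.exp (2 * φ x))
    (h' : ∀ x ∈ interior Ω, ξ' x ∈ GG Ω o ∧ LL o (ξ' x) b' = 0 ∧ 0 < w' x ∧
        (∀ y ∈ interior Ω, w' x * LL o (ξ' x) y ≤ w' y * LL o (ξ' y) y) ∧
        w' x * LL o (ξ' x) x * (MM Ω o b' x / MM Ω o b' o) = Real.exp (2 * φ' x)) :
    ∃ a a', Edge Ω o a a' b b' ∧ ∃ K : ℝ, ∀ x ∈ interior Ω,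
      Real.exp (2 * φ x) = K * (LL o a x / LL o a' x) := by
  have Mpos : ∀ x, ∀ y ∈ interior Ω, 0 < MM Ω o x y := fun x y hy =>
    lt_of_lt_of_le one_pos (one_le_MM ho hy)
  have hprod : ∀ x ∈ interior Ω, w x * LL o (ξ x) x * (w' x * LL o (ξ' x) x) *
      (MM Ω o b x * MM Ω o b' x) = MM Ω o b o * MM Ω o b' o := by
    intro x hx
    have e1 := (h x hx).2.2.2.2
    have e2 := (h' x hx).2.2.2.2
    have e3 : Real.exp (2 * φ x) * Real.exp (2 * φ' x) = 1 := by
      rw [← Real.exp_add, ← mul_add, hφ x hx]; simp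
    rw [← e1, ← e2] at e3
    have p1 := (Mpos b o ho).ne'
    have p2 := (Mpos b' o ho).ne'
    field_simp at e3
    linarith
  have hle : ∀ x0 ∈ interior Ω, ∀ x1 ∈ interior Ω, ∀ x ∈ interior Ω,
      w x0 * LL o (ξ x0) x * (w' x1 * LL o (ξ' x1) x) *
      (MM Ω o b x * MM Ω o b' x) ≤ MM Ω o b o * MM Ω o b' o := by
    intro x0 h0 x1 h1 x hx
    rw [← hprod x hx]
    have q1 := (h x0 h0).2.2.2.1 x hx
    have q2 := (h' x1 h1).2.2.2.1 x hx
    have r1 := (h x0 h0).2.2.1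
    have r2 := (h' x1 h1).2.2.1
    have r3 := (h x hx).2.2.1
    have s1 := LL_pos (h x0 h0).1 hx
    have s2 := LL_pos (h' x1 h1).1 hx
    have s3 := LL_pos (h x hx).1 hx
    have t1 := Mpos b x hx
    have t2 := Mpos b' x hx
    gcongr
  have face : ∀ x0 ∈ interior Ω, ∀ x1 ∈ interior Ω, ∀ z ∈ GG Ω o, ∀ c ∈ Ω, LL o z c = 0 →
      0 < LL o z b → LL o (ξ x0) c = 0 ∨ LL o (ξ' x1) c = 0 := by
    intro x0 h0 x1 h1 z hz c hc hzc hzb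
    exact bdry hconv ho (h x0 h0).2.2.1 (h' x1 h1).2.2.1 (h x0 h0).1 (h' x1 h1).1
      (hle x0 h0 x1 h1) hz hc hzc hzb
  have face' : ∀ x0 ∈ interior Ω, ∀ x1 ∈ interior Ω, ∀ z ∈ GG Ω o, ∀ c ∈ Ω, LL o z c = 0 →
      0 < LL o z b' → LL o (ξ x0) c = 0 ∨ LL o (ξ' x1) c = 0 := by
    intro x0 h0 x1 h1 z hz c hc hzc hzb
    exact bdry (b' := b) hconv ho (h x0 h0).2.2.1 (h' x1 h1).2.2.1 (h x0 h0).1 (h' x1 h1).1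
      (fun x hx => by rw [mul_comm (MM Ω o b' x)]; exact hle x0 h0 x1 h1 x hx) hz hc hzc hzb
  have exA := pair_exit hcomp hconv ho (h o ho).1 (h o ho).2.1 (ξ' '' interior Ω) (by
    rintro _ ⟨x1, h1, rfl⟩
    exact face o ho x1 h1)
  have exB := pair_exit hcomp hconv ho (h' o ho).1 (h' o ho).2.1 (ξ '' interior Ω) (by
    rintro _ ⟨x1, h1, rfl⟩ z hz c hc h1' h2
    exact (face' x1 h1 o ho z hz c hc h1' h2).symm)
  have uB : ∀ x ∈ interior Ω, ξ x = ξ o := fun x hx =>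
    exit_unique ho _ exB ⟨x, hx, rfl⟩ ⟨o, ho, rfl⟩
  have apA : Apex Ω o (ξ' o) b := by
    intro x hx
    obtain ⟨c, hc, s, hs0, hs1, e, hP⟩ := exA x hx
    exact ⟨c, hc, s, hs0, hs1, e, hP _ ⟨o, ho, rfl⟩⟩
  have apB : Apex Ω o (ξ o) b' := by
    intro x hx
    obtain ⟨c, hc, s, hs0, hs1, e, hP⟩ := exB x hx
    exact ⟨c, hc, s, hs0, hs1, e, hP _ ⟨o, ho, rfl⟩⟩
  have hwle : ∀ x ∈ interior Ω, ∀ y ∈ interior Ω, w x ≤ w y := by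
    intro x hx y hy
    have := (h x hx).2.2.2.1 y hy
    rw [uB x hx, uB y hy] at this
    exact le_of_mul_le_mul_right this (LL_pos (h o ho).1 hy)
  refine ⟨ξ o, ξ' o, ⟨(h o ho).1, (h' o ho).1, hb, hb', (h o ho).2.1, (h' o ho).2.1, apA, apB,
    face o ho o ho, face' o ho o ho⟩, w o * LL o (ξ' o) b / MM Ω o b o, fun x hx => ?_⟩
  rw [← (h x hx).2.2.2.2, uB x hx, le_antisymm (hwle x hx o ho) (hwle o ho x hx),
    apex_MM (h' o ho).1 apA hx]
  ring

theorem edge_ne {d : ℕ} {Ω : Set (Euc d)} {o : Euc d} (hconv : Convex ℝ Ω)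
    (ho : o ∈ interior Ω) {a a' b b' y e' : Euc d} (h : Edge Ω o a a' b b')
    (hy : y ∈ GG Ω o) (hye : Apex Ω o y e') (hne : y ≠ a') : LL o y b = 0 := by
  by_contra hcon
  have hpos : 0 < LL o y b := lt_of_le_of_ne (hy b h.hb) (Ne.symm hcon)
  have hu : ∀ z : Euc d, (∀ c ∈ Ω, LL o y c = 0 → LL o z c = 0) → y = z := by
    intro z hz
    refine exit_unique (b := e') ho {y, z} ?_ (by simp) (by simp)
    intro x hx
    obtain ⟨c, hc, s, hs0, hs1, e, hP⟩ := hye x hx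
    refine ⟨c, hc, s, hs0, hs1, e, ?_⟩
    rintro _ (rfl | rfl)
    · exact hP
    · exact hz c hc hP
  have hf := fun c hc h1 => h.face y hy c hc h1 hpos
  by_cases h1 : ∀ c ∈ Ω, LL o y c = 0 → LL o a' c = 0
  · exact hne (hu _ h1)
  push Not at h1
  obtain ⟨c1, hc1, hy1, hn1⟩ := h1
  have h2 : y = a := by
    apply hu
    intro c hc hyc
    by_contra hn
    have hm : (1 - (1/2 : ℝ)) • c1 + (1/2 : ℝ) • c ∈ Ω :=
      hconv hc1 hc (by norm_num) (by norm_num) (by norm_num)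
    have p1 : 0 < LL o a' c1 := lt_of_le_of_ne (h.ha' c1 hc1) (Ne.symm hn1)
    have p2 : 0 < LL o a c := lt_of_le_of_ne (h.ha c hc) (Ne.symm hn)
    have p3 := h.ha' c hc
    have p4 := h.ha c1 hc1
    have := hf _ hm (by rw [LL_comb, hy1, hyc]; simp)
    rw [LL_comb, LL_comb] at this
    rcases this with h | h <;> linarith
  exact hcon (h2 ▸ h.hab)

theorem apex_pos {d : ℕ} {Ω : Set (Euc d)} {o a b : Euc d} 
    (ho : o ∈ interior Ω) (h : Apex Ω o a b) : 0 < LL o a b := by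
  obtain ⟨c, hc, s, hs0, hs1, e, h0⟩ := h o ho
  have e1 := LL_comb o a b c s
  rw [← e, h0, LL_o] at e1
  by_contra hn
  push Not at hn
  nlinarith

theorem LL_sum {d : ℕ} {ι : Type*} (s : Finset ι) (w : ι → ℝ) (b : ι → Euc d) (o a : Euc d) :
    ∑ j ∈ s, w j * LL o a (b j) = (∑ j ∈ s, w j) * (1 - ⟪a, o⟫) + ⟪a, ∑ j ∈ s, w j • b j⟫ := by
  rw [inner_sum, Finset.sum_mul, ← Finset.sum_add_distrib]
  refine Finset.sum_congr rfl fun j _ => ?_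
  rw [LL, inner_sub_right, inner_smul_right]
  ring

theorem simplex_of {d : ℕ} (hd : d ≠ 0) {Ω : Set (Euc d)} {o : Euc d} (hconv : Convex ℝ Ω)
    (ho : o ∈ interior Ω) (V : Set (Euc d)) (hV : ∀ a ∈ V, a ∈ GG Ω o) (b : V → Euc d)
    (hb : ∀ i, b i ∈ Ω) (hpos : ∀ i : V, 0 < LL o i (b i))
    (hzero : ∀ i j : V, i ≠ j → LL o i (b j) = 0)
    (hsep : ∀ x ∈ interior Ω, (∀ i ∈ V, ∀ j ∈ V, LL o i x = LL o j x) → x = o) :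
    IsSimplexSet d Ω := by
  have hdiag : ∀ (s : Finset V) (w : V → ℝ), ∀ i ∈ s,
      ∑ j ∈ s, w j * LL o i (b j) = w i * LL o i (b i) := by
    intro s w i hi
    apply Finset.sum_eq_single_of_mem i hi
    intro j _ hji
    rw [hzero i j hji.symm, mul_zero]
  have hind : AffineIndependent ℝ b := by
    rw [affineIndependent_iff]
    intro s w h0 h1 i hi
    have e1 := LL_sum s w b o i
    rw [hdiag s w i hi, h1, h0, zero_mul, inner_zero_right, add_zero] at e1
    exact (mul_eq_zero.1 e1).resolve_right (hpos i).ne'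
  haveI : Finite V := finite_of_fin_dim_affineIndependent ℝ hind
  haveI : Fintype V := Fintype.ofFinite V
  have hfr : Module.finrank ℝ (Euc d) = d := by simp
  have hle : Fintype.card V ≤ d + 1 := by
    have h1 := hind.card_le_finrank_succ
    have h2 := Submodule.finrank_le (vectorSpan ℝ (Set.range b))
    omega
  have htop : vectorSpan ℝ (Set.range (fun i : V => (i : Euc d))) = ⊤ := by
    rw [← Submodule.orthogonal_eq_bot_iff, Submodule.eq_bot_iff]
    intro u hu
    rw [Submodule.mem_orthogonal] at hu
    have hc : ContinuousAt (fun s : ℝ => o + s • u) 0 := by fun_prop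
    have h1 : (fun s : ℝ => o + s • u) ⁻¹' interior Ω ∈ 𝓝 (0 : ℝ) := by
      apply hc
      apply isOpen_interior.mem_nhds
      simpa using ho
    obtain ⟨ε, hε, hb⟩ := Metric.mem_nhds_iff.1 h1
    have h2 : (ε / 2) ∈ ball (0 : ℝ) ε := by
      rw [mem_ball_zero_iff, Real.norm_of_nonneg (by positivity)]; linarith
    have h3 := hsep _ (hb h2) (by
      intro i hi j hj
      have h4 := hu (i - j) (vsub_mem_vectorSpan ℝ ⟨⟨i, hi⟩, rfl⟩ ⟨⟨j, hj⟩, rfl⟩)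
      rw [inner_sub_left] at h4
      simp only [LL, add_sub_cancel_left, inner_smul_right]
      rw [sub_eq_zero.1 h4])
    simp only [add_eq_left, smul_eq_zero] at h3
    exact h3.resolve_left (by positivity)
  have hcard : Fintype.card V = d + 1 := by
    rcases Nat.eq_zero_or_pos (Fintype.card V) with h0 | h0
    · haveI : IsEmpty V := Fintype.card_eq_zero_iff.1 h0
      rw [Set.range_eq_empty, vectorSpan_empty] at htop
      have := congrArg (fun W : Submodule ℝ (Euc d) => Module.finrank ℝ W) htop
      simp at this
      exact absurd this.symm hd
    · have h1 := finrank_vectorSpan_range_le ℝ (fun i : V => (i : Euc d))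
        (n := Fintype.card V - 1) (by omega)
      rw [htop, finrank_top, hfr] at h1
      omega
  have hspan : affineSpan ℝ (Set.range b) = ⊤ := by
    rw [hind.affineSpan_eq_top_iff_card_eq_finrank_add_one, hfr, hcard]
  have e : Fin (d + 1) ≃ V := (Fintype.equivFinOfCardEq hcard).symm
  refine ⟨b ∘ e, (affineIndependent_equiv e).2 hind, ?_⟩
  rw [e.surjective.range_comp]
  apply Set.Subset.antisymm
  · intro x hx
    have hx' : x ∈ affineSpan ℝ (Set.range b) := by rw [hspan]; trivial
    obtain ⟨w, hw, hxw⟩ := eq_affineCombination_of_mem_affineSpan_of_fintype hx'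
    rw [hxw]
    refine affineCombination_mem_convexHull (fun i _ => ?_) hw
    rw [Finset.affineCombination_eq_linear_combination _ _ _ hw] at hxw
    have e1 := LL_sum Finset.univ w b o i
    rw [hdiag _ w i (Finset.mem_univ i), ← hxw, hw] at e1
    have e2 := hV i i.2 x hx
    rw [LL, inner_sub_right] at e2
    by_contra hn
    push Not at hn
    have := hpos i
    nlinarith
  · apply convexHull_min _ hconv
    rintro _ ⟨i, rfl⟩
    exact hb i

section NormPart
variable {E : Type*} [NormedAddCommGroup E] [NormedSpace ℝ E]

theorem norm_horo {v : E} {l : E →L[ℝ] ℝ} (hl : HasFDerivAt (fun x : E => ‖x‖) l v) (z : E) :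
    Tendsto (fun n : ℕ => ‖z - (n : ℝ) • v‖ - n * ‖v‖) atTop (𝓝 (-l z)) := by
  have h1 := hl.lim (-z) (c := fun n : ℕ => (n : ℝ)) (l := atTop) (by
    simpa using tendsto_natCast_atTop_atTop (R := ℝ))
  rw [map_neg] at h1
  refine h1.congr' ?_
  filter_upwards [eventually_gt_atTop 0] with n hn
  have hn' : (0 : ℝ) < n := by exact_mod_cast hn
  rw [smul_eq_mul, mul_sub]
  congr 1
  rw [← norm_neg (z - (n : ℝ) • v)]
  nth_rewrite 1 [← Real.norm_of_nonneg hn'.le]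
  rw [← norm_smul, smul_add, smul_smul, mul_inv_cancel₀ hn'.ne', one_smul]
  congr 1; abel

theorem norm_der_self {v : E} {l : E →L[ℝ] ℝ} (hl : HasFDerivAt (fun x : E => ‖x‖) l v) :
    l v = ‖v‖ := by
  have h := norm_horo hl (-v)
  rw [map_neg, neg_neg] at h
  refine tendsto_nhds_unique h (tendsto_const_nhds.congr fun n => ?_)
  have : -v - (n : ℝ) • v = (-(1 + n) : ℝ) • v := by module
  rw [this, norm_smul, norm_neg, Real.norm_of_nonneg (by positivity)]
  ring

theorem norm_der_le {v : E} {l : E →L[ℝ] ℝ} (hl : HasFDerivAt (fun x : E => ‖x‖) l v) (z : E) :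
    l z ≤ ‖z‖ := by
  have h := norm_horo hl z
  have : -‖z‖ ≤ - l z := by
    refine ge_of_tendsto' h fun n => ?_
    have h1 := norm_sub_norm_le ((n : ℝ) • v) z
    rw [norm_sub_rev z, norm_smul, Real.norm_of_nonneg (by positivity)] at *
    linarith
  linarith

theorem exists_smooth [FiniteDimensional ℝ E] (w : E) (hw : w ≠ 0) :
    ∃ (v : E) (l : E →L[ℝ] ℝ), v ≠ 0 ∧ HasFDerivAt (fun x : E => ‖x‖) l v ∧ l w ≠ 0 := by
  letI : MeasurableSpace E := borel E
  haveI : BorelSpace E := ⟨rfl⟩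
  have h1 : ∀ᵐ x ∂(MeasureTheory.Measure.addHaar : Measure E),
      DifferentiableAt ℝ (fun x : E => ‖x‖) x :=
    (lipschitzWith_one_norm (E := E)).ae_differentiableAt
  have h2 := MeasureTheory.Measure.dense_of_ae h1
  have hn : 0 < ‖w‖ := norm_pos_iff.2 hw
  obtain ⟨v, hv, hd⟩ := h2.exists_dist_lt w (half_pos hn)
  rw [dist_eq_norm] at hd
  have hl := DifferentiableAt.hasFDerivAt hv
  refine ⟨v, _, ?_, hl, ?_⟩
  · rintro rfl
    rw [sub_zero] at hd
    linarith
  · have e1 := norm_der_self hl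
    have e2 := norm_der_le hl (v - w)
    rw [map_sub, e1, norm_sub_rev] at e2
    have e3 := norm_sub_norm_le w v
    intro h0
    rw [h0] at e2
    linarith

end NormPart

theorem sep_edge {d : ℕ} {Ω : Set (Euc d)} {o : Euc d}
    (hcomp : IsCompact Ω) (hconv : Convex ℝ Ω) (ho : o ∈ interior Ω)
    {E : Type*} [NormedAddCommGroup E] [NormedSpace ℝ E] [FiniteDimensional ℝ E]
    (f : interior Ω → E) (hbij : Function.Bijective f)
    (hiso : ∀ p q : interior Ω, ‖f p - f q‖ = hilbertDist (interior Ω) (p : Euc d) (q : Euc d))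
    {x : Euc d} (hx : x ∈ interior Ω) (hxo : x ≠ o) :
    ∃ a a' b b', Edge Ω o a a' b b' ∧ LL o a x ≠ LL o a' x := by
  have hw : f ⟨x, hx⟩ - f ⟨o, ho⟩ ≠ 0 := by
    rw [sub_ne_zero]
    intro h
    exact hxo (congrArg Subtype.val (hbij.1 h))
  obtain ⟨v, l, hv0, hl, hlw⟩ := exists_smooth _ hw
  choose g hg using hbij.2
  set 𝒰 : Ultrafilter ℕ := Ultrafilter.of atTop
  have h𝒰 : (𝒰 : Filter ℕ) ≤ atTop := Ultrafilter.of_le atTop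
  let φ : Euc d → ℝ := fun y => if hy : y ∈ interior Ω then -(l (f ⟨y, hy⟩) - l (f ⟨o, ho⟩)) else 0
  have hvn : 0 < ‖v‖ := norm_pos_iff.2 hv0
  have hinf : ∀ u : E, ‖u‖ = ‖v‖ →
      Tendsto (fun n : ℕ => hilbertDist (interior Ω) o (g ((n : ℝ) • u))) atTop atTop := by
    intro u hu
    have h1 : Tendsto (fun n : ℕ => (n : ℝ) * ‖v‖ - ‖f ⟨o, ho⟩‖) atTop atTop :=
      tendsto_atTop_add_const_right _ _ (tendsto_natCast_atTop_atTop.atTop_mul_const hvn)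
    refine tendsto_atTop_mono (fun n => ?_) h1
    have h2 := hiso ⟨o, ho⟩ (g ((n : ℝ) • u))
    rw [hg] at h2
    simp only at h2
    rw [← h2]
    have h3 := norm_sub_norm_le ((n : ℝ) • u) (f ⟨o, ho⟩)
    rw [norm_sub_rev, norm_smul, hu, Real.norm_of_nonneg (by positivity)] at h3
    exact h3
  have hlim1 : ∀ y ∈ interior Ω, Tendsto (fun n : ℕ =>
      hilbertDist (interior Ω) y (g ((n : ℝ) • v)) -
      hilbertDist (interior Ω) o (g ((n : ℝ) • v))) atTop (𝓝 (φ y)) := by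
    intro y hy
    have h1 := (norm_horo hl (f ⟨y, hy⟩)).sub (norm_horo hl (f ⟨o, ho⟩))
    have e : φ y = -l (f ⟨y, hy⟩) - -l (f ⟨o, ho⟩) := by
      simp only [φ, dif_pos hy]; ring
    rw [e]
    refine h1.congr fun n => ?_
    have h2 := hiso ⟨o, ho⟩ (g ((n : ℝ) • v))
    have h3 := hiso ⟨y, hy⟩ (g ((n : ℝ) • v))
    rw [hg] at h2 h3
    simp only at h2 h3
    rw [← h2, ← h3]; ring
  have hlim2 : ∀ y ∈ interior Ω, Tendsto (fun n : ℕ =>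
      hilbertDist (interior Ω) y (g ((n : ℝ) • (-v))) -
      hilbertDist (interior Ω) o (g ((n : ℝ) • (-v)))) atTop (𝓝 (-φ y)) := by
    intro y hy
    have h1 := (norm_horo hl (-f ⟨y, hy⟩)).sub (norm_horo hl (-f ⟨o, ho⟩))
    have e : -φ y = -l (-f ⟨y, hy⟩) - -l (-f ⟨o, ho⟩) := by
      simp only [φ, dif_pos hy, map_neg]; ring
    rw [e]
    refine h1.congr fun n => ?_
    have h2 := hiso ⟨o, ho⟩ (g ((n : ℝ) • (-v)))
    have h3 := hiso ⟨y, hy⟩ (g ((n : ℝ) • (-v)))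
    rw [hg] at h2 h3
    simp only at h2 h3
    have e4 : ∀ z : E, ‖-z - (n : ℝ) • v‖ = ‖z - (n : ℝ) • (-v)‖ := by
      intro z
      rw [← norm_neg]; congr 1; module
    rw [← h2, ← h3, e4, e4]; ring
  obtain ⟨b, hb, w, ξ, H⟩ := horo hcomp hconv ho 𝒰 (fun n => g ((n : ℝ) • v))
    (fun n => (g ((n : ℝ) • v)).2) ((hinf v rfl).mono_left h𝒰) φ
    (fun y hy => (hlim1 y hy).mono_left h𝒰)
  obtain ⟨b', hb', w', ξ', H'⟩ := horo hcomp hconv ho 𝒰 (fun n => g ((n : ℝ) • (-v)))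
    (fun n => (g ((n : ℝ) • (-v))).2) ((hinf (-v) (norm_neg v)).mono_left h𝒰) (fun y => -φ y)
    (fun y hy => (hlim2 y hy).mono_left h𝒰)
  obtain ⟨a, a', hedge, K, hK⟩ := pair_edge hcomp hconv ho hb hb'
    (fun y _ => add_neg_cancel (φ y)) H H'
  refine ⟨a, a', b, b', hedge, fun heq => hlw ?_⟩
  have e1 := hK x hx
  have e2 := hK o ho
  rw [heq, div_self (LL_pos hedge.ha' hx).ne'] at e1
  rw [LL_o, LL_o, div_one] at e2
  have e3 := Real.exp_injective (e1.trans e2.symm)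
  simp only [φ, dif_pos hx, dif_pos ho] at e3
  rw [map_sub]
  linarith

/-- If the Hilbert geometry on a convex body `Ω ⊆ ℝ^d` is isometric to a
finite-dimensional real normed vector space, then `Ω` is a `d`-simplex. -/
theorem normed_implies_simplex (d : ℕ) (Ω : Set (Euc d))
    (hcomp : IsCompact Ω) (hconv : Convex ℝ Ω) (hint : (interior Ω).Nonempty)
    (E : Type*) [NormedAddCommGroup E] [NormedSpace ℝ E] [FiniteDimensional ℝ E]
    (f : interior Ω → E) (hbij : Function.Bijective f)
    (hiso : ∀ p q : interior Ω, ‖f p - f q‖ = hilbertDist (interior Ω) (p : Euc d) (q : Euc d)) :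
    IsSimplexSet d Ω := by
  obtain ⟨o, ho⟩ := hint
  by_cases hd : d = 0
  · subst hd
    have : Subsingleton (Fin (0 + 1)) := inferInstanceAs (Subsingleton (Fin 1))
    refine ⟨fun _ => o, affineIndependent_of_subsingleton ℝ _, ?_⟩
    ext x
    have hx : x = o := Subsingleton.elim x o
    rw [hx]
    exact ⟨fun _ => subset_convexHull ℝ _ ⟨0, rfl⟩, fun _ => interior_subset ho⟩
  let V : Set (Euc d) := {a' | ∃ a b b', Edge Ω o a a' b b'}
  have hVe : ∀ i : V, ∃ b, ∃ a b', Edge Ω o a i b b' := by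
    rintro ⟨a', a, b, b', h⟩
    exact ⟨b, a, b', h⟩
  choose b a b' hE using hVe
  refine simplex_of hd hconv ho V ?_ b (fun i => (hE i).hb) (fun i => apex_pos ho (hE i).apex')
    ?_ ?_
  · rintro a' ⟨a, b, b', h⟩
    exact h.ha'
  · intro i j hij
    exact edge_ne hconv ho (hE j) (hE i).ha' (hE i).apex' (fun h => hij (Subtype.ext h))
  · intro x hx hall
    by_contra hxo
    obtain ⟨a, a', b, b', he, hne⟩ := sep_edge hcomp hconv ho f hbij hiso hx hxo
    exact hne (hall a ⟨a', b', b, he.symm⟩ a' ⟨a, b, b', he⟩)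

end
end

section
/- Let Ω ⊆ ℝ^d be a bounded open convex set, let y ∈ Ω, and let 0 < l ≤ L be such that the closed Euclidean ball of radius l about y is contained in Ω and Ω is contained in the closed Euclidean ball of radius L about y. Then for every R > 0, AsB_Ω(y, R − (1/2)·log(1 + L/l)) ⊆ B_Ω(y,R) ⊆ AsB_Ω(y,R). -/
open Filter Set MeasureTheory Metric
open scoped ENNReal Topology Pointwise RealInnerProductSpace

noncomputable section
open scoped Classical

theorem line_facts {d : ℕ} (Ω : Set (Euc d)) (hop : IsOpen Ω)
    (y v : Euc d) (hv : v ≠ 0) (l L : ℝ) (hl : 0 < l)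
    (hin : Metric.closedBall y l ⊆ Ω) (hout : Ω ⊆ Metric.closedBall y L) (hq : y + v ∈ Ω) :
    BddAbove {t : ℝ | y + t • v ∈ Ω} ∧ 1 < sSup {t : ℝ | y + t • v ∈ Ω} ∧
      sInf {t : ℝ | y + t • v ∈ Ω} ≤ -(l / ‖v‖) := by
  have hn : 0 < ‖v‖ := norm_pos_iff.mpr hv
  have hbd : ∀ t ∈ {t : ℝ | y + t • v ∈ Ω}, |t| ≤ L / ‖v‖ := by
    intro t ht
    have h := hout ht
    rw [Metric.mem_closedBall, dist_eq_norm, add_sub_cancel_left, norm_smul,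
      Real.norm_eq_abs] at h
    rwa [le_div_iff₀ hn]
  have hA : BddAbove {t : ℝ | y + t • v ∈ Ω} := ⟨L / ‖v‖, fun t ht => (abs_le.mp (hbd t ht)).2⟩
  have hB : BddBelow {t : ℝ | y + t • v ∈ Ω} :=
    ⟨-(L / ‖v‖), fun t ht => (abs_le.mp (hbd t ht)).1⟩
  refine ⟨hA, ?_, ?_⟩
  · have hT : IsOpen {t : ℝ | y + t • v ∈ Ω} :=
      hop.preimage (f := fun t : ℝ => y + t • v) (by fun_prop)
    have h1 : (1 : ℝ) ∈ {t : ℝ | y + t • v ∈ Ω} := by simpa using hq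
    obtain ⟨ε, hε, hs⟩ := Metric.isOpen_iff.mp hT 1 h1
    have h2 : 1 + ε / 2 ∈ {t : ℝ | y + t • v ∈ Ω} := by
      apply hs
      rw [Metric.mem_ball, Real.dist_eq, add_sub_cancel_left, abs_of_pos (by positivity)]
      linarith
    have := le_csSup hA h2
    linarith
  · apply csInf_le hB
    apply hin
    rw [Metric.mem_closedBall, dist_eq_norm, add_sub_cancel_left, norm_smul,
      Real.norm_eq_abs, abs_neg, abs_of_pos (by positivity), div_mul_cancel₀ _ hn.ne']

/-- For a bounded open convex set `Ω`, `y ∈ Ω`, with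
`closedBall y l ⊆ Ω ⊆ closedBall y L`, the Hilbert ball of radius `R > 0` is squeezed
between the asymptotic balls of radii `R - (1/2)·log(1 + L/l)` and `R`. -/
theorem asympBall_subset_hilbertBall_subset (d : ℕ) (Ω : Set (Euc d))
    (hop : IsOpen Ω) (hb : Bornology.IsBounded Ω) (hconv : Convex ℝ Ω)
    (y : Euc d) (hy : y ∈ Ω) (l L : ℝ) (hl : 0 < l) (hlL : l ≤ L)
    (hin : Metric.closedBall y l ⊆ Ω) (hout : Ω ⊆ Metric.closedBall y L)
    (R : ℝ) (hR : 0 < R) :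
    asympBall Ω y (R - (1 / 2) * Real.log (1 + L / l)) ⊆ hilbertBall Ω y R ∧
    hilbertBall Ω y R ⊆ asympBall Ω y R := by
  constructor
  · intro q hq
    unfold asympBall at hq
    split_ifs at hq with hpos
    · obtain ⟨u, hu, rfl⟩ := hq
      have hc : Real.exp (-2 * (R - (1 / 2) * Real.log (1 + L / l)))
          = Real.exp (-2 * R) * (1 + L / l) := by
        have : 0 < 1 + L / l := by have : 0 < L := hl.trans_le hlL; positivity
        rw [show -2 * (R - (1 / 2) * Real.log (1 + L / l)) = -2 * R + Real.log (1 + L / l) by ring,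
          Real.exp_add, Real.exp_log this]
      have he1 : Real.exp (-2 * (R - (1 / 2) * Real.log (1 + L / l))) < 1 :=
        Real.exp_lt_one_iff.mpr (by linarith)
      have he0 := Real.exp_pos (-2 * (R - (1 / 2) * Real.log (1 + L / l)))
      set e := Real.exp (-2 * (R - (1 / 2) * Real.log (1 + L / l))) with he
      have hq : y + (1 - e) • (u - y) ∈ Ω :=
        hconv.add_smul_sub_mem hy hu ⟨by linarith, by linarith⟩
      refine ⟨hq, ?_⟩
      simp only [hilbertDist, add_sub_cancel_left]
      split_ifs with hyq
      · exact hR.le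
      have hv : (1 - e) • (u - y) ≠ 0 := by
        intro h
        apply hyq
        simp [h]
      obtain ⟨hA, hb1, ha⟩ := line_facts Ω hop y _ hv l L hl hin hout hq
      have hbs : 1 / (1 - e) ≤ sSup {t : ℝ | y + t • (1 - e) • (u - y) ∈ Ω} := by
        apply le_csSup hA
        have : (1 - e) ≠ 0 := by linarith
        simp only [Set.mem_ofPred_eq, smul_smul, one_div, inv_mul_cancel₀ this, one_smul]
        simpa using hu
      have hvL : ‖(1 - e) • (u - y)‖ ≤ L := by
        have h := hout hq
        rwa [Metric.mem_closedBall, dist_eq_norm, add_sub_cancel_left] at h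
      have hn : 0 < ‖(1 - e) • (u - y)‖ := norm_pos_iff.mpr hv
      generalize ‖(1 - e) • (u - y)‖ = n at *
      generalize sSup {t : ℝ | y + t • (1 - e) • (u - y) ∈ Ω} = b at *
      generalize sInf {t : ℝ | y + t • (1 - e) • (u - y) ∈ Ω} = a at *
      have hL : 0 < L := hl.trans_le hlL
      have haL : l / L ≤ -a := by
        have : l / L ≤ l / n := by gcongr
        linarith
      have hlL0 : 0 < l / L := by positivity
      have ha0 : 0 < -a := by linarith
      have h1 : (1 - a) / (-a) ≤ 1 + L / l := by
        rw [div_le_iff₀ ha0]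
        have : L / l * (l / L) ≤ L / l * (-a) := by gcongr
        have h3 : L / l * (l / L) = 1 := by field_simp
        nlinarith
      have h2 : b / (b - 1) ≤ 1 / e := by
        rw [div_le_div_iff₀ (by linarith) he0]
        rw [div_le_iff₀ (by linarith)] at hbs
        nlinarith
      have h3 : (1 - a) / (-a) * (b / (b - 1)) ≤ Real.exp (2 * R) := by
        calc (1 - a) / (-a) * (b / (b - 1)) ≤ (1 + L / l) * (1 / e) := by
              gcongr
          _ = Real.exp (2 * R) := by
              rw [hc, show -2 * R = -(2 * R) by ring, Real.exp_neg]
              have := Real.exp_pos (2 * R)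
              have : 1 + L / l ≠ 0 := by positivity
              field_simp
      have h4 : 0 < (1 - a) / (-a) * (b / (b - 1)) :=
        mul_pos (div_pos (by linarith) ha0) (div_pos (by linarith) (by linarith))
      have := (Real.log_le_iff_le_exp h4).mpr h3
      linarith
    · exact hq.elim
  · rintro q ⟨hq, hd⟩
    unfold asympBall
    rw [if_pos hR]
    have he1 : Real.exp (-2 * R) < 1 := Real.exp_lt_one_iff.mpr (by linarith)
    have hee : Real.exp (-2 * R) * Real.exp (2 * R) = 1 := by
      rw [← Real.exp_add]; simp
    have he0 := Real.exp_pos (-2 * R)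
    by_cases hyq : y = q
    · exact ⟨y, hy, by simp [hyq]⟩
    rw [hilbertDist, if_neg hyq] at hd
    have hv : q - y ≠ 0 := fun h => hyq (sub_eq_zero.mp h).symm
    obtain ⟨hA, hb1, ha⟩ := line_facts Ω hop y _ hv l L hl hin hout (by simpa using hq)
    have hs : 1 - Real.exp (-2 * R) ≠ 0 := by linarith
    refine ⟨y + (1 / (1 - Real.exp (-2 * R))) • (q - y), ?_, ?_⟩
    swap
    · simp only [add_sub_cancel_left, smul_smul, mul_one_div_cancel hs, one_smul, add_sub_cancel]
    have hkey : 1 / (1 - Real.exp (-2 * R)) < sSup {t : ℝ | y + t • (q - y) ∈ Ω} := by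
      have hn : 0 < l / ‖q - y‖ := div_pos hl (norm_pos_iff.mpr hv)
      generalize sSup {t : ℝ | y + t • (q - y) ∈ Ω} = b at *
      generalize sInf {t : ℝ | y + t • (q - y) ∈ Ω} = a at *
      have ha0 : 0 < -a := by linarith
      have hb0 : 0 < b / (b - 1) := div_pos (by linarith) (by linarith)
      have h4 : 0 < (1 - a) / (-a) * (b / (b - 1)) :=
        mul_pos (div_pos (by linarith) ha0) hb0
      have h3 := (Real.log_le_iff_le_exp (y := 2 * R) h4).mp (by linarith)
      have h1 : 1 < (1 - a) / (-a) := by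
        rw [lt_div_iff₀ ha0]; linarith
      have h2 : b / (b - 1) < Real.exp (2 * R) := by nlinarith
      rw [div_lt_iff₀ (by linarith)] at h2
      rw [div_lt_iff₀ (by linarith)]
      have h5 := mul_lt_mul_of_pos_left h2 he0
      rw [← mul_assoc, hee] at h5
      linarith
    obtain ⟨t, ht, hlt⟩ := exists_lt_of_lt_csSup ⟨0, by simpa using hy⟩ hkey
    have hr0 : 0 < 1 / (1 - Real.exp (-2 * R)) := by
      apply one_div_pos.mpr; linarith
    generalize 1 / (1 - Real.exp (-2 * R)) = r at *
    have ht0 : 0 < t := by linarith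
    have h := hconv.add_smul_sub_mem hy ht (t := r / t)
      ⟨by positivity, (div_le_one ht0).mpr hlt.le⟩
    rwa [add_sub_cancel_left, smul_smul, div_mul_cancel₀ _ ht0.ne'] at h

end
end
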